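/- (Bombieri–Vinogradov) For every A > 0 there exist B = B(A) and C = C(A) such that for every real X ≥ 2, ∑_{q ≤ X^{1/2} (log X)^{−B}} max_{a : gcd(a,q)=1} |ψ(X; q, a) − ψ(X; q)/φ(q)| ≤ C X (log X)^{−A}. -/

import Mathlib

namespace BombieriVinogradov

open Finset

/-- The additive character `x ↦ exp (2 * π * I * x)` of the real line. -/
noncomputable def ee (x : ℝ) : ℂ := Complex.exp (2 * Real.pi * x * Complex.I)

lemma ee_add (x y : ℝ) : ee (x + y) = ee x * ee y := by
  rw [ee, ee, ee, ← Complex.exp_add]; congr 1; push_cast; ring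

lemma norm_ee (x : ℝ) : ‖ee x‖ = 1 := by
  have := Complex.norm_exp_ofReal_mul_I (2 * Real.pi * x)
  rw [ee]; push_cast at this; exact this

lemma ee_zero : ee 0 = 1 := by simp [ee]

lemma ee_int (n : ℤ) : ee n = 1 := by
  rw [ee, Complex.exp_eq_one_iff]; exact ⟨n, by push_cast; ring⟩

lemma ee_neg (x : ℝ) : ee (-x) = starRingEnd ℂ (ee x) := by
  rw [ee, ee, ← Complex.exp_conj]; congr 1
  simp only [map_mul, Complex.conj_ofReal, Complex.conj_I, Complex.ofReal_neg, map_ofNat]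
  ring

lemma ee_nat_mul (n : ℕ) (x : ℝ) : ee (n * x) = ee x ^ n := by
  rw [ee, ee, ← Complex.exp_nat_mul]; congr 1; push_cast; ring

lemma norm_ee_sub_one (x : ℝ) : ‖ee x - 1‖ = 2 * |Real.sin (Real.pi * x)| := by
  have h := Complex.norm_exp_I_mul_ofReal_sub_one (2 * Real.pi * x)
  rw [ee, show (2 * Real.pi * x * Complex.I : ℂ) = Complex.I * ((2 * Real.pi * x : ℝ) : ℂ) by
    push_cast; ring, h, norm_mul, Real.norm_eq_abs, Real.norm_eq_abs]
  norm_num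
  congr 1; ring_nf

lemma norm_ee_sub_one_ge {f : ℝ} (h0 : 0 < f) (h1 : f < 1) :
    4 * min f (1 - f) ≤ ‖ee f - 1‖ := by
  rw [norm_ee_sub_one]
  have key : ∀ g : ℝ, 0 < g → g ≤ 1 / 2 → 2 * g ≤ Real.sin (Real.pi * g) := by
    intro g hg hg'
    have := Real.mul_le_sin (x := Real.pi * g) (by positivity)
      (by nlinarith [Real.pi_pos])
    calc 2 * g = 2 / Real.pi * (Real.pi * g) := by field_simp
      _ ≤ _ := this
  rcases le_total f (1 / 2) with h | h
  · rw [min_eq_left (by linarith)]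
    have := key f h0 h
    linarith [le_abs_self (Real.sin (Real.pi * f))]
  · rw [min_eq_right (by linarith)]
    have := key (1 - f) (by linarith) (by linarith)
    have h2 : Real.sin (Real.pi * (1 - f)) = Real.sin (Real.pi * f) := by
      rw [mul_sub, mul_one, Real.sin_pi_sub]
    rw [h2] at this
    linarith [le_abs_self (Real.sin (Real.pi * f))]

/-- The geometric sum bound for exponential sums. -/
lemma norm_sum_ee_le {f : ℝ} (h0 : 0 < f) (h1 : f < 1) (N : ℕ) :
    ‖∑ n ∈ range N, ee (n * f)‖ ≤ (1 / 2) * (1 / f + 1 / (1 - f)) := by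
  have hm : 0 < min f (1 - f) := lt_min h0 (by linarith)
  have hge := norm_ee_sub_one_ge h0 h1
  have hne : ee f ≠ 1 := by
    intro h; rw [h] at hge; rw [sub_self, norm_zero] at hge; linarith
  simp_rw [ee_nat_mul]
  rw [geom_sum_eq hne, norm_div]
  have hnum : ‖ee f ^ N - 1‖ ≤ 2 := by
    calc _ ≤ ‖ee f ^ N‖ + ‖(1 : ℂ)‖ := norm_sub_le _ _
      _ = 2 := by rw [norm_pow, norm_ee]; norm_num
  calc _ ≤ 2 / (4 * min f (1 - f)) := by gcongr
    _ = (1 / 2) * (1 / min f (1 - f)) := by field_simp; norm_num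
    _ ≤ _ := by
      gcongr
      rcases min_choice f (1 - f) with h | h <;> rw [h]
      · have : 0 < 1 / (1 - f) := by rw [h] at hm; exact one_div_pos.2 (by linarith)
        linarith
      · have : 0 < 1 / f := by positivity
        linarith

/-- Fourier coefficients on `ℤ / N` of the indicator function of `[0, Y)`. -/
noncomputable def cutCoeff (N Y k : ℕ) : ℂ :=
  (1 / N : ℂ) * ∑ l ∈ range Y, ee (-(k * l / N : ℝ))

/-- A majorant of `cutCoeff` that does not depend on the cutoff. -/
noncomputable def cutBound (N k : ℕ) : ℝ :=
  if k = 0 then 1 else (1 / 2) * (1 / (k : ℝ) + 1 / ((N : ℝ) - k))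

lemma norm_cutCoeff_le {N Y k : ℕ} (hY : Y ≤ N) (hk : k < N) :
    ‖cutCoeff N Y k‖ ≤ cutBound N k := by
  have hN : 0 < (N : ℝ) := by exact_mod_cast (by omega : 0 < N)
  rw [cutCoeff, cutBound, norm_mul]
  have e1 : ‖(1 / N : ℂ)‖ = 1 / N := by simp
  rw [e1]
  split_ifs with h
  · subst h
    simp only [Nat.cast_zero, zero_mul, zero_div, neg_zero, ee_zero, sum_const, card_range,
      nsmul_eq_mul, mul_one, Complex.norm_natCast]
    rw [one_div_mul_eq_div, div_le_one hN]; exact_mod_cast hY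
  · have hk0 : 0 < (k : ℝ) := by exact_mod_cast Nat.pos_of_ne_zero h
    have hkN : (k : ℝ) < N := by exact_mod_cast hk
    have h2 : ‖∑ l ∈ range Y, ee (-(k * l / N : ℝ))‖ = ‖∑ l ∈ range Y, ee (l * (k / N : ℝ))‖ := by
      rw [← Complex.norm_conj, map_sum]
      congr 1; apply sum_congr rfl; intro l _
      rw [← ee_neg]; congr 1; ring
    rw [h2]
    have h3 := norm_sum_ee_le (f := (k / N : ℝ)) (by positivity) (by rw [div_lt_one hN]; exact hkN) Y
    have h4 : 0 < (N : ℝ) - k := by linarith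
    calc _ ≤ 1 / (N : ℝ) * (1 / 2 * (1 / (k / N : ℝ) + 1 / (1 - k / N))) := by gcongr
      _ = _ := by
        have : (1 : ℝ) - k / N = (N - k) / N := by field_simp
        rw [this]; field_simp

lemma cutBound_nonneg {N k : ℕ} (hk : k < N) : 0 ≤ cutBound N k :=
  (norm_nonneg _).trans (norm_cutCoeff_le (Nat.zero_le N) hk)

lemma sum_ee_div (N : ℕ) (j : ℤ) (hj0 : j ≠ 0) (hj : |j| < N) :
    ∑ k ∈ range N, ee (k * (j / N : ℝ)) = 0 := by
  have hNp : 0 < N := by have := abs_nonneg j; omega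
  have hN : (N : ℝ) ≠ 0 := by exact_mod_cast hNp.ne'
  have hne : ee (j / N : ℝ) ≠ 1 := by
    rw [ee, Ne, Complex.exp_eq_one_iff]
    rintro ⟨m, hm⟩
    have h1 : ((j / N : ℝ) : ℂ) = ((m : ℝ) : ℂ) := by
      have h0 : (2 * Real.pi * Complex.I : ℂ) ≠ 0 := Complex.two_pi_I_ne_zero
      apply mul_left_cancel₀ h0
      rw [show (2 * Real.pi * Complex.I * ((j / N : ℝ) : ℂ)) = 2 * Real.pi * ((j / N : ℝ) : ℂ) * Complex.I by ring, hm]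
      push_cast; ring
    have h2 : (j : ℝ) / N = m := by exact_mod_cast h1
    have h3 : (j : ℝ) = m * N := by field_simp at h2; linarith
    have h4 : j = m * N := by exact_mod_cast h3
    have : m ≠ 0 := by rintro rfl; simp at h4; exact hj0 h4
    have : (1 : ℤ) ≤ |m| := Int.one_le_abs this
    rw [h4, abs_mul, Nat.abs_cast] at hj
    nlinarith
  simp_rw [ee_nat_mul]
  rw [geom_sum_eq hne, ← ee_nat_mul]
  have : (N : ℝ) * (j / N) = (j : ℝ) := by field_simp
  rw [this, ee_int]; simp

/-- Finite Fourier expansion of a cutoff. -/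
lemma indicator_eq_sum_cutCoeff {N Y n : ℕ} (hY : Y ≤ N) (hn : n < N) :
    (if n < Y then (1 : ℂ) else 0) = ∑ k ∈ range N, cutCoeff N Y k * ee (k * n / N : ℝ) := by
  have hNp : 0 < N := by omega
  have hN : (N : ℂ) ≠ 0 := by exact_mod_cast hNp.ne'
  have h1 : ∀ k ∈ range N, cutCoeff N Y k * ee (k * n / N : ℝ) =
      (1 / N : ℂ) * ∑ l ∈ range Y, ee (k * (((n - l : ℤ) : ℝ) / N)) := by
    intro k _
    rw [cutCoeff, mul_assoc, sum_mul]
    congr 1; apply sum_congr rfl; intro l _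
    rw [← ee_add]; congr 1; push_cast; ring
  rw [sum_congr rfl h1, ← mul_sum, sum_comm]
  have h2 : ∀ l ∈ range Y, ∑ k ∈ range N, ee (k * (((n - l : ℤ) : ℝ) / N)) =
      if n = l then (N : ℂ) else 0 := by
    intro l hl
    rw [mem_range] at hl
    split_ifs with h
    · subst h; simp [ee_zero]
    · apply sum_ee_div
      · omega
      · rw [abs_lt]; omega
  rw [sum_congr rfl h2, sum_ite_eq]
  simp only [mem_range]
  split_ifs
  · field_simp
  · simp

lemma harmonic_le (N : ℕ) : ∑ k ∈ range N, 1 / ((k : ℝ) + 1) ≤ 1 + Real.log N := by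
  have := harmonic_le_one_add_log N
  refine le_trans (le_of_eq ?_) this
  rw [harmonic]; push_cast; simp

lemma sum_cutBound_le (N : ℕ) : ∑ k ∈ range N, cutBound N k ≤ 2 + Real.log N := by
  cases N with
  | zero => simp
  | succ M =>
    rw [sum_range_succ']
    have h1 : ∑ k ∈ range M, cutBound (M + 1) (k + 1) =
        (1 / 2) * (∑ k ∈ range M, 1 / ((k : ℝ) + 1) + ∑ k ∈ range M, 1 / ((M : ℝ) - k)) := by
      rw [← sum_add_distrib, mul_sum]
      apply sum_congr rfl; intro k _
      simp [cutBound]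
    have h2 : ∑ k ∈ range M, 1 / ((M : ℝ) - k) = ∑ k ∈ range M, 1 / ((k : ℝ) + 1) := by
      rw [← sum_range_reflect]
      apply sum_congr rfl; intro k hk
      rw [mem_range] at hk
      rw [Nat.cast_sub (by omega), Nat.cast_sub (by omega)]; push_cast; congr 1; ring
    rw [h1, h2]
    have h3 := harmonic_le M
    have h4 : Real.log M ≤ Real.log ((M + 1 : ℕ) : ℝ) := by
      rcases Nat.eq_zero_or_pos M with h | h
      · subst h; simp
      · apply Real.log_le_log (by exact_mod_cast h); push_cast; linarith
    have h5 : cutBound (M + 1) 0 = 1 := by simp [cutBound]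
    rw [h5]; linarith

end BombieriVinogradov

namespace BombieriVinogradov

open Finset

/-- A bound for `∑_{j ≠ i} 1 / {α_j - α_i}` over well spaced points. -/
lemma sum_inv_fract_le {ι : Type*} [DecidableEq ι] (s : Finset ι) (α : ι → ℝ) {δ : ℝ} (hδ : 0 < δ)
    (hsp : ∀ i ∈ s, ∀ j ∈ s, i ≠ j → ∀ m : ℤ, δ ≤ |α i - α j - m|) {i : ι} (hi : i ∈ s) :
    ∑ j ∈ s.erase i, 1 / Int.fract (α j - α i) ≤ δ⁻¹ * (1 + Real.log ⌊δ⁻¹⌋₊) := by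
  set m : ι → ℕ := fun j => ⌊Int.fract (α j - α i) / δ⌋₊ with hm
  have hge : ∀ j ∈ s.erase i, δ ≤ Int.fract (α j - α i) := by
    intro j hj
    have h := hsp j (mem_of_mem_erase hj) i hi (ne_of_mem_erase hj) ⌊α j - α i⌋
    rwa [Int.self_sub_floor, abs_of_nonneg (Int.fract_nonneg _)] at h
  have hm1 : ∀ j ∈ s.erase i, 1 ≤ m j := by
    intro j hj
    apply Nat.le_floor
    rw [Nat.cast_one, one_le_div hδ]; exact hge j hj
  have hmle : ∀ j ∈ s.erase i, m j ≤ ⌊δ⁻¹⌋₊ := by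
    intro j _
    apply Nat.floor_le_floor
    rw [← one_div]
    gcongr
    exact (Int.fract_lt_one _).le
  have hinj : Set.InjOn (fun j => m j - 1) (s.erase i) := by
    intro j hj k hk hjk
    by_contra hne
    have h1 := hm1 j hj
    have h2 := hm1 k hk
    have hmm : m j = m k := by simp only at hjk; omega
    have hfl : ∀ l : ι, (m l : ℝ) * δ ≤ Int.fract (α l - α i) ∧
        Int.fract (α l - α i) < (m l + 1) * δ := by
      intro l
      have h0 : 0 ≤ Int.fract (α l - α i) / δ := div_nonneg (Int.fract_nonneg _) hδ.le
      exact ⟨(le_div_iff₀ hδ).1 (Nat.floor_le h0), (div_lt_iff₀ hδ).1 (Nat.lt_floor_add_one _)⟩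
    have hj' := hfl j
    have hk' := hfl k
    rw [hmm] at hj'
    have h3 := hsp j (mem_of_mem_erase hj) k (mem_of_mem_erase hk) hne
      (⌊α j - α i⌋ - ⌊α k - α i⌋)
    have h4 : α j - α k - ((⌊α j - α i⌋ - ⌊α k - α i⌋ : ℤ) : ℝ) =
        Int.fract (α j - α i) - Int.fract (α k - α i) := by
      rw [Int.fract, Int.fract]; push_cast; ring
    rw [h4] at h3
    have : |Int.fract (α j - α i) - Int.fract (α k - α i)| < δ := by
      rw [abs_lt]; constructor <;> linarith [hj'.1, hj'.2, hk'.1, hk'.2]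
    linarith
  calc ∑ j ∈ s.erase i, 1 / Int.fract (α j - α i)
      ≤ ∑ j ∈ s.erase i, δ⁻¹ * (1 / (((m j - 1 : ℕ) : ℝ) + 1)) := by
        apply sum_le_sum; intro j hj
        have h1 := hm1 j hj
        have hc : (((m j - 1 : ℕ) : ℝ) + 1) = m j := by rw [Nat.cast_sub h1]; push_cast; ring
        have h0 : 0 ≤ Int.fract (α j - α i) / δ := div_nonneg (Int.fract_nonneg _) hδ.le
        have h2 : (m j : ℝ) * δ ≤ Int.fract (α j - α i) := (le_div_iff₀ hδ).1 (Nat.floor_le h0)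
        have h3 : (0 : ℝ) < m j := by exact_mod_cast h1
        rw [hc]
        calc 1 / Int.fract (α j - α i) ≤ 1 / (m j * δ) := by gcongr
          _ = _ := by field_simp
    _ = δ⁻¹ * ∑ k ∈ (s.erase i).image (fun j => m j - 1), 1 / ((k : ℝ) + 1) := by
        rw [sum_image hinj, mul_sum]
    _ ≤ δ⁻¹ * ∑ k ∈ range ⌊δ⁻¹⌋₊, 1 / ((k : ℝ) + 1) := by
        gcongr
        intro k hk
        obtain ⟨j, hj, rfl⟩ := mem_image.1 hk
        have := hm1 j hj
        have := hmle j hj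
        rw [mem_range]; omega
    _ ≤ _ := by gcongr; exact harmonic_le _

lemma norm_sum_ee_sub_le (x y : ℝ) (h : 0 < Int.fract (x - y)) (N : ℕ) :
    ‖∑ n ∈ range N, ee (n * (x - y))‖ ≤
      (1 / 2) * (1 / Int.fract (x - y) + 1 / Int.fract (y - x)) := by
  have h1 : Int.fract (y - x) = 1 - Int.fract (x - y) := by
    rw [← neg_sub, Int.fract_neg h.ne']
  have h2 : ∀ n ∈ range N, ee (n * (x - y)) = ee (n * Int.fract (x - y)) := by
    intro n _
    have : (n : ℝ) * (x - y) = n * Int.fract (x - y) + ((n * ⌊x - y⌋ : ℤ) : ℝ) := by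
      rw [Int.fract]; push_cast; ring
    rw [this, ee_add, ee_int, mul_one]
  rw [sum_congr rfl h2, h1]
  exact norm_sum_ee_le h (Int.fract_lt_one _) N

/-- The dual form of the large sieve inequality. -/
lemma large_sieve_dual {ι : Type*} [DecidableEq ι] (s : Finset ι) (α : ι → ℝ) {δ : ℝ} (hδ : 0 < δ)
    (hsp : ∀ i ∈ s, ∀ j ∈ s, i ≠ j → ∀ m : ℤ, δ ≤ |α i - α j - m|) (N : ℕ) (c : ι → ℂ) :
    ∑ n ∈ range N, ‖∑ i ∈ s, c i * ee (n * α i)‖ ^ 2 ≤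
      (N + δ⁻¹ * (1 + Real.log ⌊δ⁻¹⌋₊)) * ∑ i ∈ s, ‖c i‖ ^ 2 := by
  set D := δ⁻¹ * (1 + Real.log ⌊δ⁻¹⌋₊) with hD
  set K : ι → ι → ℝ := fun i j => ‖∑ n ∈ range N, ee (n * (α i - α j))‖ with hK
  have hKsymm : ∀ i j, K i j = K j i := by
    intro i j
    simp only [hK]
    rw [← Complex.norm_conj, map_sum]
    congr 1; apply sum_congr rfl; intro n _
    rw [← ee_neg]; congr 1; ring
  have hKsum : ∀ i ∈ s, ∑ j ∈ s, K i j ≤ N + D := by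
    intro i hi
    rw [← add_sum_erase s _ hi]
    have h1 : K i i = N := by simp [hK, ee_zero]
    have hfr : ∀ j ∈ s.erase i, 0 < Int.fract (α i - α j) := by
      intro j hj
      have h := hsp i hi j (mem_of_mem_erase hj) (ne_of_mem_erase hj).symm ⌊α i - α j⌋
      rw [Int.self_sub_floor, abs_of_nonneg (Int.fract_nonneg _)] at h
      linarith
    have h2 : ∑ j ∈ s.erase i, K i j ≤ (1 / 2) * (∑ j ∈ s.erase i, 1 / Int.fract (α i - α j) +
        ∑ j ∈ s.erase i, 1 / Int.fract (α j - α i)) := by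
      rw [← sum_add_distrib, mul_sum]
      exact sum_le_sum fun j hj => norm_sum_ee_sub_le _ _ (hfr j hj) N
    have h3 := sum_inv_fract_le s α hδ hsp hi
    have h4 := sum_inv_fract_le s (fun j => - α j) hδ (by
      intro i hi j hj hij m
      have := hsp i hi j hj hij (-m)
      rw [← abs_neg] at this
      convert this using 2; push_cast; ring) hi
    have h5 : ∀ j, - α j - - α i = α i - α j := by intro j; ring
    simp only [h5] at h4
    linarith
  have hexp : ((∑ n ∈ range N, ‖∑ i ∈ s, c i * ee (n * α i)‖ ^ 2 : ℝ) : ℂ) =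
      ∑ i ∈ s, ∑ j ∈ s, c i * starRingEnd ℂ (c j) * ∑ n ∈ range N, ee (n * (α i - α j)) := by
    push_cast
    have : ∀ n ∈ range N, ((‖∑ i ∈ s, c i * ee (n * α i)‖ : ℂ)) ^ 2 =
        ∑ i ∈ s, ∑ j ∈ s, c i * starRingEnd ℂ (c j) * ee (n * (α i - α j)) := by
      intro n _
      rw [← Complex.mul_conj', map_sum, sum_mul_sum]
      apply sum_congr rfl; intro i _; apply sum_congr rfl; intro j _
      rw [map_mul, ← ee_neg, show (n : ℝ) * (α i - α j) = n * α i + -(n * α j) by ring, ee_add]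
      ring
    rw [sum_congr rfl this, sum_comm]
    apply sum_congr rfl; intro i _
    rw [sum_comm]
    apply sum_congr rfl; intro j _
    rw [mul_sum]
  have hle : ∑ n ∈ range N, ‖∑ i ∈ s, c i * ee (n * α i)‖ ^ 2 ≤
      ∑ i ∈ s, ∑ j ∈ s, ‖c i‖ * ‖c j‖ * K i j := by
    have h0 : 0 ≤ ∑ n ∈ range N, ‖∑ i ∈ s, c i * ee (n * α i)‖ ^ 2 :=
      sum_nonneg fun _ _ => by positivity
    rw [← abs_of_nonneg h0, ← Real.norm_eq_abs, ← Complex.norm_real, hexp]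
    refine (norm_sum_le _ _).trans (sum_le_sum fun i _ => (norm_sum_le _ _).trans
      (sum_le_sum fun j _ => ?_))
    rw [norm_mul, norm_mul, Complex.norm_conj]
  refine hle.trans ?_
  calc ∑ i ∈ s, ∑ j ∈ s, ‖c i‖ * ‖c j‖ * K i j
      ≤ ∑ i ∈ s, ∑ j ∈ s, ((1 / 2) * (‖c i‖ ^ 2 * K i j) + (1 / 2) * (‖c j‖ ^ 2 * K j i)) := by
        apply sum_le_sum; intro i _; apply sum_le_sum; intro j _
        have hK0 : 0 ≤ K i j := norm_nonneg _
        rw [hKsymm j i]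
        nlinarith [sq_nonneg (‖c i‖ - ‖c j‖), mul_nonneg hK0 (sq_nonneg (‖c i‖ - ‖c j‖))]
    _ = ∑ i ∈ s, ‖c i‖ ^ 2 * ∑ j ∈ s, K i j := by
        simp_rw [sum_add_distrib]
        rw [sum_comm (f := fun i j => (1 / 2) * (‖c j‖ ^ 2 * K j i)), ← sum_add_distrib]
        apply sum_congr rfl; intro i _
        rw [← mul_sum, ← mul_sum]; ring
    _ ≤ ∑ i ∈ s, ‖c i‖ ^ 2 * (N + D) := by
        apply sum_le_sum; intro i hi
        exact mul_le_mul_of_nonneg_left (hKsum i hi) (by positivity)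
    _ = _ := by rw [← sum_mul]; ring

/-- The large sieve inequality for well spaced points (with a logarithmic loss). -/
theorem large_sieve_points {ι : Type*} [DecidableEq ι] (s : Finset ι) (α : ι → ℝ) {δ : ℝ}
    (hδ : 0 < δ) (hsp : ∀ i ∈ s, ∀ j ∈ s, i ≠ j → ∀ m : ℤ, δ ≤ |α i - α j - m|) (N : ℕ)
    (a : ℕ → ℂ) :
    ∑ i ∈ s, ‖∑ n ∈ range N, a n * ee (n * α i)‖ ^ 2 ≤
      (N + δ⁻¹ * (1 + Real.log ⌊δ⁻¹⌋₊)) * ∑ n ∈ range N, ‖a n‖ ^ 2 := by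
  set D := N + δ⁻¹ * (1 + Real.log ⌊δ⁻¹⌋₊) with hD
  set S : ι → ℂ := fun i => ∑ n ∈ range N, a n * ee (n * α i) with hS
  set T := ∑ i ∈ s, ‖S i‖ ^ 2 with hT
  have hT0 : 0 ≤ T := sum_nonneg fun _ _ => by positivity
  have hdual := large_sieve_dual s α hδ hsp N (fun i => starRingEnd ℂ (S i))
  simp only [Complex.norm_conj] at hdual
  have h1 : T ≤ ∑ n ∈ range N, ‖a n‖ * ‖∑ i ∈ s, starRingEnd ℂ (S i) * ee (n * α i)‖ := by
    have e1 : (T : ℂ) = ∑ n ∈ range N, a n * ∑ i ∈ s, starRingEnd ℂ (S i) * ee (n * α i) := by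
      simp only [hT]; push_cast
      simp_rw [← Complex.conj_mul', mul_sum]
      rw [sum_comm]
      apply sum_congr rfl; intro i _
      conv_lhs => rw [hS]
      simp only
      rw [mul_sum]
      apply sum_congr rfl; intro n _; ring
    rw [← abs_of_nonneg hT0, ← Real.norm_eq_abs, ← Complex.norm_real, e1]
    refine (norm_sum_le _ _).trans (sum_le_sum fun n _ => ?_)
    rw [norm_mul]
  have h2 := sum_mul_sq_le_sq_mul_sq (range N) (fun n => ‖a n‖)
    (fun n => ‖∑ i ∈ s, starRingEnd ℂ (S i) * ee (n * α i)‖)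
  have ha0 : 0 ≤ ∑ n ∈ range N, ‖a n‖ ^ 2 := sum_nonneg fun _ _ => by positivity
  have h3 : T ^ 2 ≤ (∑ n ∈ range N, ‖a n‖ ^ 2) * (D * T) :=
    (pow_le_pow_left₀ hT0 h1 2).trans (h2.trans (mul_le_mul_of_nonneg_left hdual ha0))
  rcases hT0.eq_or_lt with h | h
  · rw [← h]
    apply mul_nonneg _ ha0
    have : 0 ≤ Real.log ⌊δ⁻¹⌋₊ := Real.log_natCast_nonneg _
    positivity
  · nlinarith

/-- The additive large sieve inequality over Farey fractions. -/
theorem large_sieve_additive (Q N : ℕ) (a : ℕ → ℂ) :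
    ∑ q ∈ Icc 1 Q, ∑ b ∈ (range q).filter (fun b => b.Coprime q),
      ‖∑ n ∈ range N, a n * ee (n * (b / q : ℝ))‖ ^ 2 ≤
      (N + Q ^ 2 * (1 + 2 * Real.log Q)) * ∑ n ∈ range N, ‖a n‖ ^ 2 := by
  rw [sum_sigma']
  rcases Nat.eq_zero_or_pos Q with hQ | hQ
  · subst hQ
    simp
    positivity
  have hQ' : (0 : ℝ) < Q := by exact_mod_cast hQ
  have := large_sieve_points ((Icc 1 Q).sigma fun q => (range q).filter (fun b => b.Coprime q))
    (fun p => (p.2 / p.1 : ℝ)) (δ := ((Q : ℝ) ^ 2)⁻¹) (by positivity) (by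
      rintro ⟨q, b⟩ hi ⟨q', b'⟩ hj hne m
      simp only [mem_sigma, mem_Icc, mem_filter, mem_range] at hi hj
      obtain ⟨⟨hq1, hqQ⟩, hb, hbq⟩ := hi
      obtain ⟨⟨hq1', hqQ'⟩, hb', hbq'⟩ := hj
      have hq0 : (0 : ℝ) < q := by exact_mod_cast hq1
      have hq0' : (0 : ℝ) < q' := by exact_mod_cast hq1'
      have e1 : (b / q : ℝ) - b' / q' - m = ((b * q' - b' * q - m * q * q' : ℤ) : ℝ) / (q * q') := by
        push_cast; field_simp
      simp only
      rw [e1, abs_div, abs_of_pos (by positivity : (0 : ℝ) < q * q')]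
      have hz : (b * q' - b' * q - m * q * q' : ℤ) ≠ 0 := by
        intro h0
        apply hne
        have hd1 : (q : ℤ) ∣ b * q' := ⟨b' + m * q', by linarith⟩
        have hd2 : (q' : ℤ) ∣ b' * q := ⟨b - m * q, by linarith⟩
        have hd1' : q ∣ q' := hbq.symm.dvd_of_dvd_mul_left (by exact_mod_cast hd1)
        have hd2' : q' ∣ q := hbq'.symm.dvd_of_dvd_mul_left (by exact_mod_cast hd2)
        have hqq : q = q' := Nat.dvd_antisymm hd1' hd2'
        subst hqq
        have h1 : (b : ℤ) - b' - m * q = 0 := by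
          have : (q : ℤ) * (b - b' - m * q) = 0 := by linarith
          rcases mul_eq_zero.1 this with h | h
          · have : (q : ℤ) > 0 := by exact_mod_cast hq1
            omega
          · exact h
        have hm : m = 0 := by
          by_contra hm
          have h5 : (1 : ℤ) ≤ |m| := Int.one_le_abs hm
          have h6 : |m * q| < q := by
            rw [show m * q = (b : ℤ) - b' by linarith, abs_lt]; omega
          rw [abs_mul, Nat.abs_cast] at h6
          nlinarith
        subst hm
        have : b = b' := by omega
        subst this; rfl
      have h1 : (1 : ℝ) ≤ |((b * q' - b' * q - m * q * q' : ℤ) : ℝ)| := by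
        rw [← Int.cast_abs]; exact_mod_cast Int.one_le_abs hz
      have h2 : (q : ℝ) * q' ≤ Q ^ 2 := by
        rw [sq]; gcongr
      rw [← one_div]
      gcongr) N a
  refine this.trans (le_of_eq ?_)
  rw [inv_inv]
  congr 4
  rw [show ((Q : ℝ) ^ 2) = ((Q ^ 2 : ℕ) : ℝ) by push_cast; rfl, Nat.floor_natCast]
  push_cast
  rw [Real.log_pow]; push_cast; ring

end BombieriVinogradov

namespace BombieriVinogradov

open Finset

lemma sum_zmod_eq_sum_range (q : ℕ) [NeZero q] (f : ZMod q → ℂ) :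
    ∑ x, f x = ∑ n ∈ range q, f n := by
  symm
  apply sum_bij (fun (n : ℕ) _ => (n : ZMod q))
  · intros; exact mem_univ _
  · intro a ha b hb h
    rw [ZMod.natCast_eq_natCast_iff', Nat.mod_eq_of_lt (mem_range.1 ha),
      Nat.mod_eq_of_lt (mem_range.1 hb)] at h
    exact h
  · intro b _
    exact ⟨b.val, mem_range.2 (ZMod.val_lt b), by simp⟩
  · intros; rfl

lemma stdAddChar_natCast_mul (q : ℕ) [NeZero q] (k n : ℕ) :
    ZMod.stdAddChar ((k : ZMod q) * (n : ZMod q)) = ee (k * n / q : ℝ) := by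
  have h := ZMod.stdAddChar_coe (N := q) ((k * n : ℕ) : ℤ)
  rw [show (((k * n : ℕ) : ℤ) : ZMod q) = (k : ZMod q) * n by push_cast; rfl] at h
  rw [h, ee]; congr 1; push_cast; ring

/-- The primitive Dirichlet characters modulo `q`. -/
noncomputable def primChars (q : ℕ) : Finset (DirichletCharacter ℂ q) := by
  classical exact univ.filter fun χ => χ.IsPrimitive

lemma mem_primChars {q : ℕ} {χ : DirichletCharacter ℂ q} : χ ∈ primChars q ↔ χ.IsPrimitive := by
  simp [primChars]

lemma conj_char {q : ℕ} [NeZero q] (χ : DirichletCharacter ℂ q) (a : ZMod q) :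
    starRingEnd ℂ (χ a) = χ⁻¹ a := MulChar.star_apply' χ a

lemma norm_inv_char {q : ℕ} [NeZero q] (χ : DirichletCharacter ℂ q) (a : ZMod q) :
    ‖χ⁻¹ a‖ = ‖χ a‖ := by rw [← conj_char, Complex.norm_conj]

/-- The modulus of the Gauss sum of a primitive character. -/
lemma norm_sq_gaussSum {q : ℕ} [NeZero q] {χ : DirichletCharacter ℂ q} (hχ : χ.IsPrimitive) :
    ‖gaussSum χ ZMod.stdAddChar‖ ^ 2 = q := by
  set e : AddChar (ZMod q) ℂ := ZMod.stdAddChar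
  set P : ℝ := ∑ b : ZMod q, ‖χ b‖ ^ 2 with hP
  have hP0 : P ≠ 0 := by
    have h1 : ‖χ 1‖ ^ 2 ≤ P := single_le_sum (f := fun b => ‖χ b‖ ^ 2)
      (fun _ _ => by positivity) (mem_univ 1)
    rw [map_one, norm_one] at h1
    linarith
  have h1 : ∑ n : ZMod q, ‖gaussSum χ (e.mulShift n)‖ ^ 2 = P * ‖gaussSum χ e‖ ^ 2 := by
    simp_rw [gaussSum_mulShift_of_isPrimitive e hχ, norm_mul, mul_pow, ← sum_mul, norm_inv_char]
    rfl
  have h2 : ((∑ n : ZMod q, ‖gaussSum χ (e.mulShift n)‖ ^ 2 : ℝ) : ℂ) = ((q * P : ℝ) : ℂ) := by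
    push_cast
    simp_rw [← Complex.mul_conj', gaussSum, map_sum, map_mul, AddChar.mulShift_apply, sum_mul_sum]
    calc ∑ n : ZMod q, ∑ b : ZMod q, ∑ c : ZMod q,
          χ b * e (n * b) * (starRingEnd ℂ (χ c) * starRingEnd ℂ (e (n * c)))
        = ∑ b : ZMod q, ∑ c : ZMod q, χ b * starRingEnd ℂ (χ c) * ∑ n : ZMod q, e (n * (b - c)) := by
          rw [sum_comm]
          apply sum_congr rfl; intro b _
          rw [sum_comm]
          apply sum_congr rfl; intro c _
          rw [mul_sum]
          apply sum_congr rfl; intro n _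
          rw [← AddChar.map_neg_eq_conj, mul_sub, sub_eq_add_neg, AddChar.map_add_eq_mul]
          ring
      _ = ∑ b : ZMod q, χ b * starRingEnd ℂ (χ b) * q := by
          apply sum_congr rfl; intro b _
          rw [sum_eq_single b]
          · rw [AddChar.sum_mulShift _ (ZMod.isPrimitive_stdAddChar q)]; simp
          · intro c _ hc
            rw [AddChar.sum_mulShift _ (ZMod.isPrimitive_stdAddChar q), if_neg (sub_ne_zero.2 hc.symm)]
            simp
          · simp
      _ = _ := by
          rw [hP]; push_cast; rw [mul_sum]
          apply sum_congr rfl; intro b _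
          rw [Complex.mul_conj']; ring
  have h3 : ∑ n : ZMod q, ‖gaussSum χ (e.mulShift n)‖ ^ 2 = q * P := by exact_mod_cast h2
  rw [h1] at h3
  apply mul_left_cancel₀ hP0
  rw [h3]; ring

lemma char_mul_gaussSum {q : ℕ} [NeZero q] {χ : DirichletCharacter ℂ q} (hχ : χ.IsPrimitive)
    (n : ℕ) : χ n * gaussSum χ⁻¹ ZMod.stdAddChar =
      ∑ b ∈ range q, χ⁻¹ b * ee (n * (b / q : ℝ)) := by
  have hχ' : χ⁻¹.IsPrimitive := by
    rw [DirichletCharacter.isPrimitive_def, DirichletCharacter.conductor_inv]; exact hχ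
  have h := gaussSum_mulShift_of_isPrimitive ZMod.stdAddChar hχ' (n : ZMod q)
  rw [inv_inv] at h
  rw [← h, gaussSum, sum_zmod_eq_sum_range]
  apply sum_congr rfl; intro b _
  rw [AddChar.mulShift_apply, stdAddChar_natCast_mul, mul_div_assoc]

lemma inv_char_apply {q : ℕ} [NeZero q] (χ : DirichletCharacter ℂ q) {b : ZMod q} (hb : IsUnit b) :
    χ⁻¹ b = χ b⁻¹ := by
  rw [MulChar.inv_apply_eq_inv']
  symm
  apply eq_inv_of_mul_eq_one_left
  rw [← map_mul, ZMod.inv_mul_of_unit b hb, map_one]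

lemma sum_chars_norm_sq {q : ℕ} [NeZero q] (S : ZMod q → ℂ) :
    ∑ χ : DirichletCharacter ℂ q, ‖∑ b, χ⁻¹ b * S b‖ ^ 2 =
      q.totient * ∑ b : ZMod q, if IsUnit b then ‖S b‖ ^ 2 else 0 := by
  classical
  have : ((∑ χ : DirichletCharacter ℂ q, ‖∑ b, χ⁻¹ b * S b‖ ^ 2 : ℝ) : ℂ) =
      ((q.totient * ∑ b : ZMod q, if IsUnit b then ‖S b‖ ^ 2 else 0 : ℝ) : ℂ) := by
    push_cast
    simp_rw [← Complex.mul_conj', map_sum, map_mul, sum_mul_sum]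
    rw [sum_comm, mul_sum]
    apply sum_congr rfl; intro b _
    rw [sum_comm]
    by_cases hb : IsUnit b
    · rw [sum_eq_single b]
      · have h1 : ∀ χ : DirichletCharacter ℂ q,
            χ⁻¹ b * S b * (starRingEnd ℂ (χ⁻¹ b) * starRingEnd ℂ (S b)) =
            (χ b⁻¹ * χ b) * (S b * starRingEnd ℂ (S b)) := by
          intro χ
          rw [conj_char, inv_inv, ← inv_char_apply χ hb]; ring
        simp_rw [h1]
        rw [← sum_mul, DirichletCharacter.sum_char_inv_mul_char_eq ℂ hb]
        simp only [if_true, hb]; push_cast; rw [Complex.mul_conj']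
      · intro c _ hc
        have h1 : ∀ χ : DirichletCharacter ℂ q,
            χ⁻¹ b * S b * (starRingEnd ℂ (χ⁻¹ c) * starRingEnd ℂ (S c)) =
            (χ b⁻¹ * χ c) * (S b * starRingEnd ℂ (S c)) := by
          intro χ
          rw [conj_char, inv_inv, ← inv_char_apply χ hb]; ring
        simp_rw [h1]
        rw [← sum_mul, DirichletCharacter.sum_char_inv_mul_char_eq ℂ hb, if_neg hc.symm, zero_mul]
      · simp
    · simp only [hb, if_false, Complex.ofReal_zero, mul_zero]
      apply sum_eq_zero; intro c _
      apply sum_eq_zero; intro χ _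
      rw [MulChar.map_nonunit _ hb]; simp
  exact_mod_cast this

/-- Passage from additive to primitive multiplicative characters. -/
lemma sum_primChars_norm_sq_le (q : ℕ) [NeZero q] (N : ℕ) (a : ℕ → ℂ) :
    (q / q.totient : ℝ) * ∑ χ ∈ primChars q, ‖∑ n ∈ range N, a n * χ n‖ ^ 2 ≤
      ∑ b ∈ (range q).filter (fun b => b.Coprime q),
        ‖∑ n ∈ range N, a n * ee (n * (b / q : ℝ))‖ ^ 2 := by
  have hq : (0 : ℝ) < q := by exact_mod_cast Nat.pos_of_ne_zero (NeZero.ne q)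
  have hφ : (0 : ℝ) < q.totient := by
    exact_mod_cast Nat.totient_pos.2 (Nat.pos_of_ne_zero (NeZero.ne q))
  set S : ZMod q → ℂ := fun b => ∑ n ∈ range N, a n * ee (n * (b.val / q : ℝ)) with hS
  have h1 : ∀ χ ∈ primChars q, q * ‖∑ n ∈ range N, a n * χ n‖ ^ 2 = ‖∑ b, χ⁻¹ b * S b‖ ^ 2 := by
    intro χ hχ
    rw [mem_primChars] at hχ
    have hχ' : χ⁻¹.IsPrimitive := by
      rw [DirichletCharacter.isPrimitive_def, DirichletCharacter.conductor_inv]; exact hχ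
    rw [← norm_sq_gaussSum hχ', ← mul_pow, ← norm_mul, mul_comm, sum_mul, sum_zmod_eq_sum_range]
    congr 2
    simp_rw [mul_assoc, char_mul_gaussSum hχ, hS, mul_sum]
    rw [sum_comm]
    apply sum_congr rfl; intro b hb
    apply sum_congr rfl; intro n _
    rw [ZMod.val_natCast, Nat.mod_eq_of_lt (mem_range.1 hb)]; ring
  have h2 : q * ∑ χ ∈ primChars q, ‖∑ n ∈ range N, a n * χ n‖ ^ 2 ≤
      q.totient * ∑ b : ZMod q, if IsUnit b then ‖S b‖ ^ 2 else 0 := by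
    rw [mul_sum, sum_congr rfl h1, ← sum_chars_norm_sq]
    exact sum_le_sum_of_subset_of_nonneg (subset_univ _) fun _ _ _ => by positivity
  have h3 : (∑ b : ZMod q, if IsUnit b then ‖S b‖ ^ 2 else 0) =
      ∑ b ∈ (range q).filter (fun b => b.Coprime q),
        ‖∑ n ∈ range N, a n * ee (n * (b / q : ℝ))‖ ^ 2 := by
    have := sum_zmod_eq_sum_range q (fun b => ((if IsUnit b then ‖S b‖ ^ 2 else 0 : ℝ) : ℂ))
    have h4 : (∑ b : ZMod q, if IsUnit b then ‖S b‖ ^ 2 else 0) =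
      ∑ b ∈ range q, if IsUnit (b : ZMod q) then ‖S b‖ ^ 2 else 0 := by exact_mod_cast this
    rw [h4, sum_filter]
    apply sum_congr rfl; intro b hb
    simp only [ZMod.isUnit_iff_coprime, hS, ZMod.val_natCast, Nat.mod_eq_of_lt (mem_range.1 hb)]
  rw [h3] at h2
  rw [div_mul_eq_mul_div, div_le_iff₀ hφ]
  linarith

/-- The multiplicative large sieve inequality. -/
theorem large_sieve_multiplicative (Q N : ℕ) (a : ℕ → ℂ) :
    ∑ q ∈ Icc 1 Q, (q / q.totient : ℝ) * ∑ χ ∈ primChars q, ‖∑ n ∈ range N, a n * χ n‖ ^ 2 ≤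
      (N + Q ^ 2 * (1 + 2 * Real.log Q)) * ∑ n ∈ range N, ‖a n‖ ^ 2 := by
  refine le_trans (sum_le_sum fun q hq => ?_) (large_sieve_additive Q N a)
  have : NeZero q := ⟨by have := (mem_Icc.1 hq).1; omega⟩
  exact sum_primChars_norm_sq_le q N a

/-- Partial sums of a periodic function with mean zero reduce to an incomplete period. -/
lemma sum_range_mod_of_periodic {q : ℕ} {f : ℕ → ℂ} (hf : ∀ n, f (n + q) = f n)
    (h0 : ∑ n ∈ range q, f n = 0) (N : ℕ) :
    ∑ n ∈ range N, f n = ∑ n ∈ range (N % q), f n := by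
  have hf' : ∀ k n, f (q * k + n) = f n := by
    intro k; induction k with
    | zero => intro n; simp
    | succ k ih => intro n; rw [show q * (k + 1) + n = (q * k + n) + q by ring, hf, ih]
  have hk : ∀ k, ∑ n ∈ range (q * k), f n = 0 := by
    intro k; induction k with
    | zero => simp
    | succ k ih => rw [mul_add, mul_one, sum_range_add, ih, zero_add]; simp_rw [hf']; exact h0
  conv_lhs => rw [← Nat.div_add_mod N q, sum_range_add, hk, zero_add]
  exact sum_congr rfl fun n _ => hf' _ n

lemma sum_range_char_eq_zero {q : ℕ} [NeZero q] {χ : DirichletCharacter ℂ q} (hχ : χ ≠ 1) :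
    ∑ n ∈ range q, χ n = 0 := by
  rw [← sum_zmod_eq_sum_range]; exact MulChar.sum_eq_zero_of_ne_one hχ

/-- The Pólya–Vinogradov inequality for primitive characters. -/
theorem polya_vinogradov {q : ℕ} [NeZero q] {χ : DirichletCharacter ℂ q} (hχ : χ.IsPrimitive)
    (hχ1 : χ ≠ 1) (N : ℕ) : ‖∑ n ∈ range N, χ n‖ ≤ √q * (2 + Real.log q) := by
  have hq : 0 < q := Nat.pos_of_ne_zero (NeZero.ne q)
  rw [sum_range_mod_of_periodic (f := fun n => χ n) (q := q) (fun n => by simp)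
    (sum_range_char_eq_zero hχ1)]
  set Y := N % q
  have hY : Y ≤ q := (Nat.mod_lt N hq).le
  have h1 : ∑ n ∈ range Y, χ n = ∑ n ∈ range q, χ n * (if n < Y then 1 else 0) := by
    simp_rw [mul_ite, mul_one, mul_zero]
    rw [← sum_filter]
    congr 1; ext n; simp only [mem_range, mem_filter]; omega
  have h2 : ∑ n ∈ range q, χ n * (if n < Y then (1 : ℂ) else 0) =
      ∑ k ∈ range q, cutCoeff q Y k * (χ⁻¹ k * gaussSum χ ZMod.stdAddChar) := by
    rw [sum_congr rfl fun n hn => by rw [indicator_eq_sum_cutCoeff hY (mem_range.1 hn)]]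
    simp_rw [mul_sum]
    rw [sum_comm]
    apply sum_congr rfl; intro k _
    rw [← gaussSum_mulShift_of_isPrimitive _ hχ, gaussSum, sum_zmod_eq_sum_range, mul_sum]
    apply sum_congr rfl; intro n _
    rw [AddChar.mulShift_apply, stdAddChar_natCast_mul]; ring
  have hg : ‖gaussSum χ ZMod.stdAddChar‖ = √q := by
    rw [← norm_sq_gaussSum hχ, Real.sqrt_sq (norm_nonneg _)]
  rw [h1, h2]
  calc _ ≤ ∑ k ∈ range q, cutBound q k * √q := by
        refine (norm_sum_le _ _).trans (sum_le_sum fun k hk => ?_)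
        rw [norm_mul, norm_mul, hg]
        have h3 := norm_cutCoeff_le hY (mem_range.1 hk)
        have h4 := DirichletCharacter.norm_le_one χ⁻¹ (k : ZMod q)
        have h5 : 0 ≤ √(q : ℝ) := Real.sqrt_nonneg _
        calc _ ≤ cutBound q k * (1 * √q) := by
              gcongr
              exact cutBound_nonneg (mem_range.1 hk)
          _ = _ := by ring
    _ = (∑ k ∈ range q, cutBound q k) * √q := by rw [sum_mul]
    _ ≤ (2 + Real.log q) * √q := by gcongr; exact sum_cutBound_le q
    _ = _ := by ring

end BombieriVinogradov

namespace BombieriVinogradov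

open Finset

/-- The factor of the large sieve inequality. -/
noncomputable def sieveFactor (Q N : ℕ) : ℝ := N + Q ^ 2 * (1 + 2 * Real.log Q)

lemma sieveFactor_nonneg (Q N : ℕ) : 0 ≤ sieveFactor Q N := by
  have := Real.log_natCast_nonneg Q
  unfold sieveFactor; positivity

/-- Cauchy–Schwarz combined with the large sieve. -/
lemma sum_primChars_mul_le (Q M N : ℕ) (a b : ℕ → ℂ) :
    ∑ q ∈ Icc 1 Q, (q / q.totient : ℝ) * ∑ χ ∈ primChars q,
      ‖∑ m ∈ range M, a m * χ m‖ * ‖∑ n ∈ range N, b n * χ n‖ ≤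
      √(sieveFactor Q M * ∑ m ∈ range M, ‖a m‖ ^ 2) *
        √(sieveFactor Q N * ∑ n ∈ range N, ‖b n‖ ^ 2) := by
  have hw : ∀ q : ℕ, 0 ≤ (q / q.totient : ℝ) := fun q => by positivity
  have key : ∀ (N : ℕ) (b : ℕ → ℂ), ∑ p ∈ (Icc 1 Q).sigma primChars,
      (√(p.1 / p.1.totient : ℝ) * ‖∑ n ∈ range N, b n * p.2 n‖) ^ 2 ≤
      sieveFactor Q N * ∑ n ∈ range N, ‖b n‖ ^ 2 := by
    intro N b
    refine le_trans (le_of_eq ?_) (large_sieve_multiplicative Q N b)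
    rw [sum_sigma]
    apply sum_congr rfl; intro q _
    rw [mul_sum]
    apply sum_congr rfl; intro χ _
    rw [mul_pow, Real.sq_sqrt (hw q)]
  calc _ = ∑ p ∈ (Icc 1 Q).sigma primChars,
        (√(p.1 / p.1.totient : ℝ) * ‖∑ m ∈ range M, a m * p.2 m‖) *
        (√(p.1 / p.1.totient : ℝ) * ‖∑ n ∈ range N, b n * p.2 n‖) := by
        rw [sum_sigma]
        apply sum_congr rfl; intro q _
        rw [mul_sum]
        apply sum_congr rfl; intro χ _
        rw [mul_mul_mul_comm, Real.mul_self_sqrt (hw q)]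
    _ ≤ _ := by
        refine (Real.sum_mul_le_sqrt_mul_sqrt _ _ _).trans ?_
        gcongr
        · exact key M a
        · exact key N b

/-- The bilinear form of the large sieve, with a cutoff `n < Y m` separated by Fourier expansion. -/
theorem sum_primChars_bilinear_le (Q M N : ℕ) (a b : ℕ → ℂ) (Y : ℕ → ℕ) (hY : ∀ m, Y m ≤ N) :
    ∑ q ∈ Icc 1 Q, (q / q.totient : ℝ) * ∑ χ ∈ primChars q,
      ‖∑ m ∈ range M, ∑ n ∈ range N, if n < Y m then a m * χ m * (b n * χ n) else 0‖ ≤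
      (2 + Real.log N) * (√(sieveFactor Q M * ∑ m ∈ range M, ‖a m‖ ^ 2) *
        √(sieveFactor Q N * ∑ n ∈ range N, ‖b n‖ ^ 2)) := by
  have h1 : ∀ (q : ℕ) (χ : DirichletCharacter ℂ q),
      ‖∑ m ∈ range M, ∑ n ∈ range N, if n < Y m then a m * χ m * (b n * χ n) else 0‖ ≤
      ∑ k ∈ range N, ‖∑ m ∈ range M, (a m * cutCoeff N (Y m) k) * χ m‖ *
        ‖∑ n ∈ range N, (b n * ee (k * n / N : ℝ)) * χ n‖ := by
    intro q χ
    have : ∑ m ∈ range M, ∑ n ∈ range N, (if n < Y m then a m * χ m * (b n * χ n) else 0) =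
        ∑ k ∈ range N, (∑ m ∈ range M, (a m * cutCoeff N (Y m) k) * χ m) *
        (∑ n ∈ range N, (b n * ee (k * n / N : ℝ)) * χ n) := by
      simp_rw [sum_mul_sum]
      rw [sum_comm (s := range N)]
      apply sum_congr rfl; intro m _
      rw [sum_comm (s := range N)]
      apply sum_congr rfl; intro n hn
      have := indicator_eq_sum_cutCoeff (hY m) (mem_range.1 hn)
      rw [← mul_boole, this, mul_sum]
      apply sum_congr rfl; intro k _; ring
    rw [this]
    exact (norm_sum_le _ _).trans (sum_le_sum fun k _ => (norm_mul _ _).le)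
  have hw : ∀ q : ℕ, 0 ≤ (q / q.totient : ℝ) := fun q => by positivity
  calc _ ≤ ∑ q ∈ Icc 1 Q, (q / q.totient : ℝ) * ∑ χ ∈ primChars q,
        ∑ k ∈ range N, ‖∑ m ∈ range M, (a m * cutCoeff N (Y m) k) * χ m‖ *
        ‖∑ n ∈ range N, (b n * ee (k * n / N : ℝ)) * χ n‖ :=
        sum_le_sum fun q _ => mul_le_mul_of_nonneg_left (sum_le_sum fun χ _ => h1 q χ) (hw q)
    _ = ∑ k ∈ range N, ∑ q ∈ Icc 1 Q, (q / q.totient : ℝ) * ∑ χ ∈ primChars q,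
        ‖∑ m ∈ range M, (a m * cutCoeff N (Y m) k) * χ m‖ *
        ‖∑ n ∈ range N, (b n * ee (k * n / N : ℝ)) * χ n‖ := by
        rw [sum_comm]
        apply sum_congr rfl; intro q _
        rw [sum_comm, mul_sum]
    _ ≤ ∑ k ∈ range N, cutBound N k * (√(sieveFactor Q M * ∑ m ∈ range M, ‖a m‖ ^ 2) *
        √(sieveFactor Q N * ∑ n ∈ range N, ‖b n‖ ^ 2)) := by
        apply sum_le_sum; intro k hk
        refine (sum_primChars_mul_le Q M N _ _).trans ?_
        have hc0 := cutBound_nonneg (mem_range.1 hk)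
        have e1 : ∑ n ∈ range N, ‖b n * ee (k * n / N : ℝ)‖ ^ 2 = ∑ n ∈ range N, ‖b n‖ ^ 2 := by
          simp_rw [norm_mul, norm_ee, mul_one]
        have e2 : ∑ m ∈ range M, ‖a m * cutCoeff N (Y m) k‖ ^ 2 ≤
            cutBound N k ^ 2 * ∑ m ∈ range M, ‖a m‖ ^ 2 := by
          rw [mul_sum]
          apply sum_le_sum; intro m _
          rw [norm_mul, mul_pow, mul_comm]
          gcongr
          exact norm_cutCoeff_le (hY m) (mem_range.1 hk)
        rw [e1, ← mul_assoc]
        gcongr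
        have hs := sieveFactor_nonneg Q M
        calc √(sieveFactor Q M * ∑ m ∈ range M, ‖a m * cutCoeff N (Y m) k‖ ^ 2)
            ≤ √(cutBound N k ^ 2 * (sieveFactor Q M * ∑ m ∈ range M, ‖a m‖ ^ 2)) := by
              apply Real.sqrt_le_sqrt
              calc _ ≤ sieveFactor Q M * (cutBound N k ^ 2 * ∑ m ∈ range M, ‖a m‖ ^ 2) := by gcongr
                _ = _ := by ring
          _ = _ := by rw [Real.sqrt_mul (by positivity), Real.sqrt_sq hc0]
    _ ≤ _ := by
        rw [← sum_mul]
        gcongr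
        exact sum_cutBound_le N

end BombieriVinogradov

namespace BombieriVinogradov

open Finset
open ArithmeticFunction (vonMangoldt moebius zeta)

/-! ### Divisor sums -/

lemma harmonic_Ioc_le (N : ℕ) : ∑ k ∈ Ioc 0 N, 1 / (k : ℝ) ≤ 1 + Real.log N := by
  refine le_trans (le_of_eq ?_) (harmonic_le N)
  have h := Finset.sum_Ico_add' (fun k : ℕ => 1 / (k : ℝ)) 0 N 1
  rw [range_eq_Ico]
  push_cast at h
  rw [h]
  refine sum_congr ?_ fun _ _ => rfl
  ext k; simp; omega

lemma card_divisors_mul_le (m n : ℕ) :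
    (m * n).divisors.card ≤ m.divisors.card * n.divisors.card := by
  rw [Nat.divisors_mul]; exact Finset.card_mul_le

lemma sum_card_divisors_le (K : ℕ) :
    ∑ k ∈ Ioc 0 K, (k.divisors.card : ℝ) ≤ K * (1 + Real.log K) := by
  have h := ArithmeticFunction.sum_Ioc_sigma0_eq_sum_div K
  simp only [ArithmeticFunction.sigma_zero_apply] at h
  have h2 : ∑ k ∈ Ioc 0 K, (k.divisors.card : ℝ) = ∑ n ∈ Ioc 0 K, ((K / n : ℕ) : ℝ) := by
    exact_mod_cast h
  rw [h2]
  calc ∑ n ∈ Ioc 0 K, ((K / n : ℕ) : ℝ) ≤ ∑ n ∈ Ioc 0 K, (K : ℝ) * (1 / (n : ℝ)) := by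
        refine sum_le_sum fun n _ => ?_
        rw [mul_one_div]; exact Nat.cast_div_le
    _ = K * ∑ n ∈ Ioc 0 K, (1 / (n : ℝ)) := by rw [mul_sum]
    _ ≤ _ := by gcongr; exact harmonic_Ioc_le K

lemma log_natCast_mono {a b : ℕ} (h : a ≤ b) : Real.log a ≤ Real.log b := by
  rcases Nat.eq_zero_or_pos a with rfl | ha
  · simpa using Real.log_natCast_nonneg b
  · exact Real.log_le_log (by exact_mod_cast ha) (by exact_mod_cast h)

/-- The reciprocal function as an arithmetic function. -/
noncomputable def recip : ArithmeticFunction ℝ := ⟨fun n => 1 / (n : ℝ), by simp⟩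

lemma sum_card_divisors_div_le (K : ℕ) :
    ∑ k ∈ Ioc 0 K, (k.divisors.card : ℝ) / k ≤ (1 + Real.log K) ^ 2 := by
  have h : ∀ k : ℕ, (k.divisors.card : ℝ) / k = (recip * recip) k := by
    intro k
    rw [ArithmeticFunction.mul_apply]
    rw [sum_congr rfl (g := fun _ => 1 / (k : ℝ))]
    · rw [sum_const, ← Nat.map_div_right_divisors, card_map]; simp; rfl
    · intro x hx
      have := Nat.mem_divisorsAntidiagonal.1 hx
      simp only [recip, ArithmeticFunction.coe_mk]
      rw [← this.1]; push_cast; ring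
  rw [sum_congr rfl fun k _ => h k, ArithmeticFunction.sum_Ioc_mul_eq_sum_sum, sq]
  have hl := Real.log_natCast_nonneg K
  calc _ ≤ ∑ n ∈ Ioc 0 K, recip n * (1 + Real.log K) := by
        refine sum_le_sum fun n _ => ?_
        refine mul_le_mul_of_nonneg_left ?_ (by simp [recip])
        refine (harmonic_Ioc_le (K / n)).trans ?_
        have := log_natCast_mono (Nat.div_le_self K n)
        linarith
    _ = (∑ n ∈ Ioc 0 K, recip n) * (1 + Real.log K) := by rw [sum_mul]
    _ ≤ _ := by gcongr; exact harmonic_Ioc_le K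

lemma sum_card_divisors_sq_le (K : ℕ) :
    ∑ k ∈ Ioc 0 K, (k.divisors.card : ℝ) ^ 2 ≤ K * (1 + Real.log K) ^ 3 := by
  let d : ArithmeticFunction ℝ := ⟨fun n => (n.divisors.card : ℝ), by simp⟩
  have hl := Real.log_natCast_nonneg K
  have h : ∀ k : ℕ, (k.divisors.card : ℝ) ^ 2 ≤ (d * d) k := by
    intro k
    rw [ArithmeticFunction.mul_apply]
    have h1 : (k.divisors.card : ℝ) ^ 2
        = ∑ x ∈ k.divisorsAntidiagonal, (k.divisors.card : ℝ) := by
      rw [sum_const, ← Nat.map_div_right_divisors, card_map]; simp [sq]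
    rw [h1]
    refine sum_le_sum fun x hx => ?_
    have := Nat.mem_divisorsAntidiagonal.1 hx
    simp only [d, ArithmeticFunction.coe_mk]
    rw [← this.1]
    exact_mod_cast card_divisors_mul_le x.1 x.2
  refine (sum_le_sum fun k _ => h k).trans ?_
  rw [ArithmeticFunction.sum_Ioc_mul_eq_sum_sum]
  calc _ ≤ ∑ n ∈ Ioc 0 K, (K * (1 + Real.log K)) * ((n.divisors.card : ℝ) / n) := by
        refine sum_le_sum fun n _ => ?_
        have h2 : d n = (n.divisors.card : ℝ) := rfl
        have h3 : ∑ m ∈ Ioc 0 (K / n), d m ≤ (K / n : ℝ) * (1 + Real.log K) := by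
          refine (sum_card_divisors_le (K / n)).trans ?_
          have := log_natCast_mono (Nat.div_le_self K n)
          have h4 : ((K / n : ℕ) : ℝ) ≤ (K : ℝ) / n := Nat.cast_div_le
          gcongr
        rw [h2]
        refine (mul_le_mul_of_nonneg_left h3 (by positivity)).trans (le_of_eq (by ring))
    _ = (K * (1 + Real.log K)) * ∑ n ∈ Ioc 0 K, ((n.divisors.card : ℝ) / n) := by rw [mul_sum]
    _ ≤ (K * (1 + Real.log K)) * (1 + Real.log K) ^ 2 := by
        gcongr; exact sum_card_divisors_div_le K
    _ = _ := by ring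

/-! ### Vaughan's identity -/

/-- An arithmetic function twisted by a Dirichlet character. -/
noncomputable def twist {r : ℕ} (χ : DirichletCharacter ℂ r) (f : ArithmeticFunction ℝ) :
    ArithmeticFunction ℂ := ⟨fun n => (f n : ℂ) * χ n, by simp⟩

lemma arith_sub_apply (f g : ArithmeticFunction ℝ) (n : ℕ) : (f - g) n = f n - g n := by
  rw [sub_eq_add_neg, ArithmeticFunction.add_apply, sub_eq_add_neg]; rfl

lemma twist_apply {r : ℕ} (χ : DirichletCharacter ℂ r) (f : ArithmeticFunction ℝ) (n : ℕ) :
    twist χ f n = (f n : ℂ) * χ n := rfl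

lemma twist_mul {r : ℕ} (χ : DirichletCharacter ℂ r) (f g : ArithmeticFunction ℝ) :
    twist χ (f * g) = twist χ f * twist χ g := by
  ext n
  rw [twist_apply, ArithmeticFunction.mul_apply, ArithmeticFunction.mul_apply]
  push_cast
  rw [sum_mul]
  refine sum_congr rfl fun x hx => ?_
  have := Nat.mem_divisorsAntidiagonal.1 hx
  rw [twist_apply, twist_apply, ← this.1]
  push_cast
  rw [map_mul]; ring

/-- The summatory function of `f` twisted by `χ`. -/
noncomputable def twistSum {r : ℕ} (χ : DirichletCharacter ℂ r) (f : ArithmeticFunction ℝ)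
    (N : ℕ) : ℂ := ∑ n ∈ Ioc 0 N, (f n : ℂ) * χ n

lemma twistSum_mul {r : ℕ} (χ : DirichletCharacter ℂ r) (f g : ArithmeticFunction ℝ) (N : ℕ) :
    twistSum χ (f * g) N = ∑ n ∈ Ioc 0 N, (f n : ℂ) * χ n * twistSum χ g (N / n) := by
  have := ArithmeticFunction.sum_Ioc_mul_eq_sum_sum (twist χ f) (twist χ g) N
  rw [← twist_mul] at this
  exact this

/-- Restriction of an arithmetic function to arguments at most `U`. -/
noncomputable def trunc (f : ArithmeticFunction ℝ) (U : ℕ) : ArithmeticFunction ℝ :=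
  ⟨fun n => if n ≤ U then f n else 0, by simp⟩

lemma trunc_apply (f : ArithmeticFunction ℝ) (U n : ℕ) :
    trunc f U n = if n ≤ U then f n else 0 := rfl

theorem vaughan_identity (U : ℕ) :
    vonMangoldt = trunc vonMangoldt U + trunc (moebius : ArithmeticFunction ℝ) U
        * ArithmeticFunction.log
      - trunc vonMangoldt U * (trunc (moebius : ArithmeticFunction ℝ) U * (zeta : ArithmeticFunction ℝ))
      + (vonMangoldt - trunc vonMangoldt U)
        * (1 - trunc (moebius : ArithmeticFunction ℝ) U * (zeta : ArithmeticFunction ℝ)) := by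
  rw [← ArithmeticFunction.vonMangoldt_mul_zeta]
  ring

lemma norm_twistSum_mul_le {r : ℕ} (χ : DirichletCharacter ℂ r) (f g : ArithmeticFunction ℝ)
    (N U : ℕ) {H W : ℝ} (hH : ∀ n ≤ U, |f n| ≤ H) (hH0 : ∀ n, U < n → f n = 0)
    (hW : ∀ K ≤ N, ‖twistSum χ g K‖ ≤ W) :
    ‖twistSum χ (f * g) N‖ ≤ U * (H * W) := by
  have hHn : 0 ≤ H := (abs_nonneg _).trans (hH 0 (Nat.zero_le _))
  have hWn : 0 ≤ W := (norm_nonneg _).trans (hW 0 (Nat.zero_le _))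
  rw [twistSum_mul]
  have h1 : ∀ n ∈ Ioc 0 N, ‖(f n : ℂ) * χ n * twistSum χ g (N / n)‖
      ≤ if n ∈ Ioc 0 U then H * W else 0 := by
    intro n hn
    rw [mem_Ioc] at hn
    simp only [mem_Ioc]
    split_ifs with h
    · rw [norm_mul, norm_mul, Complex.norm_real]
      have h2 := hW (N / n) (Nat.div_le_self N n)
      have h3 : ‖χ (n : ZMod r)‖ ≤ 1 := χ.norm_le_one _
      calc ‖f n‖ * ‖χ n‖ * ‖twistSum χ g (N / n)‖ ≤ H * 1 * W := by
            gcongr; exact hH n h.2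
        _ = _ := by ring
    · rw [hH0 n (by omega)]; simp
  refine (norm_sum_le_of_le _ h1).trans ?_
  rw [← sum_filter, sum_const, nsmul_eq_mul]
  gcongr
  calc _ ≤ (Ioc 0 U).card := card_le_card (fun x hx => (mem_filter.1 hx).2)
    _ = U := by simp

/-- Abel summation against the logarithm. -/
lemma norm_twistSum_log_le {r : ℕ} (χ : DirichletCharacter ℂ r) {P : ℝ}
    (hP : ∀ N : ℕ, ‖∑ n ∈ range N, χ n‖ ≤ P) (N : ℕ) :
    ‖twistSum χ ArithmeticFunction.log N‖ ≤ 2 * P * Real.log N := by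
  have hP0 : 0 ≤ P := (norm_nonneg _).trans (hP 0)
  rcases Nat.eq_zero_or_pos N with rfl | hN
  · simp [twistSum]
  have key : ∀ M : ℕ, twistSum χ ArithmeticFunction.log M
      = Real.log M * (∑ n ∈ range (M + 1), χ n)
        - ∑ m ∈ range M, ((Real.log (m + 1 : ℕ) - Real.log m : ℝ) : ℂ)
            * ∑ n ∈ range (m + 1), χ n := by
    intro M
    induction M with
    | zero => simp [twistSum]
    | succ M ih =>
      have h1 : twistSum χ ArithmeticFunction.log (M + 1)
          = twistSum χ ArithmeticFunction.log M + Real.log (M + 1 : ℕ) * χ (M + 1 : ℕ) := by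
        unfold twistSum
        rw [Finset.sum_Ioc_succ_top (Nat.zero_le M)]
        simp only [ArithmeticFunction.log_apply]
      have h2 := sum_range_succ (fun n : ℕ => χ (n : ZMod r)) (M + 1)
      rw [h1, ih, h2, sum_range_succ (fun m : ℕ => ((Real.log (m + 1 : ℕ) - Real.log m : ℝ) : ℂ)
        * ∑ n ∈ range (m + 1), χ (n : ZMod r)) M]
      push_cast
      ring
  rw [key]
  have h2 : ‖∑ m ∈ range N, ((Real.log (m + 1 : ℕ) - Real.log m : ℝ) : ℂ)
      * ∑ n ∈ range (m + 1), χ n‖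
      ≤ ∑ m ∈ range N, (Real.log (m + 1 : ℕ) - Real.log m) * P := by
    refine norm_sum_le_of_le _ fun m _ => ?_
    have := log_natCast_mono (Nat.le_succ m)
    rw [norm_mul, Complex.norm_real, Real.norm_of_nonneg (by simpa using this)]
    exact mul_le_mul_of_nonneg_left (hP _) (by simpa using this)
  rw [← sum_mul, sum_range_sub (fun m : ℕ => Real.log m)] at h2
  simp only [Nat.cast_zero, Real.log_zero, sub_zero] at h2
  have h3 : ‖(Real.log N : ℂ) * (∑ n ∈ range (N + 1), χ n)‖ ≤ Real.log N * P := by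
    rw [norm_mul, Complex.norm_real, Real.norm_of_nonneg (Real.log_natCast_nonneg N)]
    exact mul_le_mul_of_nonneg_left (hP _) (Real.log_natCast_nonneg N)
  refine (norm_sub_le _ _).trans ?_
  linarith

lemma norm_twistSum_zeta_le {r : ℕ} (hr : 1 < r) (χ : DirichletCharacter ℂ r) {P : ℝ}
    (hP : ∀ N : ℕ, ‖∑ n ∈ range N, χ n‖ ≤ P) (N : ℕ) :
    ‖twistSum χ (zeta : ArithmeticFunction ℝ) N‖ ≤ P := by
  have : Fact (1 < r) := ⟨hr⟩
  have h : twistSum χ (zeta : ArithmeticFunction ℝ) N = ∑ n ∈ range (N + 1), χ n := by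
    rw [range_eq_Ico, sum_eq_sum_Ico_succ_bot (Nat.succ_pos N)]
    simp only [Nat.cast_zero, MulChar.map_zero, zero_add]
    unfold twistSum
    refine sum_congr ?_ fun n hn => ?_
    · ext k; simp; omega
    · have : n ≠ 0 := by simp at hn; omega
      simp [ArithmeticFunction.natCoe_apply, ArithmeticFunction.zeta_apply, this]
  rw [h]; exact hP _

lemma vonMangoldt_le_log_of_le {n N : ℕ} (h : n ≤ N) : |vonMangoldt n| ≤ Real.log N := by
  rw [abs_of_nonneg ArithmeticFunction.vonMangoldt_nonneg]
  exact ArithmeticFunction.vonMangoldt_le_log.trans (log_natCast_mono h)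

lemma abs_moebius_le_one (n : ℕ) : |(moebius : ArithmeticFunction ℝ) n| ≤ 1 := by
  rw [ArithmeticFunction.intCoe_apply]
  exact_mod_cast ArithmeticFunction.abs_moebius_le_one

/-- The contribution of the type I sums in Vaughan's identity. -/
lemma norm_twistSum_vonMangoldt_sub_le {r : ℕ} (hr : 1 < r) (χ : DirichletCharacter ℂ r) {P : ℝ}
    (hP1 : 1 ≤ P) (hP : ∀ N : ℕ, ‖∑ n ∈ range N, χ n‖ ≤ P) {N U : ℕ} (hU : 1 ≤ U) (hUN : U ≤ N) :
    ‖twistSum χ vonMangoldt N‖ ≤ 4 * P * U ^ 2 * Real.log N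
      + ‖twistSum χ ((vonMangoldt - trunc vonMangoldt U)
        * (1 - trunc (moebius : ArithmeticFunction ℝ) U * (zeta : ArithmeticFunction ℝ))) N‖ := by
  have hU1 : (1 : ℝ) ≤ U := by exact_mod_cast hU
  have hl := Real.log_natCast_nonneg N
  have hv := vaughan_identity U
  have hadd : ∀ f g : ArithmeticFunction ℝ, twistSum χ (f + g) N
      = twistSum χ f N + twistSum χ g N := fun f g => by
    simp [twistSum, add_mul, sum_add_distrib]
  have hsub : ∀ f g : ArithmeticFunction ℝ, twistSum χ (f - g) N
      = twistSum χ f N - twistSum χ g N := fun f g => by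
    simp [twistSum, arith_sub_apply, sub_mul, sum_sub_distrib]
  have htr : ∀ (f : ArithmeticFunction ℝ) (H : ℝ), (∀ n ≤ U, |f n| ≤ H) →
      (∀ n ≤ U, |trunc f U n| ≤ H) := fun f H h n hn => by
    rw [trunc_apply, if_pos hn]; exact h n hn
  have htr0 : ∀ (f : ArithmeticFunction ℝ), ∀ n, U < n → trunc f U n = 0 := fun f n hn => by
    rw [trunc_apply, if_neg (by omega)]
  have h1 : ‖twistSum χ (trunc vonMangoldt U) N‖ ≤ U * (Real.log N * 1) := by
    have := norm_twistSum_mul_le χ (trunc vonMangoldt U) 1 N U (H := Real.log N) (W := 1)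
      (htr _ _ fun n hn => vonMangoldt_le_log_of_le (hn.trans hUN)) (htr0 _) (fun K _ => by
        unfold twistSum
        rw [sum_eq_ite 1] 
        · split_ifs
          · simp
          · simp
        · intro b _ hb; simp [hb])
    rwa [mul_one] at this
  have h2 : ‖twistSum χ (trunc (moebius : ArithmeticFunction ℝ) U * ArithmeticFunction.log) N‖
      ≤ U * (1 * (2 * P * Real.log N)) :=
    norm_twistSum_mul_le χ _ _ N U (htr _ _ fun n _ => abs_moebius_le_one n) (htr0 _)
      fun K hK => (norm_twistSum_log_le χ hP K).trans (by
        have := log_natCast_mono hK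
        gcongr)
  have h3 : ‖twistSum χ (trunc vonMangoldt U * (trunc (moebius : ArithmeticFunction ℝ) U
      * (zeta : ArithmeticFunction ℝ))) N‖ ≤ U * (Real.log N * (U * (1 * P))) :=
    norm_twistSum_mul_le χ _ _ N U
      (htr _ _ fun n hn => vonMangoldt_le_log_of_le (hn.trans hUN)) (htr0 _) fun K _ =>
      norm_twistSum_mul_le χ _ _ K U (htr _ _ fun n _ => abs_moebius_le_one n) (htr0 _)
        fun L _ => norm_twistSum_zeta_le hr χ hP L
  have h4 : twistSum χ vonMangoldt N = twistSum χ (trunc vonMangoldt U) N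
      + twistSum χ (trunc (moebius : ArithmeticFunction ℝ) U * ArithmeticFunction.log) N
      - twistSum χ (trunc vonMangoldt U * (trunc (moebius : ArithmeticFunction ℝ) U
        * (zeta : ArithmeticFunction ℝ))) N
      + twistSum χ ((vonMangoldt - trunc vonMangoldt U)
        * (1 - trunc (moebius : ArithmeticFunction ℝ) U * (zeta : ArithmeticFunction ℝ))) N := by
    rw [← hadd, ← hsub, ← hadd, ← hv]
  rw [h4]
  refine (norm_add_le _ _).trans ?_
  gcongr
  refine (norm_sub_le _ _).trans ((add_le_add (norm_add_le _ _) le_rfl).trans ?_)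
  have e1 : (U : ℝ) * (Real.log N * 1) ≤ P * U ^ 2 * Real.log N := by
    have : (U : ℝ) ≤ P * U ^ 2 := by nlinarith
    nlinarith
  have e2 : (U : ℝ) * (1 * (2 * P * Real.log N)) ≤ 2 * (P * U ^ 2 * Real.log N) := by
    have : (U : ℝ) * P ≤ P * U ^ 2 := by
      nlinarith [mul_nonneg (mul_nonneg (zero_le_one.trans hP1) (zero_le_one.trans hU1)) (sub_nonneg.2 hU1)]
    nlinarith
  nlinarith
end BombieriVinogradov

namespace BombieriVinogradov

open Finset
open ArithmeticFunction (vonMangoldt moebius zeta)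

/-! ### The type II sums -/

/-- The first factor of the type II sum in Vaughan's identity. -/
noncomputable def vaughanAlpha (U : ℕ) : ArithmeticFunction ℝ := vonMangoldt - trunc vonMangoldt U

/-- The second factor of the type II sum in Vaughan's identity. -/
noncomputable def vaughanBeta (U : ℕ) : ArithmeticFunction ℝ :=
  1 - trunc (moebius : ArithmeticFunction ℝ) U * (zeta : ArithmeticFunction ℝ)

lemma vaughanAlpha_eq_zero {U n : ℕ} (h : n ≤ U) : vaughanAlpha U n = 0 := by
  rw [vaughanAlpha, arith_sub_apply, trunc_apply, if_pos h, sub_self]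

lemma abs_vaughanAlpha_le (U : ℕ) {n N : ℕ} (h : n ≤ N) : |vaughanAlpha U n| ≤ Real.log N := by
  rw [vaughanAlpha, arith_sub_apply, trunc_apply]
  split_ifs
  · simpa using Real.log_natCast_nonneg N
  · simpa using vonMangoldt_le_log_of_le h

lemma vaughanBeta_eq_zero {U m : ℕ} (h : m ≤ U) : vaughanBeta U m = 0 := by
  rw [vaughanBeta, arith_sub_apply, sub_eq_zero, ArithmeticFunction.coe_mul_zeta_apply]
  rw [← ArithmeticFunction.coe_moebius_mul_coe_zeta, ArithmeticFunction.coe_mul_zeta_apply]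
  refine sum_congr rfl fun d hd => ?_
  rw [trunc_apply, if_pos ((Nat.divisor_le hd).trans h)]

lemma abs_vaughanBeta_le {U : ℕ} (hU : 1 ≤ U) (m : ℕ) : |vaughanBeta U m| ≤ m.divisors.card := by
  by_cases hm : m ≤ 1
  · rw [vaughanBeta_eq_zero (hm.trans hU)]; simp
  · rw [vaughanBeta, arith_sub_apply, ArithmeticFunction.one_apply_ne (by omega), zero_sub,
      abs_neg, ArithmeticFunction.coe_mul_zeta_apply]
    refine (abs_sum_le_sum_abs _ _).trans ?_
    rw [card_eq_sum_ones]
    push_cast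
    refine sum_le_sum fun d _ => ?_
    rw [trunc_apply]
    split_ifs
    · exact abs_moebius_le_one d
    · simp

lemma twistSum_vaughanBeta_eq_zero {r : ℕ} (χ : DirichletCharacter ℂ r) {U K : ℕ} (h : K ≤ U) :
    twistSum χ (vaughanBeta U) K = 0 := by
  refine sum_eq_zero fun n hn => ?_
  rw [vaughanBeta_eq_zero ((mem_Ioc.1 hn).2.trans h)]; simp

lemma sqrt_mul_sqrt_le {N M K R U L X Y : ℝ} (hN : 0 ≤ N) (hM : 0 ≤ M) (hK : 0 ≤ K) (hR : 0 ≤ R)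
    (hU : 0 < U) (hL : 1 ≤ L) (hKM : K * M ≤ N) (hMU : M ≤ N / U) (hKU : K ≤ N / U) (hX0 : 0 ≤ X)
    (hX : X ≤ 3 * L * (M + R ^ 2) * (M * L ^ 2)) (hY : Y ≤ 3 * L * (K + R ^ 2) * (K * L ^ 3)) :
    √X * √Y ≤ 3 * L ^ 4 * (√N * (√N + 2 * (R * √N / √U) + R ^ 2)) := by
  have hs : √N ^ 2 = N := Real.sq_sqrt hN
  have hu : √U ^ 2 = U := Real.sq_sqrt hU.le
  have hNU : 0 ≤ N / U := by positivity
  have hL0 : 0 ≤ L := by linarith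
  rw [← Real.sqrt_mul hX0]
  refine Real.sqrt_le_iff.2 ⟨by positivity, ?_⟩
  have h4 : (R * √N / √U) ^ 2 = R ^ 2 * (N / U) := by
    rw [div_pow, mul_pow, hs, hu]; ring
  set w := R * √N / √U with hw
  have hw0 : 0 ≤ w := by positivity
  calc X * Y ≤ 3 * L * (M + R ^ 2) * (M * L ^ 2) * (3 * L * (K + R ^ 2) * (K * L ^ 3)) :=
        (mul_le_mul_of_nonneg_left hY hX0).trans (mul_le_mul_of_nonneg_right hX (by positivity))
    _ = 9 * L ^ 7 * ((K * M) * (K * M + R ^ 2 * M + R ^ 2 * K + R ^ 4)) := by ring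
    _ ≤ 9 * L ^ 7 * (N * (N + R ^ 2 * (N / U) + R ^ 2 * (N / U) + R ^ 4)) := by gcongr
    _ ≤ 9 * L ^ 8 * (N * (√N + 2 * w + R ^ 2) ^ 2) := by
        have h7 : L ^ 7 ≤ L ^ 8 := pow_le_pow_right₀ hL (by norm_num)
        have hsn : 0 ≤ √N := Real.sqrt_nonneg _
        have e : (√N + 2 * w + R ^ 2) ^ 2 = √N ^ 2 + 4 * w ^ 2 + R ^ 4
            + (4 * √N * w + 2 * √N * R ^ 2 + 4 * w * R ^ 2) := by ring
        have e2 : 0 ≤ 4 * √N * w + 2 * √N * R ^ 2 + 4 * w * R ^ 2 := by positivity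
        have e3 : N + R ^ 2 * (N / U) + R ^ 2 * (N / U) + R ^ 4 ≤ (√N + 2 * w + R ^ 2) ^ 2 := by
          rw [e, hs, ← h4]
          linarith [sq_nonneg w]
        gcongr
    _ = (3 * L ^ 4 * (√N * (√N + 2 * w + R ^ 2))) ^ 2 := by
        rw [mul_pow, mul_pow √N, hs]; ring

/-- The contribution of one dyadic block to the type II sum. -/
lemma sum_primChars_dyadic_le {N R U M : ℕ} (hU : 1 ≤ U) (hUM : U ≤ M)
    (hR1 : 1 ≤ R) (hRN : R ≤ N) :
    ∑ q ∈ Icc 1 R, (q / q.totient : ℝ) * ∑ χ ∈ primChars q,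
      ‖∑ m ∈ Ioc M (2 * M), (vaughanAlpha U m : ℂ) * χ m * twistSum χ (vaughanBeta U) (N / m)‖
      ≤ 6 * (2 + Real.log N) ^ 5 * (N + 2 * (R * N / √U) + R ^ 2 * √N) := by
  have hlN := Real.log_natCast_nonneg N
  set L := 2 + Real.log N with hL
  have hL2 : 2 ≤ L := by linarith
  rcases Nat.lt_or_ge (N / U) M with hM | hM
  · have h0 : ∀ q : ℕ, ∀ χ : DirichletCharacter ℂ q,
        ∑ m ∈ Ioc M (2 * M), (vaughanAlpha U m : ℂ) * χ m
          * twistSum χ (vaughanBeta U) (N / m) = 0 := by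
      intro q χ
      refine sum_eq_zero fun m hm => ?_
      rw [twistSum_vaughanBeta_eq_zero, mul_zero]
      rw [mem_Ioc] at hm
      have : N < U * M := by
        rw [Nat.div_lt_iff_lt_mul hU] at hM; linarith
      have h1 : N / m < U := by
        rw [Nat.div_lt_iff_lt_mul (by omega)]
        nlinarith
      exact h1.le
    simp only [h0, norm_zero, sum_const_zero, mul_zero]
    positivity
  set K := N / M with hK
  have hM1 : 1 ≤ M := hU.trans hUM
  have hMU : M * U ≤ N := by
    have := Nat.div_mul_le_self N U
    nlinarith
  have hMN : M ≤ N := by nlinarith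
  have hN1 : 1 ≤ N := hM1.trans hMN
  have hK1 : 1 ≤ K := (Nat.one_le_div_iff hM1).2 hMN
  have hKM : K * M ≤ N := Nat.div_mul_le_self N M
  have hKN : K ≤ N := Nat.div_le_self _ _
  let Y : ℕ → ℕ := fun m => if M < m then N / m + 1 else 0
  have hY : ∀ m, Y m ≤ K + 1 := by
    intro m
    simp only [Y]
    split_ifs with h
    · have := Nat.div_le_div_left (a := N) h.le hM1
      omega
    · omega
  let a : ℕ → ℂ := fun m => if M < m then (vaughanAlpha U m : ℂ) else 0
  let b : ℕ → ℂ := fun n => (vaughanBeta U n : ℂ)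
  have hmain := sum_primChars_bilinear_le R (2 * M + 1) (K + 1) a b Y hY
  have hEq : ∀ q : ℕ, ∀ χ : DirichletCharacter ℂ q,
      ∑ m ∈ Ioc M (2 * M), (vaughanAlpha U m : ℂ) * χ m * twistSum χ (vaughanBeta U) (N / m)
      = ∑ m ∈ range (2 * M + 1), ∑ n ∈ range (K + 1),
          if n < Y m then a m * χ m * (b n * χ n) else 0 := by
    intro q χ
    have hsub : Ioc M (2 * M) ⊆ range (2 * M + 1) := by
      intro m hm; simp at hm ⊢; omega
    rw [← sum_subset hsub]
    · refine sum_congr rfl fun m hm => ?_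
      rw [mem_Ioc] at hm
      have e1 : Y m = N / m + 1 := if_pos hm.1
      have e2 : a m = (vaughanAlpha U m : ℂ) := if_pos hm.1
      have e3 : N / m ≤ K := Nat.div_le_div_left hm.1.le hM1
      rw [e1, e2, ← sum_filter, ← mul_sum]
      congr 1
      unfold twistSum
      have hs2 : Ioc 0 (N / m) ⊆ {n ∈ range (K + 1) | n < N / m + 1} := by
        intro n hn; simp at hn ⊢; omega
      refine sum_subset hs2 fun n hn hn' => ?_
      have : n = 0 := by simp at hn hn'; omega
      subst this
      simp
    · intro m hm hm'
      have : ¬ M < m := by simp at hm hm'; omega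
      simp [a, this]
  simp only [← hEq] at hmain
  refine hmain.trans ?_
  have hlR := log_natCast_mono hRN
  have hR0 := Real.log_natCast_nonneg R
  have hlog2 : Real.log 2 ≤ 1 := by have := Real.log_two_lt_d9; linarith
  -- the two square sums
  have hA : ∑ m ∈ range (2 * M + 1), ‖a m‖ ^ 2 ≤ M * L ^ 2 := by
    have : ∀ m ∈ range (2 * M + 1), ‖a m‖ ^ 2 ≤ if M < m then L ^ 2 else 0 := by
      intro m hm
      simp only [a]
      split_ifs
      · have h1 := abs_vaughanAlpha_le U (n := m) (N := 2 * N) (by simp at hm; omega)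
        rw [Complex.norm_real]
        have h2 : Real.log ((2 * N : ℕ) : ℝ) ≤ L := by
          push_cast
          rw [Real.log_mul (by norm_num) (by positivity)]
          linarith
        have h3 : ‖vaughanAlpha U m‖ ≤ L := h1.trans h2
        gcongr
      · simp
    refine (sum_le_sum this).trans ?_
    rw [← sum_filter, sum_const, nsmul_eq_mul]
    have : #{m ∈ range (2 * M + 1) | M < m} ≤ M := by
      calc _ ≤ #(Ioc M (2 * M)) := card_le_card fun m hm => by simp at hm ⊢; omega
        _ = M := by simp; omega
    gcongr
  have hB : ∑ n ∈ range (K + 1), ‖b n‖ ^ 2 ≤ K * L ^ 3 := by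
    have h1 : ∑ n ∈ range (K + 1), ‖b n‖ ^ 2 ≤ ∑ n ∈ Ioc 0 K, (n.divisors.card : ℝ) ^ 2 := by
      have hs : Ioc 0 K ⊆ range (K + 1) := by intro n hn; simp at hn ⊢; omega
      rw [← sum_subset hs]
      · refine sum_le_sum fun n _ => ?_
        simp only [b]
        rw [Complex.norm_real]
        have := abs_vaughanBeta_le hU n
        rw [Real.norm_eq_abs]
        gcongr
      · intro n hn hn'
        have : n = 0 := by simp at hn hn'; omega
        subst this
        simp [b]
    refine h1.trans ((sum_card_divisors_sq_le K).trans ?_)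
    have := log_natCast_mono hKN
    have := Real.log_natCast_nonneg K
    gcongr
    linarith
  have hcast1 : (1 : ℝ) ≤ M := by exact_mod_cast hM1
  have hcast2 : (1 : ℝ) ≤ K := by exact_mod_cast hK1
  have hcast3 : (K : ℝ) * M ≤ N := by exact_mod_cast hKM
  have hcast4 : (M : ℝ) * U ≤ N := by exact_mod_cast hMU
  have hcast5 : (K : ℝ) * U ≤ N := by
    refine le_trans ?_ hcast3
    gcongr
  have hcastU : (1 : ℝ) ≤ U := by exact_mod_cast hU
  have hsf : ∀ T : ℝ, ∀ n : ℕ, 1 ≤ T → (n : ℝ) ≤ 3 * T → sieveFactor R n ≤ 3 * L * (T + R ^ 2) := by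
    intro T n hT hn
    unfold sieveFactor
    have : (R : ℝ) ^ 2 * (1 + 2 * Real.log R) ≤ R ^ 2 * (3 * L) := by
      gcongr; linarith
    nlinarith
  have hSA := hsf M (2 * M + 1) hcast1 (by push_cast; linarith)
  have hSB := hsf K (K + 1) hcast2 (by push_cast; linarith)
  have hs : √(N : ℝ) ^ 2 = N := Real.sq_sqrt (by positivity)
  have hsq : √(sieveFactor R (2 * M + 1) * ∑ m ∈ range (2 * M + 1), ‖a m‖ ^ 2)
      * √(sieveFactor R (K + 1) * ∑ n ∈ range (K + 1), ‖b n‖ ^ 2)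
      ≤ 3 * L ^ 4 * (√N * (√N + 2 * (R * √N / √U) + R ^ 2)) := by
    have hMu : (M : ℝ) ≤ N / U := by rw [le_div_iff₀ (by linarith)]; exact hcast4
    have hKu : (K : ℝ) ≤ N / U := by rw [le_div_iff₀ (by linarith)]; exact hcast5
    have p1 := sieveFactor_nonneg R (2 * M + 1)
    have p2 := sieveFactor_nonneg R (K + 1)
    refine sqrt_mul_sqrt_le (M := M) (K := K) (by positivity) (by positivity) (by positivity)
      (by positivity) (by linarith) (by linarith) hcast3 hMu hKu (by positivity) ?_ ?_
    · exact mul_le_mul hSA hA (by positivity) (by positivity)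
    · exact mul_le_mul hSB hB (by positivity) (by positivity)
  have hlogK : 2 + Real.log ((K + 1 : ℕ) : ℝ) ≤ 2 * L := by
    have h1 := log_natCast_mono (show K + 1 ≤ 2 * N by omega)
    push_cast at h1 ⊢
    rw [Real.log_mul (by norm_num) (by positivity)] at h1
    linarith
  calc _ ≤ 2 * L * (3 * L ^ 4 * (√N * (√N + 2 * (R * √N / √U) + R ^ 2))) := by gcongr
    _ = 6 * L ^ 5 * (√N ^ 2 + 2 * (R * √N ^ 2 / √U) + R ^ 2 * √N) := by ring
    _ = _ := by rw [hs]

/-- The contribution of the type II sums in Vaughan's identity. -/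
lemma sum_primChars_typeII_le {N R U : ℕ} (hU : 1 ≤ U) (hR1 : 1 ≤ R) (hRN : R ≤ N) :
    ∑ q ∈ Icc 1 R, (q / q.totient : ℝ) * ∑ χ ∈ primChars q,
      ‖twistSum χ (vaughanAlpha U * vaughanBeta U) N‖
      ≤ 12 * (2 + Real.log N) ^ 6 * (N + 2 * (R * N / √U) + R ^ 2 * √N) := by
  have hlN := Real.log_natCast_nonneg N
  set L := 2 + Real.log N with hL
  set J := Nat.log 2 N + 1 with hJ
  have hN : N < 2 ^ J := Nat.lt_pow_succ_log_self (by norm_num) N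
  have key : ∀ q : ℕ, ∀ χ : DirichletCharacter ℂ q, twistSum χ (vaughanAlpha U * vaughanBeta U) N
      = ∑ j ∈ range J, ∑ m ∈ Ioc (U * 2 ^ j) (2 * (U * 2 ^ j)),
        (vaughanAlpha U m : ℂ) * χ m * twistSum χ (vaughanBeta U) (N / m) := by
    intro q χ
    set c : ℕ → ℂ := fun m => (vaughanAlpha U m : ℂ) * χ m * twistSum χ (vaughanBeta U) (N / m)
    have h1 : ∀ J : ℕ, ∑ j ∈ range J, ∑ m ∈ Ioc (U * 2 ^ j) (2 * (U * 2 ^ j)), c m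
        = ∑ m ∈ Ioc U (U * 2 ^ J), c m := by
      intro J
      induction J with
      | zero => simp
      | succ J ih =>
        rw [sum_range_succ, ih, show 2 * (U * 2 ^ J) = U * 2 ^ (J + 1) by ring]
        refine sum_Ioc_consecutive c (Nat.le_mul_of_pos_right _ (by positivity)) ?_
        exact Nat.mul_le_mul_left _ (Nat.pow_le_pow_right (by norm_num) (by omega))
    have hbig : N ≤ U * 2 ^ J := by nlinarith
    rw [h1, twistSum_mul]
    have h2 : ∑ m ∈ Ioc U (U * 2 ^ J), c m = ∑ m ∈ Ioc 0 (U * 2 ^ J), c m := by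
      refine sum_subset (Ioc_subset_Ioc_left (Nat.zero_le _)) fun m hm hm' => ?_
      have : m ≤ U := by simp at hm hm'; omega
      simp [c, vaughanAlpha_eq_zero this]
    rw [h2]
    refine sum_subset (Ioc_subset_Ioc_right hbig) fun m hm hm' => ?_
    have : N < m := by simp at hm hm'; omega
    simp [Nat.div_eq_of_lt this, twistSum]
  set B := 6 * L ^ 5 * (N + 2 * (R * N / √U) + R ^ 2 * √N) with hB
  have hB0 : 0 ≤ B := by positivity
  calc _ ≤ ∑ q ∈ Icc 1 R, (q / q.totient : ℝ) * ∑ χ ∈ primChars q, ∑ j ∈ range J,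
        ‖∑ m ∈ Ioc (U * 2 ^ j) (2 * (U * 2 ^ j)), (vaughanAlpha U m : ℂ) * χ m
          * twistSum χ (vaughanBeta U) (N / m)‖ := by
        refine sum_le_sum fun q _ => ?_
        refine mul_le_mul_of_nonneg_left (sum_le_sum fun χ _ => ?_) (by positivity)
        rw [key q χ]
        exact norm_sum_le _ _
    _ = ∑ j ∈ range J, ∑ q ∈ Icc 1 R, (q / q.totient : ℝ) * ∑ χ ∈ primChars q,
        ‖∑ m ∈ Ioc (U * 2 ^ j) (2 * (U * 2 ^ j)), (vaughanAlpha U m : ℂ) * χ m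
          * twistSum χ (vaughanBeta U) (N / m)‖ := by
        rw [sum_comm]
        refine sum_congr rfl fun q _ => ?_
        rw [sum_comm, mul_sum]
    _ ≤ ∑ j ∈ range J, B := by
        refine sum_le_sum fun j _ => sum_primChars_dyadic_le hU ?_ hR1 hRN
        exact Nat.le_mul_of_pos_right _ (by positivity)
    _ = J * B := by simp
    _ ≤ (2 * L) * B := by
        gcongr
        have h1 : (Nat.log 2 N : ℝ) ≤ Real.log N / Real.log 2 := by
          have := Real.natLog_le_logb N 2
          simpa [Real.logb] using this
        have h2 := Real.log_two_gt_d9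
        have h3 : Real.log N / Real.log 2 ≤ 2 * Real.log N := by
          rw [div_le_iff₀ (by linarith)]; nlinarith
        rw [hJ]; push_cast; linarith
    _ = _ := by rw [hB]; ring

lemma card_primChars_le {q : ℕ} (hq : 0 < q) : (primChars q).card ≤ q.totient := by
  have : NeZero q := ⟨hq.ne'⟩
  rw [← DirichletCharacter.card_eq_totient_of_hasEnoughRootsOfUnity ℂ q]
  rw [Nat.card_eq_fintype_card]
  exact card_le_univ _

lemma ne_one_of_mem_primChars {q : ℕ} (hq : 1 < q) {χ : DirichletCharacter ℂ q}
    (h : χ ∈ primChars q) : χ ≠ 1 := by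
  rintro rfl
  have : NeZero q := ⟨by omega⟩
  have h1 := mem_primChars.1 h
  rw [DirichletCharacter.isPrimitive_def, DirichletCharacter.conductor_one] at h1
  omega

/-- The mean value theorem for prime sums twisted by primitive characters. -/
theorem sum_primChars_vonMangoldt_le {N R U : ℕ} (hU : 1 ≤ U) (hUN : U ≤ N) (hR1 : 1 ≤ R)
    (hRN : R ≤ N) :
    ∑ q ∈ Icc 2 R, (q / q.totient : ℝ) * ∑ χ ∈ primChars q, ‖twistSum χ vonMangoldt N‖
      ≤ 24 * (2 + Real.log N) ^ 6 * (N + R * N / √U + R ^ 2 * √N + R ^ 2 * √R * U ^ 2) := by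
  have hlN := Real.log_natCast_nonneg N
  have hII := sum_primChars_typeII_le (N := N) hU hR1 hRN
  set L := 2 + Real.log N with hL
  have hL2 : 2 ≤ L := by linarith
  have h1 : ∀ q ∈ Icc 2 R, (q / q.totient : ℝ) * ∑ χ ∈ primChars q, ‖twistSum χ vonMangoldt N‖
      ≤ R * (4 * (√R * L) * U ^ 2 * L) + (q / q.totient : ℝ) * ∑ χ ∈ primChars q,
      ‖twistSum χ (vaughanAlpha U * vaughanBeta U) N‖ := by
    intro q hq
    rw [mem_Icc] at hq
    have : NeZero q := ⟨by omega⟩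
    have hqR : (q : ℝ) ≤ R := by exact_mod_cast hq.2
    have hq1 : (1 : ℝ) ≤ q := by exact_mod_cast (show 1 ≤ q by omega)
    have hφ : (0 : ℝ) < q.totient := by exact_mod_cast Nat.totient_pos.2 (by omega)
    have h2 : ∀ χ ∈ primChars q, ‖twistSum χ vonMangoldt N‖ ≤ 4 * (√R * L) * U ^ 2 * L
        + ‖twistSum χ (vaughanAlpha U * vaughanBeta U) N‖ := by
      intro χ hχ
      have hP : ∀ M : ℕ, ‖∑ n ∈ range M, χ n‖ ≤ √q * (2 + Real.log q) :=
        polya_vinogradov (mem_primChars.1 hχ) (ne_one_of_mem_primChars (by omega) hχ)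
      have hlq := log_natCast_mono (hq.2.trans hRN)
      have hlq0 := Real.log_natCast_nonneg q
      have hs1 : 1 ≤ √(q : ℝ) := by rw [Real.one_le_sqrt]; exact hq1
      refine (norm_twistSum_vonMangoldt_sub_le (by omega) χ (by nlinarith) hP hU hUN).trans ?_
      refine add_le_add ?_ le_rfl
      gcongr <;> linarith
    calc _ ≤ (q / q.totient : ℝ) * ∑ χ ∈ primChars q, (4 * (√R * L) * U ^ 2 * L
        + ‖twistSum χ (vaughanAlpha U * vaughanBeta U) N‖) := by
          gcongr with χ hχ; exact h2 χ hχ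
      _ = (q / q.totient : ℝ) * ((primChars q).card * (4 * (√R * L) * U ^ 2 * L))
        + (q / q.totient : ℝ) * ∑ χ ∈ primChars q,
          ‖twistSum χ (vaughanAlpha U * vaughanBeta U) N‖ := by
          rw [sum_add_distrib, mul_add, sum_const, nsmul_eq_mul]
      _ ≤ _ := by
          refine add_le_add ?_ le_rfl
          have hc : ((primChars q).card : ℝ) ≤ q.totient := by
            exact_mod_cast card_primChars_le (by omega)
          calc _ ≤ (R / q.totient : ℝ) * (q.totient * (4 * (√R * L) * U ^ 2 * L)) := by gcongr
            _ = _ := by field_simp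
  refine (sum_le_sum h1).trans ?_
  rw [sum_add_distrib, sum_const, nsmul_eq_mul]
  have h3 : ((Icc 2 R).card : ℝ) ≤ R := by
    exact_mod_cast (show (Icc 2 R).card ≤ R by simp)
  have h4 : ∑ q ∈ Icc 2 R, (q / q.totient : ℝ) * ∑ χ ∈ primChars q,
      ‖twistSum χ (vaughanAlpha U * vaughanBeta U) N‖ ≤ ∑ q ∈ Icc 1 R, (q / q.totient : ℝ)
        * ∑ χ ∈ primChars q, ‖twistSum χ (vaughanAlpha U * vaughanBeta U) N‖ :=
    sum_le_sum_of_subset_of_nonneg (Icc_subset_Icc_left (by norm_num)) fun q _ _ => by positivity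
  have h5 : L ^ 2 ≤ L ^ 6 := pow_le_pow_right₀ (by linarith) (by norm_num)
  calc _ ≤ R * (R * (4 * (√R * L) * U ^ 2 * L))
        + 12 * L ^ 6 * (N + 2 * (R * N / √U) + R ^ 2 * √N) := by
        gcongr; exact h4.trans hII
    _ = 4 * L ^ 2 * (R ^ 2 * √R * U ^ 2) + 12 * L ^ 6 * (N + 2 * (R * N / √U) + R ^ 2 * √N) := by
        ring
    _ ≤ 24 * L ^ 6 * (R ^ 2 * √R * U ^ 2)
        + 24 * L ^ 6 * (N + R * N / √U + R ^ 2 * √N) := by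
        refine add_le_add ?_ ?_
        · gcongr; norm_num
        · have : 0 ≤ L ^ 6 * N := by positivity
          have : 0 ≤ L ^ 6 * (R ^ 2 * √N) := by positivity
          nlinarith
    _ = _ := by ring

end BombieriVinogradov

namespace BombieriVinogradov

open Finset

/-! ### Dirichlet series with periodic coefficients of mean zero -/

/-- Bounded functions of period `q` with mean value zero. -/
structure PeriodicMeanZero (q : ℕ) (f : ℕ → ℂ) : Prop where
  pos : 0 < q
  periodic : ∀ n, f (n + q) = f n
  sum_eq_zero : ∑ n ∈ range q, f n = 0
  norm_le_one : ∀ n, ‖f n‖ ≤ 1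

lemma norm_cpow_neg_le {a σ : ℝ} {s : ℂ} (ha : 1 ≤ a) (hs : σ ≤ s.re) :
    ‖(a : ℂ) ^ (-s)‖ ≤ a ^ (-σ) := by
  rw [Complex.norm_cpow_eq_rpow_re_of_pos (by linarith)]
  exact Real.rpow_le_rpow_of_exponent_le ha (by simpa using hs)

lemma norm_cpow_neg_sub_le {a b σ : ℝ} {s : ℂ} (ha : 1 ≤ a) (hab : a ≤ b) (hσ : 0 ≤ σ)
    (hs : σ ≤ s.re) (hs0 : s ≠ 0) :
    ‖(b : ℂ) ^ (-s) - (a : ℂ) ^ (-s)‖ ≤ ‖s‖ * a ^ (-σ - 1) * (b - a) := by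
  have key := Convex.norm_image_sub_le_of_norm_hasDerivWithin_le (𝕜 := ℝ)
    (f := fun x : ℝ => (x : ℂ) ^ (-s)) (f' := fun x : ℝ => (-s) * (x : ℂ) ^ (-s - 1))
    (s := Set.Icc a b) (C := ‖s‖ * a ^ (-σ - 1)) (x := a) (y := b) ?_ ?_ (convex_Icc a b)
    (by simpa using hab) (by simpa using hab)
  · rwa [Real.norm_of_nonneg (by linarith : 0 ≤ b - a)] at key
  · intro x hx
    exact (hasDerivAt_ofReal_cpow_const (by linarith [hx.1] : x ≠ 0)
      (neg_ne_zero.2 hs0)).hasDerivWithinAt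
  · intro x hx
    rw [norm_mul, norm_neg]
    gcongr
    rw [Complex.norm_cpow_eq_rpow_re_of_pos (by linarith [hx.1])]
    calc x ^ ((-s - 1).re) ≤ x ^ (-σ - 1) := by
          refine Real.rpow_le_rpow_of_exponent_le (by linarith [hx.1]) ?_
          simp; linarith
      _ ≤ a ^ (-σ - 1) :=
          Real.rpow_le_rpow_of_nonpos (by linarith) hx.1 (by linarith)

/-- The sum of the terms of a Dirichlet series over the `k`-th block of length `q`. -/
noncomputable def blockSum (q : ℕ) (f : ℕ → ℂ) (s : ℂ) (k : ℕ) : ℂ :=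
  ∑ j ∈ range q, LSeries.term f s (k * q + j)

/-- The Dirichlet series of `f` summed over blocks of length `q`. -/
noncomputable def blockLSeries (q : ℕ) (f : ℕ → ℂ) (s : ℂ) : ℂ := ∑' k, blockSum q f s k

lemma PeriodicMeanZero.periodic_mul {q : ℕ} {f : ℕ → ℂ} (h : PeriodicMeanZero q f) (k j : ℕ) :
    f (k * q + j) = f j := by
  induction k with
  | zero => simp
  | succ k ih => rw [show (k + 1) * q + j = (k * q + j) + q by ring, h.periodic, ih]

lemma norm_term_le_rpow {f : ℕ → ℂ} (hf : ∀ n, ‖f n‖ ≤ 1) {σ : ℝ} {s : ℂ} (hs : σ ≤ s.re)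
    {n : ℕ} (hn : 1 ≤ n) : ‖LSeries.term f s n‖ ≤ (n : ℝ) ^ (-σ) := by
  rw [LSeries.term_of_ne_zero (by omega), div_eq_mul_inv, ← Complex.cpow_neg, norm_mul]
  have h1 := norm_cpow_neg_le (a := n) (by exact_mod_cast hn) hs
  rw [Complex.ofReal_natCast] at h1
  calc _ ≤ 1 * (n : ℝ) ^ (-σ) := by gcongr; exact hf n
    _ = _ := one_mul _

lemma PeriodicMeanZero.norm_blockSum_zero_le {q : ℕ} {f : ℕ → ℂ} (h : PeriodicMeanZero q f)
    {η : ℝ} (hη : 0 < η) {s : ℂ} (hs : 1 - η ≤ s.re) :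
    ‖blockSum q f s 0‖ ≤ (q : ℝ) ^ η * (1 + Real.log q) := by
  unfold blockSum
  have hq : (1 : ℝ) ≤ q := by exact_mod_cast h.pos
  calc _ ≤ ∑ j ∈ range q, ‖LSeries.term f s j‖ := by
        simpa using norm_sum_le (range q) fun j => LSeries.term f s (0 * q + j)
    _ ≤ ∑ j ∈ range q, (if 0 < j then (q : ℝ) ^ η * (1 / j) else 0) := by
        refine sum_le_sum fun j hj => ?_
        rw [mem_range] at hj
        split_ifs with h0
        · refine (norm_term_le_rpow h.norm_le_one hs h0).trans ?_
          have hj0 : (0 : ℝ) < j := by exact_mod_cast h0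
          rw [show -(1 - η) = η + (-1) by ring, Real.rpow_add hj0, Real.rpow_neg_one, one_div]
          gcongr
        · have : j = 0 := by omega
          simp [this]
    _ = (q : ℝ) ^ η * ∑ j ∈ (range q).filter (0 < ·), 1 / (j : ℝ) := by
        rw [← sum_filter, mul_sum]
    _ ≤ (q : ℝ) ^ η * ∑ j ∈ Ioc 0 q, 1 / (j : ℝ) := by
        gcongr
        intro j hj; simp at hj ⊢; omega
    _ ≤ _ := by gcongr; exact harmonic_Ioc_le q

lemma PeriodicMeanZero.norm_blockSum_le {q : ℕ} {f : ℕ → ℂ} (h : PeriodicMeanZero q f)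
    {η : ℝ} (hη : 0 < η) (hη2 : η ≤ 1 / 2) {s : ℂ} (hs : 1 - η ≤ s.re) (k : ℕ) :
    ‖blockSum q f s (k + 1)‖ ≤ (q : ℝ) ^ η * ‖s‖ ^ (2 * η) * ((k : ℝ) + 1) ^ (-1 - η) := by
  have hq : (1 : ℝ) ≤ q := by exact_mod_cast h.pos
  have hq0 : (0 : ℝ) < q := by linarith
  set K : ℝ := (k : ℝ) + 1 with hK
  have hK1 : 1 ≤ K := by rw [hK]; linarith [(Nat.cast_nonneg k : (0 : ℝ) ≤ k)]
  have hK0 : 0 < K := by linarith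
  have hs0 : s ≠ 0 := by rintro rfl; simp at hs; linarith
  have hKq : 1 ≤ K * q := by nlinarith
  have ht : ∀ j, LSeries.term f s ((k + 1) * q + j)
      = f j * (((K * q + j : ℝ) : ℂ) ^ (-s)) := by
    intro j
    rw [LSeries.term_of_ne_zero (by have := h.pos; positivity), h.periodic_mul, div_eq_mul_inv,
      ← Complex.cpow_neg]
    push_cast [hK]; rfl
  have e0 : (K * q) ^ (-(1 - η)) * q = (q : ℝ) ^ η * K ^ (-(1 - η)) := by
    rw [Real.mul_rpow hK0.le hq0.le, mul_assoc, ← Real.rpow_add_one hq0.ne']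
    rw [show -(1 - η) + 1 = η by ring]; ring
  have b1 : ‖blockSum q f s (k + 1)‖ ≤ (q : ℝ) ^ η * K ^ (-(1 - η)) := by
    unfold blockSum
    calc _ ≤ ∑ j ∈ range q, (K * q) ^ (-(1 - η)) := by
          refine norm_sum_le_of_le _ fun j _ => ?_
          rw [ht, norm_mul]
          have hj : (0 : ℝ) ≤ j := Nat.cast_nonneg j
          calc _ ≤ 1 * (K * q + j) ^ (-(1 - η)) := by
                gcongr
                · exact h.norm_le_one j
                · exact norm_cpow_neg_le (by linarith) hs
            _ ≤ _ := by
                rw [one_mul]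
                exact Real.rpow_le_rpow_of_nonpos (by linarith) (by linarith) (by linarith)
      _ = (K * q) ^ (-(1 - η)) * q := by rw [sum_const, card_range, nsmul_eq_mul, mul_comm]
      _ = _ := e0
  have b2 : ‖blockSum q f s (k + 1)‖ ≤ (q : ℝ) ^ η * K ^ (-(1 - η)) * (‖s‖ / K) := by
    have e1 : blockSum q f s (k + 1) = ∑ j ∈ range q,
        f j * (((K * q + j : ℝ) : ℂ) ^ (-s) - ((K * q : ℝ) : ℂ) ^ (-s)) := by
      unfold blockSum
      simp only [mul_sub, sum_sub_distrib, ht]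
      rw [← sum_mul, h.sum_eq_zero, zero_mul, sub_zero]
    rw [e1]
    calc _ ≤ ∑ j ∈ range q, ‖s‖ * (K * q) ^ (-(1 - η) - 1) * q := by
          refine norm_sum_le_of_le _ fun j hj => ?_
          rw [norm_mul]
          have hj0 : (0 : ℝ) ≤ j := Nat.cast_nonneg j
          have hjq : (j : ℝ) ≤ q := by exact_mod_cast (mem_range.1 hj).le
          calc _ ≤ 1 * (‖s‖ * (K * q) ^ (-(1 - η) - 1) * ((K * q + j) - K * q)) := by
                gcongr
                · exact h.norm_le_one j
                · exact norm_cpow_neg_sub_le hKq (by linarith) (by linarith) hs hs0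
            _ ≤ _ := by
                rw [one_mul]
                gcongr
                linarith
      _ = ‖s‖ * (K * q) ^ (-(1 - η) - 1) * q * q := by
          rw [sum_const, card_range, nsmul_eq_mul]; ring
      _ = ((K * q) ^ (-(1 - η)) * q) * (‖s‖ / K) := by
          rw [Real.rpow_sub_one (by positivity)]
          field_simp
      _ = _ := by rw [e0]
  set D := (q : ℝ) ^ η * K ^ (-(1 - η)) with hD
  have hD0 : 0 ≤ D := by positivity
  have b3 : ‖blockSum q f s (k + 1)‖ ≤ D * (‖s‖ / K) ^ (2 * η) := by
    rcases le_total 1 (‖s‖ / K) with hx | hx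
    · refine b1.trans (le_mul_of_one_le_right hD0 (Real.one_le_rpow hx (by linarith)))
    · refine b2.trans (mul_le_mul_of_nonneg_left ?_ hD0)
      have hpos : 0 < ‖s‖ / K := by have := norm_pos_iff.2 hs0; positivity
      calc ‖s‖ / K = (‖s‖ / K) ^ (1 : ℝ) := (Real.rpow_one _).symm
        _ ≤ _ := Real.rpow_le_rpow_of_exponent_ge hpos hx (by linarith)
  refine b3.trans (le_of_eq ?_)
  rw [Real.div_rpow (norm_nonneg _) hK0.le, hD, show -1 - η = -(1 - η) - 2 * η by ring,
    Real.rpow_sub hK0]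
  ring

lemma summable_rpow_neg_one_sub {η : ℝ} (hη : 0 < η) :
    Summable fun k : ℕ => ((k : ℝ) + 1) ^ (-1 - η) := by
  have := (Real.summable_nat_rpow (p := -1 - η)).2 (by linarith)
  have h2 := (summable_nat_add_iff 1).2 this
  simpa using h2

lemma PeriodicMeanZero.summable_blockSum {q : ℕ} {f : ℕ → ℂ} (h : PeriodicMeanZero q f)
    {s : ℂ} (hs : 1 / 2 ≤ s.re) : Summable (blockSum q f s) := by
  rw [← summable_nat_add_iff 1]
  refine Summable.of_norm_bounded ((summable_rpow_neg_one_sub (η := 1 / 2) (by norm_num)).mul_left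
    ((q : ℝ) ^ (1 / 2 : ℝ) * ‖s‖ ^ (2 * (1 / 2) : ℝ))) fun k => ?_
  exact h.norm_blockSum_le (by norm_num) le_rfl (by linarith) k

/-- The convexity-free bound for `L`-functions close to the line `Re s = 1`. -/
theorem exists_norm_blockLSeries_le {η : ℝ} (hη : 0 < η) (hη2 : η ≤ 1 / 2) :
    ∃ C : ℝ, 1 ≤ C ∧ ∀ (q : ℕ) (f : ℕ → ℂ), PeriodicMeanZero q f → ∀ s : ℂ, 1 - η ≤ s.re →
      ‖blockLSeries q f s‖ ≤ C * (q * (1 + ‖s‖)) ^ (2 * η) := by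
  set Z := ∑' k : ℕ, ((k : ℝ) + 1) ^ (-1 - η) with hZ
  have hZ0 : 0 ≤ Z := tsum_nonneg fun k => by positivity
  refine ⟨1 + 1 / η + Z, by have : 0 < 1 / η := by positivity
                            linarith, fun q f h s hs => ?_⟩
  have hq : (1 : ℝ) ≤ q := by exact_mod_cast h.pos
  have hsum := h.summable_blockSum (s := s) (by linarith)
  have e1 : blockLSeries q f s = blockSum q f s 0 + ∑' k, blockSum q f s (k + 1) :=
    hsum.tsum_eq_zero_add
  have b1 := h.norm_blockSum_zero_le hη hs
  have b2 : ‖∑' k, blockSum q f s (k + 1)‖ ≤ (q : ℝ) ^ η * ‖s‖ ^ (2 * η) * Z :=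
    tsum_of_norm_bounded ((summable_rpow_neg_one_sub hη).hasSum.mul_left _)
      fun k => h.norm_blockSum_le hη hη2 hs k
  have hlog : Real.log q ≤ (q : ℝ) ^ η / η := Real.log_le_rpow_div (by linarith) hη
  have hq1 : 1 ≤ (q : ℝ) ^ η := Real.one_le_rpow hq hη.le
  have hq2 : (q : ℝ) ^ (2 * η) = (q : ℝ) ^ η * (q : ℝ) ^ η := by
    rw [← Real.rpow_add (by linarith)]; ring_nf
  have hs1 : 1 ≤ (1 + ‖s‖) ^ (2 * η) :=
    Real.one_le_rpow (by linarith [norm_nonneg s]) (by linarith)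
  have hs2 : ‖s‖ ^ (2 * η) ≤ (1 + ‖s‖) ^ (2 * η) :=
    Real.rpow_le_rpow (norm_nonneg _) (by linarith) (by linarith)
  rw [Real.mul_rpow (by linarith) (by positivity), hq2, e1]
  refine (norm_add_le _ _).trans ((add_le_add b1 b2).trans ?_)
  set x := (q : ℝ) ^ η
  set y := (1 + ‖s‖) ^ (2 * η)
  calc x * (1 + Real.log q) + x * ‖s‖ ^ (2 * η) * Z ≤ x * (x + x / η) + x * y * Z := by gcongr
    _ ≤ (x * (x + x / η)) * y + x * y * Z * x := by
        refine add_le_add (le_mul_of_one_le_right (by positivity) hs1)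
          (le_mul_of_one_le_right (by positivity) hq1)
    _ = _ := by ring

lemma PeriodicMeanZero.differentiableOn {q : ℕ} {f : ℕ → ℂ} (h : PeriodicMeanZero q f) :
    DifferentiableOn ℂ (blockLSeries q f) {s | 1 / 2 < s.re} := by
  have hopen : IsOpen {s : ℂ | 1 / 2 < s.re} := isOpen_lt continuous_const Complex.continuous_re
  intro s hs
  set U : Set ℂ := {z | 1 / 2 < z.re} ∩ Metric.ball 0 (‖s‖ + 1) with hU
  have hUo : IsOpen U := hopen.inter Metric.isOpen_ball
  have hsU : s ∈ U := ⟨hs, by simp⟩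
  have hq : (1 : ℝ) ≤ q := by exact_mod_cast h.pos
  have hd : ∀ k, DifferentiableOn ℂ (fun z => blockSum q f z k) U := by
    intro k
    unfold blockSum
    refine DifferentiableOn.fun_sum fun j _ => ?_
    intro z _
    refine DifferentiableAt.differentiableWithinAt ?_
    by_cases h0 : k * q + j = 0
    · rw [h0]; simp
    · simp only [LSeries.term_of_ne_zero h0]
      have : ((k * q + j : ℕ) : ℂ) ≠ 0 := by exact_mod_cast h0
      refine DifferentiableAt.div (by fun_prop) ?_ ?_
      · exact DifferentiableAt.const_cpow differentiableAt_id (Or.inl this)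
      · rw [Complex.cpow_ne_zero_iff]; exact Or.inl this
  have key : DifferentiableOn ℂ (fun z => ∑' k, blockSum q f z (k + 1)) U := by
    refine Complex.differentiableOn_tsum_of_summable_norm
      (u := fun k : ℕ => (q : ℝ) ^ (1 / 2 : ℝ) * (‖s‖ + 1) ^ (2 * (1 / 2) : ℝ)
        * ((k : ℝ) + 1) ^ (-1 - 1 / 2 : ℝ))
      ((summable_rpow_neg_one_sub (by norm_num)).mul_left _) (fun k => hd (k + 1)) hUo
      fun k z hz => ?_
    have hz1 : 1 / 2 < z.re := hz.1
    refine (h.norm_blockSum_le (η := 1 / 2) (by norm_num) le_rfl (by linarith) k).trans ?_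
    have hz2 : ‖z‖ ≤ ‖s‖ + 1 := by have := hz.2; simp at this; exact this.le
    gcongr
  have e1 : Set.EqOn (blockLSeries q f)
      (fun z => blockSum q f z 0 + ∑' k, blockSum q f z (k + 1)) U := fun z hz =>
    (h.summable_blockSum (le_of_lt hz.1)).tsum_eq_zero_add
  have := ((hd 0).add key).congr e1
  exact (this.differentiableAt (hUo.mem_nhds hsU)).differentiableWithinAt

lemma PeriodicMeanZero.lseriesSummable {q : ℕ} {f : ℕ → ℂ} (h : PeriodicMeanZero q f)
    {s : ℂ} (hs : 1 < s.re) : LSeriesSummable f s :=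
  LSeriesSummable_of_bounded_of_one_lt_re (m := 1) (fun n _ => h.norm_le_one n) hs

lemma PeriodicMeanZero.blockLSeries_eq {q : ℕ} {f : ℕ → ℂ} (h : PeriodicMeanZero q f)
    {s : ℂ} (hs : 1 < s.re) : blockLSeries q f s = LSeries f s := by
  have : NeZero q := ⟨h.pos.ne'⟩
  have hsum := h.lseriesSummable hs
  unfold LSeriesSummable at hsum
  unfold LSeries blockLSeries
  rw [← (Nat.divModEquiv q).symm.tsum_eq (LSeries.term f s)]
  have hs2 := (Nat.divModEquiv q).symm.summable_iff.2 hsum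
  refine Eq.trans ?_ (Summable.tsum_prod hs2).symm
  refine tsum_congr fun k => ?_
  rw [tsum_fintype]
  unfold blockSum
  rw [← Fin.sum_univ_eq_sum_range (fun j => LSeries.term f s (k * q + j))]
  rfl

lemma eqOn_of_eqOn_one_lt_re {F G : ℂ → ℂ} (hF : DifferentiableOn ℂ F {s | 1 / 2 < s.re})
    (hG : DifferentiableOn ℂ G {s | 1 / 2 < s.re}) (h : ∀ s : ℂ, 1 < s.re → F s = G s) :
    Set.EqOn F G {s | 1 / 2 < s.re} := by
  have hopen : IsOpen {s : ℂ | 1 / 2 < s.re} := isOpen_lt continuous_const Complex.continuous_re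
  refine AnalyticOnNhd.eqOn_of_preconnected_of_eventuallyEq (z₀ := 2)
    (hF.analyticOnNhd hopen) (hG.analyticOnNhd hopen) ?_ (by simp; norm_num) ?_
  · exact (convex_halfSpace_re_gt (1 / 2)).isPreconnected
  · filter_upwards [(isOpen_lt continuous_const Complex.continuous_re).mem_nhds
      (show (2 : ℂ) ∈ {s : ℂ | 1 < s.re} by simp)] with s hs
    exact h s hs

lemma periodicMeanZero_char {q : ℕ} [NeZero q] {χ : DirichletCharacter ℂ q} (hχ : χ ≠ 1) :
    PeriodicMeanZero q (fun n => χ n) where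
  pos := Nat.pos_of_ne_zero (NeZero.ne q)
  periodic n := by simp
  sum_eq_zero := sum_range_char_eq_zero hχ
  norm_le_one n := χ.norm_le_one _

lemma LFunction_eq_blockLSeries {q : ℕ} [NeZero q] {χ : DirichletCharacter ℂ q} (hχ : χ ≠ 1)
    {s : ℂ} (hs : 1 / 2 < s.re) : χ.LFunction s = blockLSeries q (fun n => χ n) s := by
  refine eqOn_of_eqOn_one_lt_re (DirichletCharacter.differentiable_LFunction hχ).differentiableOn
    (periodicMeanZero_char hχ).differentiableOn (fun s hs => ?_) hs
  rw [DirichletCharacter.LFunction_eq_LSeries χ hs, (periodicMeanZero_char hχ).blockLSeries_eq hs]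

end BombieriVinogradov

namespace BombieriVinogradov

open Finset

/-! ### Bounds to the right of the line `Re s = 1` -/

/-- The difference between a term of the zeta series and the corresponding integral. -/
noncomputable def zetaDiff (s : ℂ) (x : ℝ) : ℂ :=
  (x : ℂ) ^ (-s) - ((x : ℂ) ^ (1 - s) - ((x + 1 : ℝ) : ℂ) ^ (1 - s)) / (s - 1)

lemma norm_zetaDiff_le_two_div {s : ℂ} (hs : 1 < s.re) {x : ℝ} (hx : 1 ≤ x) :
    ‖zetaDiff s x‖ ≤ 2 / x := by
  have hs1 : s - 1 ≠ 0 := by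
    intro h; have := congrArg Complex.re h; simp at this; linarith
  have h1 := norm_cpow_neg_le (s := s) (σ := 1) hx hs.le
  have h2 := norm_cpow_neg_sub_le (s := s - 1) (σ := 0) (b := x + 1) hx (by linarith) le_rfl
    (by simpa using hs.le) hs1
  rw [neg_sub] at h2
  unfold zetaDiff
  have h3 : ‖((x : ℂ) ^ (1 - s) - ((x + 1 : ℝ) : ℂ) ^ (1 - s)) / (s - 1)‖ ≤ x ^ (-1 : ℝ) := by
    rw [norm_div, div_le_iff₀ (norm_pos_iff.2 hs1), norm_sub_rev]
    refine h2.trans (le_of_eq ?_)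
    norm_num
    ring
  refine (norm_sub_le _ _).trans ((add_le_add h1 h3).trans (le_of_eq ?_))
  rw [Real.rpow_neg_one]
  ring

lemma norm_zetaDiff_le_div_sq {s : ℂ} (hs : 1 < s.re) {x : ℝ} (hx : 1 ≤ x) :
    ‖zetaDiff s x‖ ≤ ‖s‖ / x ^ 2 := by
  have hs0 : s ≠ 0 := by rintro rfl; simp at hs; linarith
  have hs1 : s - 1 ≠ 0 := by
    intro h; have := congrArg Complex.re h; simp at this; linarith
  have hs1' : 1 - s ≠ 0 := by rw [← neg_sub]; exact neg_ne_zero.2 hs1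
  have key := Convex.norm_image_sub_le_of_norm_hasDerivWithin_le (𝕜 := ℝ)
    (f := fun u : ℝ => (x : ℂ) ^ (-s) * ((u - x : ℝ) : ℂ)
      - ((x : ℂ) ^ (1 - s) - (u : ℂ) ^ (1 - s)) / (s - 1))
    (f' := fun u : ℝ => (x : ℂ) ^ (-s) - (u : ℂ) ^ (-s))
    (s := Set.Icc x (x + 1)) (C := ‖s‖ * x ^ (-1 - 1 : ℝ)) (x := x) (y := x + 1) ?_ ?_
    (convex_Icc _ _) (by simp) (by simp)
  · have e : ‖s‖ * x ^ (-1 - 1 : ℝ) = ‖s‖ / x ^ 2 := by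
      rw [show (-1 - 1 : ℝ) = -(2 : ℕ) by norm_num, Real.rpow_neg (by linarith),
        Real.rpow_natCast]; rfl
    rw [e] at key
    unfold zetaDiff
    simpa using key
  · intro u hu
    have hu0 : u ≠ 0 := by linarith [hu.1]
    have d1 := hasDerivAt_ofReal_cpow_const (r := -s) hu0 (neg_ne_zero.2 hs0)
    have d2 : HasDerivAt (fun u : ℝ => (u : ℂ) ^ (1 - s)) ((1 - s) * (u : ℂ) ^ (-s)) u := by
      have := hasDerivAt_ofReal_cpow_const (r := 1 - s) hu0 hs1'
      rwa [show 1 - s - 1 = -s by ring] at this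
    have d3 : HasDerivAt (fun u : ℝ => ((u - x : ℝ) : ℂ)) 1 u := by
      have := ((hasDerivAt_id u).sub_const x).ofReal_comp
      simpa using this
    have d4 := (d3.const_mul ((x : ℂ) ^ (-s))).sub
      ((d2.const_sub ((x : ℂ) ^ (1 - s))).div_const (s - 1))
    refine HasDerivAt.hasDerivWithinAt (d4.congr_deriv ?_)
    field_simp
    ring
  · intro u hu
    rw [norm_sub_rev]
    have := norm_cpow_neg_sub_le (σ := 1) hx hu.1 (by norm_num) hs.le hs0
    refine this.trans (mul_le_of_le_one_right (by positivity) (by linarith [hu.2]))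

lemma norm_zetaDiff_le {s : ℂ} (hs : 1 < s.re) {x ε : ℝ} (hx : 1 ≤ x) (hε : 0 < ε) (hε1 : ε ≤ 1) :
    ‖zetaDiff s x‖ ≤ 2 * ‖s‖ ^ ε * x ^ (-1 - ε) := by
  have hx0 : 0 < x := by linarith
  have hs0 : 0 < ‖s‖ := norm_pos_iff.2 (by rintro rfl; simp at hs; linarith)
  have e : 2 * ‖s‖ ^ ε * x ^ (-1 - ε) = 2 / x * (‖s‖ / x) ^ ε := by
    rw [Real.div_rpow hs0.le hx0.le, Real.rpow_sub hx0, Real.rpow_neg_one]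
    field_simp
  rw [e]
  rcases le_total 1 (‖s‖ / x) with h | h
  · exact (norm_zetaDiff_le_two_div hs hx).trans
      (le_mul_of_one_le_right (by positivity) (Real.one_le_rpow h hε.le))
  · refine (norm_zetaDiff_le_div_sq hs hx).trans ?_
    have : ‖s‖ / x ≤ (‖s‖ / x) ^ ε := by
      calc ‖s‖ / x = (‖s‖ / x) ^ (1 : ℝ) := (Real.rpow_one _).symm
        _ ≤ _ := Real.rpow_le_rpow_of_exponent_ge (by positivity) h hε1
    calc ‖s‖ / x ^ 2 = 1 / x * (‖s‖ / x) := by field_simp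
      _ ≤ 2 / x * (‖s‖ / x) ^ ε := by gcongr; norm_num

lemma tendsto_cpow_one_sub {s : ℂ} (hs : 1 < s.re) :
    Filter.Tendsto (fun n : ℕ => ((n + 1 : ℝ) : ℂ) ^ (1 - s)) Filter.atTop (nhds 0) := by
  rw [tendsto_zero_iff_norm_tendsto_zero]
  have h1 : ∀ n : ℕ, ‖((n + 1 : ℝ) : ℂ) ^ (1 - s)‖ = (n + 1 : ℝ) ^ (-(s.re - 1)) := by
    intro n
    rw [Complex.norm_cpow_eq_rpow_re_of_pos (by positivity)]
    simp
  simp only [h1]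
  exact (tendsto_rpow_neg_atTop (by linarith)).comp
    (Filter.tendsto_atTop_add_const_right _ 1 tendsto_natCast_atTop_atTop)

lemma hasSum_zetaDiff {s : ℂ} (hs : 1 < s.re) :
    HasSum (fun n : ℕ => zetaDiff s ((n : ℝ) + 1)) (riemannZeta s - 1 / (s - 1)) := by
  have hsumm : Summable fun n : ℕ => zetaDiff s ((n : ℝ) + 1) := by
    refine Summable.of_norm_bounded ((summable_rpow_neg_one_sub (η := 1) (by norm_num)).mul_left
      (2 * ‖s‖ ^ (1 : ℝ))) fun n => ?_
    exact norm_zetaDiff_le hs (by linarith [(Nat.cast_nonneg n : (0 : ℝ) ≤ n)]) one_pos le_rfl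
  have h1 : Filter.Tendsto (fun N : ℕ => ∑ n ∈ range N, ((n + 1 : ℝ) : ℂ) ^ (-s)) Filter.atTop
      (nhds (riemannZeta s)) := by
    have hz := zeta_eq_tsum_one_div_nat_add_one_cpow hs
    have hsm : Summable fun n : ℕ => 1 / ((n : ℂ) + 1) ^ s := by
      have := (summable_nat_add_iff 1).2 (Complex.summable_one_div_nat_cpow.2 hs)
      simpa using this
    have := hsm.hasSum.tendsto_sum_nat
    rw [← hz] at this
    refine this.congr fun N => sum_congr rfl fun n _ => ?_
    rw [Complex.cpow_neg]
    push_cast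
    simp
  have h2 : ∀ N : ℕ, ∑ n ∈ range N, zetaDiff s ((n : ℝ) + 1)
      = ∑ n ∈ range N, ((n + 1 : ℝ) : ℂ) ^ (-s)
        - (1 - ((N + 1 : ℝ) : ℂ) ^ (1 - s)) / (s - 1) := by
    intro N
    induction N with
    | zero => simp
    | succ N ih =>
      rw [sum_range_succ, sum_range_succ, ih, zetaDiff]
      push_cast
      ring
  have h3 : Filter.Tendsto (fun N : ℕ => ∑ n ∈ range N, zetaDiff s ((n : ℝ) + 1)) Filter.atTop
      (nhds (riemannZeta s - 1 / (s - 1))) := by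
    simp only [h2]
    have := h1.sub (((tendsto_cpow_one_sub hs).const_sub 1).div_const (s - 1))
    simpa using this
  rw [← tendsto_nhds_unique hsumm.hasSum.tendsto_sum_nat h3]
  exact hsumm.hasSum

theorem exists_norm_zeta_sub_le {ε : ℝ} (hε : 0 < ε) (hε1 : ε ≤ 1) :
    ∃ C : ℝ, 1 ≤ C ∧ ∀ s : ℂ, 1 < s.re → ‖riemannZeta s - 1 / (s - 1)‖ ≤ C * ‖s‖ ^ ε := by
  set Z := ∑' k : ℕ, ((k : ℝ) + 1) ^ (-1 - ε)
  have hZ0 : 0 ≤ Z := tsum_nonneg fun k => by positivity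
  refine ⟨1 + 2 * Z, by linarith, fun s hs => ?_⟩
  rw [← (hasSum_zetaDiff hs).tsum_eq]
  refine (tsum_of_norm_bounded ((summable_rpow_neg_one_sub hε).hasSum.mul_left
    (2 * ‖s‖ ^ ε)) fun n => norm_zetaDiff_le hs
      (by linarith [(Nat.cast_nonneg n : (0 : ℝ) ≤ n)]) hε hε1).trans ?_
  have : 0 ≤ ‖s‖ ^ ε := by positivity
  change 2 * ‖s‖ ^ ε * Z ≤ _
  nlinarith

/-- The quantity measuring the size of `L`-functions modulo `q` at height `t`. -/
noncomputable def anCond (q : ℕ) (t : ℝ) : ℝ := q * (|t| + 2)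

lemma one_le_anCond {q : ℕ} (hq : 0 < q) (t : ℝ) : 1 ≤ anCond q t := by
  have : (1 : ℝ) ≤ q := by exact_mod_cast hq
  unfold anCond
  nlinarith [abs_nonneg t]

lemma one_le_anCond_rpow {q : ℕ} (hq : 0 < q) (t : ℝ) {a : ℝ} (ha : 0 ≤ a) :
    1 ≤ anCond q t ^ a := Real.one_le_rpow (one_le_anCond hq t) ha

lemma mul_one_add_norm_le_anCond {q : ℕ} {s : ℂ} (h0 : 0 ≤ s.re) (h3 : s.re ≤ 3) {t : ℝ}
    (ht : |s.im| ≤ 2 * |t| + 1) : q * (1 + ‖s‖) ≤ 3 * anCond q t := by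
  unfold anCond
  have := Complex.norm_le_abs_re_add_abs_im s
  rw [abs_of_nonneg h0] at this
  rw [show 3 * (q * (|t| + 2)) = q * (3 * (|t| + 2)) by ring]
  gcongr
  linarith [abs_nonneg t]

lemma rpow_mul_le {x y a : ℝ} (hx : 0 ≤ x) (h : x ≤ 3 * y) (ha : 0 ≤ a)
    (ha1 : a ≤ 1) : x ^ a ≤ 3 * y ^ a := by
  have hy : 0 ≤ y := by linarith
  calc x ^ a ≤ (3 * y) ^ a := Real.rpow_le_rpow hx h ha
    _ = 3 ^ a * y ^ a := Real.mul_rpow (by norm_num) hy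
    _ ≤ 3 ^ (1 : ℝ) * y ^ a := by gcongr; norm_num
    _ = _ := by rw [Real.rpow_one]

theorem exists_norm_periodic_le {ε : ℝ} (hε : 0 < ε) (hε1 : ε ≤ 1) :
    ∃ C : ℝ, 1 ≤ C ∧ ∀ (q : ℕ) (f : ℕ → ℂ), PeriodicMeanZero q f → ∀ (s : ℂ) (t : ℝ),
      1 - ε / 2 ≤ s.re → s.re ≤ 3 → |s.im| ≤ 2 * |t| + 1 →
      ‖blockLSeries q f s‖ ≤ C * anCond q t ^ ε := by
  obtain ⟨C, hC, h⟩ := exists_norm_blockLSeries_le (η := ε / 2) (by linarith) (by linarith)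
  refine ⟨C * 3, by linarith, fun q f hf s t h1 h2 h3 => (h q f hf s h1).trans ?_⟩
  rw [show 2 * (ε / 2) = ε by ring, mul_assoc]
  gcongr
  exact rpow_mul_le (by positivity) (mul_one_add_norm_le_anCond (by linarith) h2 h3) hε.le hε1

lemma totient_sum_eq (q : ℕ) [NeZero q] :
    ∑ n ∈ range q, (1 : DirichletCharacter ℂ q) n = (q.totient : ℂ) := by
  rw [Nat.totient_eq_card_coprime, card_eq_sum_ones, sum_filter]
  push_cast
  refine sum_congr rfl fun n _ => ?_
  by_cases hn : IsUnit (n : ZMod q)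
  · rw [MulChar.one_apply hn, if_pos ((ZMod.isUnit_iff_coprime n q).1 hn).symm]
  · rw [MulChar.map_nonunit _ hn, if_neg fun h => hn ((ZMod.isUnit_iff_coprime n q).2 h.symm)]

lemma periodicMeanZero_one_sub (q : ℕ) [NeZero q] :
    PeriodicMeanZero q (fun n => (1 : DirichletCharacter ℂ q) n - (q.totient : ℂ) / q) where
  pos := Nat.pos_of_ne_zero (NeZero.ne q)
  periodic n := by simp
  sum_eq_zero := by
    have : (q : ℂ) ≠ 0 := by exact_mod_cast NeZero.ne q
    rw [sum_sub_distrib, totient_sum_eq, sum_const, card_range, nsmul_eq_mul]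
    field_simp
    ring
  norm_le_one n := by
    have hq : (0 : ℝ) < q := by exact_mod_cast Nat.pos_of_ne_zero (NeZero.ne q)
    have h1 : (q.totient : ℝ) / q ≤ 1 := by
      rw [div_le_one hq]; exact_mod_cast Nat.totient_le q
    have h2 : 0 ≤ (q.totient : ℝ) / q := by positivity
    have h3 : (1 : DirichletCharacter ℂ q) n - (q.totient : ℂ) / q
        = (((if IsUnit (n : ZMod q) then 1 else 0) - (q.totient : ℝ) / q : ℝ) : ℂ) := by
      by_cases hn : IsUnit (n : ZMod q)
      · simp [hn, MulChar.one_apply hn]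
      · simp [hn, MulChar.map_nonunit _ hn]
    rw [h3, Complex.norm_real, Real.norm_eq_abs, abs_le]
    split_ifs <;> constructor <;> linarith

lemma LFunction_one_eq {q : ℕ} [NeZero q] {s : ℂ} (hs : 1 < s.re) :
    (1 : DirichletCharacter ℂ q).LFunction s = (q.totient : ℂ) / q * riemannZeta s
      + blockLSeries q (fun n => (1 : DirichletCharacter ℂ q) n - (q.totient : ℂ) / q) s := by
  have h := periodicMeanZero_one_sub q
  rw [DirichletCharacter.LFunction_eq_LSeries _ hs, h.blockLSeries_eq hs,
    ← LSeries_one_eq_riemannZeta hs, ← LSeries_smul, ← LSeries_add]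
  · congr 1
    ext n
    simp
  · exact (LSeriesSummable_one_iff.2 hs).smul _
  · exact h.lseriesSummable hs

/-- `L`-functions of arbitrary characters to the right of `Re s = 1`. -/
theorem exists_norm_LFunction_le {ε : ℝ} (hε : 0 < ε) (hε1 : ε ≤ 1) :
    ∃ C : ℝ, 1 ≤ C ∧ ∀ (q : ℕ) [NeZero q] (χ : DirichletCharacter ℂ q) (s : ℂ) (t : ℝ),
      1 < s.re → s.re ≤ 3 → |s.im| ≤ 2 * |t| + 1 →
      ‖χ.LFunction s‖ ≤ 1 / ‖s - 1‖ + C * anCond q t ^ ε := by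
  obtain ⟨C₁, hC₁, h₁⟩ := exists_norm_periodic_le hε hε1
  obtain ⟨C₂, hC₂, h₂⟩ := exists_norm_zeta_sub_le hε hε1
  refine ⟨C₁ + C₂ * 3, by linarith, fun q _ χ s t hs hs3 ht => ?_⟩
  have hq : 1 ≤ q := Nat.pos_of_ne_zero (NeZero.ne q)
  have hq1 : (1 : ℝ) ≤ q := by exact_mod_cast hq
  have hA : 1 ≤ anCond q t ^ ε := one_le_anCond_rpow hq t hε.le
  by_cases hχ : χ = 1
  · subst hχ
    rw [LFunction_one_eq hs]
    have b1 := h₁ q _ (periodicMeanZero_one_sub q) s t (by linarith) hs3 ht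
    have b2 := h₂ s hs
    have b3 : ‖s‖ ^ ε ≤ 3 * anCond q t ^ ε := by
      refine rpow_mul_le (norm_nonneg _) ?_ hε.le hε1
      refine le_trans ?_ (mul_one_add_norm_le_anCond (by linarith) hs3 ht)
      nlinarith [norm_nonneg s]
    have b4 : ‖riemannZeta s‖ ≤ 1 / ‖s - 1‖ + C₂ * ‖s‖ ^ ε := by
      have : riemannZeta s = 1 / (s - 1) + (riemannZeta s - 1 / (s - 1)) := by ring
      rw [this]
      refine (norm_add_le _ _).trans (add_le_add (by simp) b2)
    have b5 : ‖(q.totient : ℂ) / q‖ ≤ 1 := by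
      rw [norm_div, Complex.norm_natCast, Complex.norm_natCast, div_le_one (by linarith)]
      exact_mod_cast Nat.totient_le q
    calc _ ≤ 1 * (1 / ‖s - 1‖ + C₂ * ‖s‖ ^ ε) + C₁ * anCond q t ^ ε := by
          refine (norm_add_le _ _).trans (add_le_add ?_ b1)
          rw [norm_mul]
          gcongr
      _ ≤ 1 * (1 / ‖s - 1‖ + C₂ * (3 * anCond q t ^ ε)) + C₁ * anCond q t ^ ε := by gcongr
      _ = _ := by ring
  · rw [LFunction_eq_blockLSeries hχ (by linarith)]
    have b1 := h₁ q _ (periodicMeanZero_char hχ) s t (by linarith) hs3 ht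
    have : 0 ≤ 1 / ‖s - 1‖ := by positivity
    nlinarith

end BombieriVinogradov

namespace BombieriVinogradov

open Finset

/-! ### Lower bounds for `L(1, χ)` for real characters -/

lemma iteratedDeriv_inv_sub_one (m : ℕ) :
    iteratedDeriv m (fun s : ℂ => (s - 1)⁻¹) 2 = (-1) ^ m * m.factorial := by
  have h := congrFun (iter_deriv_inv_linear_sub m (1 : ℂ) 1) 2
  rw [iteratedDeriv_eq_iterate]
  simp only [one_mul, one_pow, mul_one] at h
  rw [h]
  norm_num

/-- A lower bound for a function whose Taylor coefficients at `2`, after adding those of a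
simple pole at `1`, alternate in sign. -/
lemma re_ge_of_alternating {F h : ℂ → ℂ} {l : ℂ} {S b β : ℝ}
    (hh : DifferentiableOn ℂ h {s | 1 / 2 < s.re})
    (hS : ∀ z ∈ Metric.sphere (2 : ℂ) (7 / 5), ‖h z‖ ≤ S)
    (hF : ∀ s : ℂ, 1 < s.re → F s = h s + l * (s - 1)⁻¹)
    (hpos : ∀ m, 0 ≤ ((-1) ^ m * iteratedDeriv m F 2).re) (hb : b ≤ (F 2).re)
    (hβ : 9 / 10 ≤ β) (hβ1 : β < 1) (M : ℕ) (hM : 1 ≤ M) :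
    b - l.re * (((2 - β) ^ M - 1) / (1 - β)) - S * (11 / 14) ^ M * (14 / 3) ≤ (h β).re := by
  have hopen : IsOpen {s : ℂ | 1 / 2 < s.re} := isOpen_lt continuous_const Complex.continuous_re
  have hball : Metric.closedBall (2 : ℂ) (7 / 5) ⊆ {s | 1 / 2 < s.re} := by
    intro z hz
    have h1 := (Complex.abs_re_le_norm (z - 2)).trans (by simpa [dist_eq_norm] using hz)
    rw [abs_le] at h1
    simp only [Complex.sub_re, Complex.re_ofNat] at h1
    simp only [Set.mem_ofPred_eq]
    linarith [h1.1]
  have hcl : DiffContOnCl ℂ h (Metric.ball 2 (7 / 5)) := by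
    refine DifferentiableOn.diffContOnCl (hh.mono ?_)
    rw [closure_ball _ (by norm_num)]
    exact hball
  have hS0 : 0 ≤ S := (norm_nonneg _).trans (hS (2 + (7 / 5 : ℝ)) (by simp))
  -- the Taylor coefficients in terms of those of `F`
  set b' : ℕ → ℝ := fun m => ((-1) ^ m * iteratedDeriv m F 2).re / m.factorial with hb'
  have hcoef : ∀ m, ((-1) ^ m * iteratedDeriv m h 2).re / m.factorial = b' m - l.re := by
    intro m
    have hev : F =ᶠ[nhds 2] h + fun s => l * (s - 1)⁻¹ := by
      filter_upwards [(isOpen_lt continuous_const Complex.continuous_re).mem_nhds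
        (show (2 : ℂ) ∈ {s : ℂ | 1 < s.re} by simp)] with s hs
      exact hF s hs
    have h1 := (hev.iteratedDeriv m).eq_of_nhds
    have hhc : ContDiffAt ℂ m h 2 :=
      ((hh.analyticOnNhd hopen) 2 (by simp; norm_num)).contDiffAt
    have hpc : ContDiffAt ℂ m (fun s : ℂ => (s - 1)⁻¹) 2 :=
      ContDiffAt.inv (by fun_prop) (by norm_num)
    rw [iteratedDeriv_add hhc (contDiffAt_const.mul hpc), iteratedDeriv_const_mul_field,
      iteratedDeriv_inv_sub_one] at h1
    have hm : (m.factorial : ℝ) ≠ 0 := by exact_mod_cast m.factorial_ne_zero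
    have h2 : ((-1 : ℂ) ^ m * ((-1) ^ m * m.factorial)) = m.factorial := by
      rw [← mul_assoc, ← pow_add, Even.neg_one_pow ⟨m, rfl⟩, one_mul]
    rw [hb']
    simp only
    rw [h1, mul_add, Complex.add_re, mul_left_comm, h2]
    simp only [Complex.mul_re, Complex.natCast_re, Complex.natCast_im]
    field_simp
    ring
  have hb0 : ∀ m, 0 ≤ b' m := fun m => div_nonneg (hpos m) (by positivity)
  have hbb : b ≤ b' 0 := by simpa [hb'] using hb
  set x : ℝ := 2 - β with hx
  have hx1 : 1 < x := by linarith
  have hx2 : x ≤ 11 / 10 := by linarith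
  -- the Taylor expansion of the real part
  have hsum : HasSum (fun m => (b' m - l.re) * x ^ m) (h β).re := by
    have hmem : (β : ℂ) ∈ Metric.ball (2 : ℂ) (7 / 5) := by
      rw [Metric.mem_ball, dist_eq_norm, show (β : ℂ) - 2 = ((β - 2 : ℝ) : ℂ) by push_cast; ring,
        Complex.norm_real, Real.norm_eq_abs, abs_lt]
      constructor <;> linarith
    have h1 := Complex.hasSum_re (Complex.hasSum_taylorSeries_on_ball
      (hh.mono (Metric.ball_subset_closedBall.trans hball)) hmem)
    convert h1 using 1
    ext m
    rw [← hcoef, show (β : ℂ) - 2 = -((x : ℝ) : ℂ) by rw [hx]; push_cast; ring, neg_pow (x : ℂ),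
      smul_eq_mul, smul_eq_mul, show ((m.factorial : ℂ)⁻¹ * ((-1) ^ m * (x : ℂ) ^ m
        * iteratedDeriv m h 2)) = ((m.factorial : ℝ)⁻¹ * x ^ m : ℝ)
          * ((-1) ^ m * iteratedDeriv m h 2) by push_cast; ring, Complex.re_ofReal_mul]
    ring
  have hterm : ∀ m, ‖(b' m - l.re) * x ^ m‖ ≤ S * (11 / 14) ^ m := by
    intro m
    have hm : (0 : ℝ) < m.factorial := by exact_mod_cast m.factorial_pos
    have h1 := Complex.norm_iteratedDeriv_le_of_forall_mem_sphere_norm_le m (by norm_num) hcl hS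
    have h2 : ‖b' m - l.re‖ ≤ S / (7 / 5) ^ m := by
      rw [← hcoef, norm_div, Real.norm_of_nonneg hm.le, div_le_iff₀ hm]
      refine (Complex.abs_re_le_norm _).trans ?_
      rw [norm_mul, norm_pow, norm_neg, norm_one, one_pow, one_mul]
      refine h1.trans (le_of_eq ?_)
      ring
    rw [norm_mul, norm_pow, Real.norm_of_nonneg (by linarith : 0 ≤ x)]
    calc _ ≤ S / (7 / 5) ^ m * (11 / 10) ^ m := by gcongr
      _ = S * (11 / 14) ^ m := by
        rw [div_mul_eq_mul_div, mul_div_assoc, ← div_pow]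
        norm_num
  have hgeom := (hasSum_geometric_of_lt_one (r := (11 / 14 : ℝ)) (by norm_num) (by norm_num))
  have htail : ‖∑' m, (b' (m + M) - l.re) * x ^ (m + M)‖ ≤ S * (11 / 14) ^ M * (14 / 3) := by
    have := tsum_of_norm_bounded (hgeom.mul_left (S * (11 / 14) ^ M))
      (f := fun m => (b' (m + M) - l.re) * x ^ (m + M)) fun m => by
        refine (hterm (m + M)).trans (le_of_eq ?_)
        rw [pow_add]; ring
    refine this.trans (le_of_eq ?_)
    norm_num
  have hhead : b - l.re * ((x ^ M - 1) / (1 - β)) ≤ ∑ m ∈ range M, (b' m - l.re) * x ^ m := by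
    simp only [sub_mul, sum_sub_distrib]
    rw [← mul_sum, geom_sum_eq hx1.ne', show x - 1 = 1 - β by rw [hx]; ring]
    refine sub_le_sub_right ?_ _
    calc b ≤ b' 0 * x ^ 0 := by simpa using hbb
      _ ≤ _ := single_le_sum (f := fun m => b' m * x ^ m)
          (fun m _ => mul_nonneg (hb0 m) (by positivity)) (mem_range.2 hM)
  rw [← hsum.tsum_eq, ← hsum.summable.sum_add_tsum_nat_add M]
  have := (abs_le.1 htail).1
  linarith

/-- `F` is differentiable for `Re s > 1` with logarithmic derivative `-∑ g(n) n⁻ˢ`. -/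
structure HasLogDeriv (F : ℂ → ℂ) (g : ℕ → ℂ) : Prop where
  summable : ∀ s : ℂ, 1 < s.re → LSeriesSummable g s
  hasDerivAt : ∀ s : ℂ, 1 < s.re → HasDerivAt F (-LSeries g s * F s) s

lemma HasLogDeriv.mul {F₁ F₂ : ℂ → ℂ} {g₁ g₂ : ℕ → ℂ} (h₁ : HasLogDeriv F₁ g₁)
    (h₂ : HasLogDeriv F₂ g₂) : HasLogDeriv (F₁ * F₂) (g₁ + g₂) where
  summable s hs := (h₁.summable s hs).add (h₂.summable s hs)
  hasDerivAt s hs := by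
    refine ((h₁.hasDerivAt s hs).mul (h₂.hasDerivAt s hs)).congr_deriv ?_
    rw [LSeries_add (h₁.summable s hs) (h₂.summable s hs), Pi.mul_apply]
    ring

lemma hasLogDeriv_LFunction {q : ℕ} [NeZero q] (χ : DirichletCharacter ℂ q) :
    HasLogDeriv χ.LFunction
      (fun n : ℕ => χ n * (ArithmeticFunction.vonMangoldt n : ℂ)) where
  summable s hs := DirichletCharacter.LSeriesSummable_twist_vonMangoldt χ hs
  hasDerivAt s hs := by
    have h1 : s ≠ 1 := by rintro rfl; simp at hs
    have h2 : LSeries (fun n : ℕ => χ n * (ArithmeticFunction.vonMangoldt n : ℂ)) s = _ :=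
      DirichletCharacter.LSeries_twist_vonMangoldt_eq χ hs
    have h3 : χ.LFunction s ≠ 0 :=
      DirichletCharacter.LFunction_ne_zero_of_one_le_re χ (Or.inr h1) hs.le
    rw [← DirichletCharacter.LFunction_eq_LSeries χ hs,
      ← DirichletCharacter.deriv_LFunction_eq_deriv_LSeries χ hs] at h2
    rw [h2]
    refine (DirichletCharacter.differentiableAt_LFunction χ s (Or.inl h1)).hasDerivAt.congr_deriv ?_
    field_simp

lemma hasLogDeriv_zeta :
    HasLogDeriv riemannZeta (fun n => (ArithmeticFunction.vonMangoldt n : ℂ)) := by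
  have := hasLogDeriv_LFunction (1 : DirichletCharacter ℂ 1)
  rw [DirichletCharacter.LFunction_modOne_eq] at this
  convert this using 1
  ext n
  simp [MulChar.one_apply (isUnit_of_subsingleton (n : ZMod 1))]

open scoped ComplexOrder in
lemma HasLogDeriv.iteratedDeriv_alternating {F : ℂ → ℂ} {g : ℕ → ℂ} (h : HasLogDeriv F g)
    (hg : 0 ≤ g) (h2 : 0 ≤ F 2) (m : ℕ) : 0 ≤ (-1) ^ m * iteratedDeriv m F 2 := by
  have hopen : IsOpen {s : ℂ | 1 < s.re} := isOpen_lt continuous_const Complex.continuous_re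
  have h2mem : (2 : ℂ) ∈ {s : ℂ | 1 < s.re} := by simp
  have hFd : DifferentiableOn ℂ F {s | 1 < s.re} := fun s hs =>
    (h.hasDerivAt s hs).differentiableAt.differentiableWithinAt
  have habs : LSeries.abscissaOfAbsConv g ≤ (1 : ℝ) :=
    LSeries.abscissaOfAbsConv_le_of_forall_lt_LSeriesSummable fun y hy => h.summable y (by simpa)
  have hlt : ∀ s : ℂ, 1 < s.re → LSeries.abscissaOfAbsConv g < s.re := fun s hs =>
    habs.trans_lt (by exact_mod_cast hs)
  have hGd : DifferentiableOn ℂ (LSeries g) {s | 1 < s.re} := fun s hs =>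
    (LSeries_hasDerivAt (hlt s hs)).differentiableAt.differentiableWithinAt
  have hFc : ∀ i : ℕ, ContDiffAt ℂ i F 2 := fun i =>
    ((hFd.analyticOnNhd hopen) 2 h2mem).contDiffAt
  have hGc : ∀ i : ℕ, ContDiffAt ℂ i (LSeries g) 2 := fun i =>
    ((hGd.analyticOnNhd hopen) 2 h2mem).contDiffAt
  induction m using Nat.strong_induction_on with
  | _ m ih =>
    cases m with
    | zero => simpa using h2
    | succ m =>
      have hev : deriv F =ᶠ[nhds 2] fun s => -(LSeries g s * F s) := by
        filter_upwards [hopen.mem_nhds h2mem] with s hs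
        rw [(h.hasDerivAt s hs).deriv, neg_mul]
      rw [iteratedDeriv_succ', (hev.iteratedDeriv m).eq_of_nhds, iteratedDeriv_fun_neg,
        iteratedDeriv_fun_mul (hGc m) (hFc m), pow_succ, mul_assoc, neg_one_mul, neg_neg, mul_sum]
      refine sum_nonneg fun i hi => ?_
      have hi' : i ≤ m := by simpa [Nat.lt_succ_iff] using hi
      have e : (-1 : ℂ) ^ m = (-1) ^ i * (-1) ^ (m - i) := by
        rw [← pow_add, Nat.add_sub_cancel' hi']
      have hG := LSeries.iteratedDeriv_alternating (x := 2) hg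
        (by simpa using hlt 2 h2mem) i
      have hF := ih (m - i) (by omega)
      have hc : (0 : ℂ) ≤ (m.choose i : ℂ) := by exact_mod_cast Nat.zero_le _
      rw [e]
      calc (0 : ℂ) ≤ (m.choose i : ℂ) * (((-1) ^ i * iteratedDeriv i (LSeries g) 2)
            * ((-1) ^ (m - i) * iteratedDeriv (m - i) F 2)) :=
            mul_nonneg hc (mul_nonneg (by simpa using hG) hF)
        _ = _ := by ring

end BombieriVinogradov

namespace BombieriVinogradov

open Finset

/-- The entire function `(s - 1) ζ(s)`. -/
noncomputable def zetaEntire : ℂ → ℂ := DirichletCharacter.LFunctionTrivChar₁ 1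

lemma differentiable_zetaEntire : Differentiable ℂ zetaEntire :=
  DirichletCharacter.differentiable_LFunctionTrivChar₁ 1

lemma zetaEntire_one : zetaEntire 1 = 1 := by
  simp [zetaEntire]

lemma zetaEntire_of_ne {s : ℂ} (hs : s ≠ 1) : zetaEntire s = (s - 1) * riemannZeta s := by
  rw [zetaEntire, DirichletCharacter.LFunctionTrivChar₁, Function.update_of_ne hs,
    DirichletCharacter.LFunctionTrivChar, DirichletCharacter.LFunction_modOne_eq]

open scoped ComplexOrder in
/-- A real zero, or a sign change, of a product of `L`-functions with nonnegative logarithmic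
derivative bounds the value at `1` from below. -/
theorem exists_le_re_apply_one :
    ∃ c : ℝ, 0 < c ∧ ∃ D : ℝ, 0 ≤ D ∧ ∀ (P : ℂ → ℂ) (g : ℕ → ℂ) (K β : ℝ), 1 ≤ K →
      DifferentiableOn ℂ P {s | 1 / 2 < s.re} →
      (∀ z ∈ Metric.closedBall (2 : ℂ) (7 / 5), ‖P z‖ ≤ K) →
      HasLogDeriv (riemannZeta * P) g → 0 ≤ g → 0 ≤ riemannZeta 2 * P 2 →
      1 / 64 ≤ (riemannZeta 2 * P 2).re → 9 / 10 ≤ β → β < 1 →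
      (riemannZeta β * P β).re ≤ 0 → c * (1 - β) * K ^ (-(D * (1 - β))) ≤ (P 1).re := by
  have hcont : ContinuousOn riemannZeta (Metric.sphere (2 : ℂ) (7 / 5)) := fun z hz => by
    refine (differentiableAt_riemannZeta ?_).continuousAt.continuousWithinAt
    rintro rfl
    rw [mem_sphere_iff_norm] at hz
    norm_num at hz
  obtain ⟨Z, hZ⟩ := (isCompact_sphere (2 : ℂ) (7 / 5)).exists_bound_of_continuousOn hcont
  have hZ0 : 0 ≤ Z := (norm_nonneg _).trans (hZ (2 + (7 / 5 : ℝ)) (by simp))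
  set A : ℝ := (Z + 5 / 2) * (14 / 3) * 128 with hA
  have hA1 : 1 ≤ A := by rw [hA]; nlinarith
  set L : ℝ := Real.log (14 / 11) with hL
  have hL0 : 0 < L := Real.log_pos (by norm_num)
  refine ⟨1 / 128 * Real.exp (-(Real.log A / L + 2)), by positivity, 1 / L, by positivity, ?_⟩
  intro P g K β hK hP hPK hg hg0 hF0 hF2 hβ hβ1 hneg
  have hopen : IsOpen {s : ℂ | 1 / 2 < s.re} := isOpen_lt continuous_const Complex.continuous_re
  have h1mem : (1 : ℂ) ∈ {s : ℂ | 1 / 2 < s.re} := by simp; norm_num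
  set H : ℂ → ℂ := fun s => zetaEntire s * P s with hH
  have hHd : DifferentiableOn ℂ H {s | 1 / 2 < s.re} :=
    differentiable_zetaEntire.differentiableOn.mul hP
  have hh : DifferentiableOn ℂ (dslope H 1) {s | 1 / 2 < s.re} :=
    (Complex.differentiableOn_dslope (hopen.mem_nhds h1mem)).2 hHd
  have hform : ∀ s : ℂ, s ≠ 1 → dslope H 1 s = riemannZeta s * P s - P 1 * (s - 1)⁻¹ := by
    intro s hs
    rw [dslope_of_ne _ hs, slope_def_field, hH]
    simp only
    rw [zetaEntire_one, zetaEntire_of_ne hs]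
    have := sub_ne_zero.2 hs
    field_simp
  have hS : ∀ z ∈ Metric.sphere (2 : ℂ) (7 / 5), ‖dslope H 1 z‖ ≤ (Z + 5 / 2) * K := by
    intro z hz
    have hz' := hz
    rw [mem_sphere_iff_norm] at hz'
    have h1 : 2 / 5 ≤ ‖z - 1‖ := by
      have : z - 2 = (z - 1) - 1 := by ring
      rw [this] at hz'
      have := norm_sub_le (z - 1) 1
      rw [hz', norm_one] at this
      linarith
    have hz1 : z ≠ 1 := by rintro rfl; norm_num at h1
    rw [hform z hz1]
    have hP1 : ‖P 1‖ ≤ K := hPK 1 (by simp [dist_eq_norm]; norm_num)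
    calc _ ≤ Z * K + K * (2 / 5)⁻¹ := by
          refine (norm_sub_le _ _).trans (add_le_add ?_ ?_)
          · rw [norm_mul]
            exact mul_le_mul (hZ z hz) (hPK z (Metric.sphere_subset_closedBall hz))
              (norm_nonneg _) hZ0
          · rw [norm_mul, norm_inv]
            gcongr
      _ = _ := by ring
  set M : ℕ := ⌈Real.log (A * K) / L⌉₊ + 1 with hM
  have key := re_ge_of_alternating (F := riemannZeta * P) (l := P 1) hh hS (fun s hs => by
      rw [hform s (by rintro rfl; simp at hs), Pi.mul_apply]; ring)
    (fun m => (Complex.nonneg_iff.1 (hg.iteratedDeriv_alternating hg0 hF0 m)).1) hF2 hβ hβ1 M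
    (by omega)
  have hβne : (β : ℂ) ≠ 1 := by exact_mod_cast hβ1.ne
  have hre : (dslope H 1 β).re = (riemannZeta β * P β).re + (P 1).re / (1 - β) := by
    rw [hform β hβne, Complex.sub_re, show ((β : ℂ) - 1)⁻¹ = (((β - 1)⁻¹ : ℝ) : ℂ) by push_cast; rfl,
      Complex.re_mul_ofReal, show (β - 1)⁻¹ = -(1 - β)⁻¹ by rw [← inv_neg]; ring_nf]
    ring
  rw [hre] at key
  have hAK : 1 ≤ A * K := by nlinarith
  have htail : (Z + 5 / 2) * K * (11 / 14) ^ M * (14 / 3) ≤ 1 / 128 := by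
    have h1 : A * K ≤ (14 / 11) ^ M := by
      have : Real.log (A * K) ≤ M * L := by
        rw [← div_le_iff₀ hL0]
        exact (Nat.le_ceil _).trans (by rw [hM]; push_cast; linarith)
      rw [← Real.log_le_log_iff (by linarith) (by positivity), Real.log_pow]
      exact this
    have h2 : (11 / 14 : ℝ) ^ M * (14 / 11) ^ M = 1 := by rw [← mul_pow]; norm_num
    have h3 : 0 < (11 / 14 : ℝ) ^ M := by positivity
    have h4 : (11 / 14 : ℝ) ^ M * (A * K) ≤ 1 := by rw [← h2]; gcongr
    rw [hA] at h4
    linarith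
  have hb0 : 0 < 1 - β := by linarith
  have hmain : 1 / 128 ≤ (P 1).re * (2 - β) ^ M / (1 - β) := by
    have e : (P 1).re * (((2 - β) ^ M - 1) / (1 - β))
        = (P 1).re * (2 - β) ^ M / (1 - β) - (P 1).re / (1 - β) := by ring
    rw [e] at key
    linarith
  have hMle : (M : ℝ) ≤ Real.log A / L + 2 + Real.log K / L := by
    have h1 := Nat.ceil_lt_add_one (a := Real.log (A * K) / L)
      (div_nonneg (Real.log_nonneg hAK) hL0.le)
    rw [Real.log_mul (by linarith) (by linarith), add_div] at h1
    rw [hM, Real.log_mul (by linarith) (by linarith), add_div]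
    push_cast
    linarith
  have hpow : (2 - β) ^ M ≤ Real.exp ((1 - β) * M) := by
    rw [mul_comm, Real.exp_nat_mul]
    gcongr
    · linarith
    · have := Real.add_one_le_exp (1 - β); linarith
  have hlA : 0 ≤ Real.log A := Real.log_nonneg hA1
  have hexp : Real.exp (-(Real.log A / L + 2)) * K ^ (-(1 / L * (1 - β)))
      ≤ Real.exp (-((1 - β) * M)) := by
    rw [Real.rpow_def_of_pos (by linarith), ← Real.exp_add]
    gcongr
    have h1 : (1 - β) * M ≤ (1 - β) * (Real.log A / L + 2 + Real.log K / L) := by gcongr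
    have h2 : (1 - β) * (Real.log A / L + 2) ≤ 1 * (Real.log A / L + 2) := by
      gcongr; linarith
    have h3 : Real.log K * -(1 / L * (1 - β)) = -((1 - β) * (Real.log K / L)) := by ring
    rw [h3]
    linarith
  rw [le_div_iff₀ hb0] at hmain
  have hpos : 0 < (2 - β) ^ M := by have : 0 < 2 - β := by linarith
                                    positivity
  have hP1pos : 0 ≤ (P 1).re := by
    by_contra hcon
    push Not at hcon
    nlinarith
  calc _ = (1 / 128 * (1 - β)) * (Real.exp (-(Real.log A / L + 2))
        * K ^ (-(1 / L * (1 - β)))) := by ring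
    _ ≤ ((P 1).re * Real.exp ((1 - β) * M)) * Real.exp (-((1 - β) * M)) := by
        refine mul_le_mul ?_ hexp (by positivity) (by positivity)
        exact hmain.trans (mul_le_mul_of_nonneg_left hpow hP1pos)
    _ = _ := by rw [mul_assoc, ← Real.exp_add]; simp

end BombieriVinogradov

namespace BombieriVinogradov

open Finset

section RealCharacters

variable {q : ℕ} {χ : DirichletCharacter ℂ q}

lemma apply_eq_of_sq_eq_one (h : χ ^ 2 = 1) (a : ZMod q) : χ a = 0 ∨ χ a = 1 ∨ χ a = -1 := by
  by_cases ha : IsUnit a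
  · right
    have h1 : (χ ^ 2) a = 1 := by rw [h, MulChar.one_apply ha]
    rw [MulChar.pow_apply' _ two_ne_zero] at h1
    exact sq_eq_one_iff.1 h1
  · exact Or.inl (χ.map_nonunit ha)

lemma apply_real_of_sq_eq_one (h : χ ^ 2 = 1) (a : ZMod q) :
    ∃ r : ℝ, χ a = r ∧ -1 ≤ r ∧ r ≤ 1 := by
  rcases apply_eq_of_sq_eq_one h a with h | h | h
  · exact ⟨0, by simp [h], by norm_num, by norm_num⟩
  · exact ⟨1, by simp [h], by norm_num, by norm_num⟩
  · exact ⟨-1, by simp [h], by norm_num, by norm_num⟩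

variable [NeZero q]

lemma LFunction_im_eq_zero (hχ : χ ≠ 1) (h : χ ^ 2 = 1) {x : ℝ} (hx : 1 / 2 < x) :
    (χ.LFunction x).im = 0 := by
  rw [LFunction_eq_blockLSeries hχ (by simpa using hx)]
  have hs := (periodicMeanZero_char hχ).summable_blockSum (s := x) (by simpa using hx.le)
  have h1 := Complex.hasSum_im hs.hasSum
  have h2 : ∀ k, (blockSum q (fun n => χ n) x k).im = 0 := by
    intro k
    unfold blockSum
    rw [Complex.im_sum]
    refine sum_eq_zero fun j _ => ?_
    obtain ⟨r, hr, -⟩ := apply_real_of_sq_eq_one h ((k * q + j : ℕ) : ZMod q)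
    rw [LSeries.term_def]
    split_ifs
    · simp
    · rw [hr, ← Complex.ofReal_natCast, ← Complex.ofReal_cpow (by positivity),
        ← Complex.ofReal_div, Complex.ofReal_im]
  simp only [h2] at h1
  exact h1.unique hasSum_zero

lemma quarter_le_re_LFunction_two (χ : DirichletCharacter ℂ q) :
    1 / 4 ≤ (χ.LFunction 2).re := by
  have h2 : (1 : ℝ) < (2 : ℂ).re := by simp
  rw [DirichletCharacter.LFunction_eq_LSeries χ h2]
  have hs : LSeriesSummable (fun n : ℕ => χ n) 2 :=
    LSeriesSummable_of_bounded_of_one_lt_re (m := 1) (fun n _ => χ.norm_le_one _) h2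
  unfold LSeriesSummable at hs
  unfold LSeries
  rw [← hs.sum_add_tsum_nat_add 2]
  have h3 := ((hasSum_nat_add_iff' 2).2 hasSum_zeta_two)
  have h4 := tsum_of_norm_bounded h3 (f := fun n : ℕ => LSeries.term (fun n : ℕ => χ n) 2 (n + 2))
    fun n => by
      refine (norm_term_le_rpow (fun n => χ.norm_le_one _) (σ := 2) (by simp) (by omega)).trans ?_
      rw [Real.rpow_neg (by positivity)]
      norm_num
  simp only [sum_range_succ, range_zero, sum_empty, LSeries.term_zero, zero_add] at h4 ⊢
  have h5 : LSeries.term (fun n : ℕ => χ n) 2 1 = 1 := by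
    rw [LSeries.term_of_ne_zero one_ne_zero]; simp
  rw [h5, Complex.add_re, Complex.one_re]
  have h6 := (abs_le.1 ((Complex.abs_re_le_norm _).trans h4)).1
  have h7 := Real.pi_lt_d2
  have h8 := Real.pi_pos
  have h9 : 1 / ((0 : ℕ) : ℝ) ^ 2 + 1 / ((1 : ℕ) : ℝ) ^ 2 = 1 := by norm_num
  rw [h9] at h6
  nlinarith

end RealCharacters

end BombieriVinogradov

namespace BombieriVinogradov

open Finset

lemma closedBall_two_subset {z : ℂ} (hz : z ∈ Metric.closedBall (2 : ℂ) (7 / 5)) :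
    3 / 5 ≤ z.re ∧ ‖z‖ ≤ 17 / 5 := by
  rw [mem_closedBall_iff_norm] at hz
  have h1 := (Complex.abs_re_le_norm (z - 2)).trans hz
  rw [abs_le] at h1
  simp only [Complex.sub_re, Complex.re_ofNat] at h1
  refine ⟨by linarith [h1.1], ?_⟩
  calc ‖z‖ = ‖(z - 2) + 2‖ := by ring_nf
    _ ≤ ‖z - 2‖ + ‖(2 : ℂ)‖ := norm_add_le _ _
    _ ≤ 7 / 5 + 2 := by gcongr; simp
    _ = _ := by norm_num

lemma exists_norm_LFunction_closedBall_le : ∃ C : ℝ, 1 ≤ C ∧ ∀ (q : ℕ) [NeZero q]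
    (χ : DirichletCharacter ℂ q), χ ≠ 1 → ∀ z ∈ Metric.closedBall (2 : ℂ) (7 / 5),
      ‖χ.LFunction z‖ ≤ C * q := by
  obtain ⟨C, hC, h⟩ := exists_norm_blockLSeries_le (η := 2 / 5) (by norm_num) (by norm_num)
  refine ⟨C * 5, by linarith, fun q _ χ hχ z hz => ?_⟩
  obtain ⟨h1, h2⟩ := closedBall_two_subset hz
  rw [LFunction_eq_blockLSeries hχ (by linarith)]
  have hq : (1 : ℝ) ≤ q := by exact_mod_cast Nat.pos_of_ne_zero (NeZero.ne q)
  refine (h q _ (periodicMeanZero_char hχ) z (by linarith)).trans ?_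
  have h3 : (1 : ℝ) ≤ q * (1 + ‖z‖) := by nlinarith [norm_nonneg z]
  calc C * (q * (1 + ‖z‖)) ^ (2 * (2 / 5) : ℝ) ≤ C * (q * (1 + ‖z‖)) ^ (1 : ℝ) := by
        gcongr
        norm_num
    _ ≤ C * (q * 5) := by rw [Real.rpow_one]; gcongr; linarith
    _ = _ := by ring

lemma exists_norm_LFunction_one_le {ε : ℝ} (hε : 0 < ε) (hε1 : ε ≤ 1) :
    ∃ C : ℝ, 1 ≤ C ∧ ∀ (q : ℕ) [NeZero q] (χ : DirichletCharacter ℂ q), χ ≠ 1 →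
      ‖χ.LFunction 1‖ ≤ C * (q : ℝ) ^ ε := by
  obtain ⟨C, hC, h⟩ := exists_norm_blockLSeries_le (η := ε / 2) (by linarith) (by linarith)
  refine ⟨C * 2, by linarith, fun q _ χ hχ => ?_⟩
  rw [LFunction_eq_blockLSeries hχ (by norm_num)]
  refine (h q _ (periodicMeanZero_char hχ) 1 (by simp; linarith)).trans ?_
  rw [norm_one, show 2 * (ε / 2) = ε by ring, Real.mul_rpow (by positivity) (by norm_num)]
  have : (1 + 1 : ℝ) ^ ε ≤ 2 := by
    calc (1 + 1 : ℝ) ^ ε ≤ (1 + 1 : ℝ) ^ (1 : ℝ) := by gcongr; norm_num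
      _ = 2 := by norm_num
  calc C * ((q : ℝ) ^ ε * (1 + 1) ^ ε) ≤ C * ((q : ℝ) ^ ε * 2) := by gcongr
    _ = _ := by ring

/-- Close to `1` the zeta function is negative on the left. -/
lemma exists_re_zeta_neg : ∃ δ : ℝ, 0 < δ ∧ ∀ x : ℝ, 1 - δ ≤ x → x < 1 →
    (riemannZeta x).re < 0 := by
  have hc : ContinuousAt zetaEntire 1 := differentiable_zetaEntire.continuous.continuousAt
  rw [Metric.continuousAt_iff] at hc
  obtain ⟨δ, hδ, h⟩ := hc (1 / 2) (by norm_num)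
  refine ⟨δ / 2, by linarith, fun x hx hx1 => ?_⟩
  have hx' : (x : ℂ) ≠ 1 := by exact_mod_cast hx1.ne
  have h1 := h (x := (x : ℂ)) (by
    rw [dist_eq_norm, ← Complex.ofReal_one, ← Complex.ofReal_sub, Complex.norm_real,
      Real.norm_eq_abs, abs_lt]
    constructor <;> linarith)
  rw [zetaEntire_one, zetaEntire_of_ne hx', dist_eq_norm] at h1
  have h2 := (abs_lt.1 ((Complex.abs_re_le_norm _).trans_lt h1)).1
  rw [← Complex.ofReal_one, ← Complex.ofReal_sub, Complex.sub_re, Complex.re_ofReal_mul,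
    Complex.ofReal_re] at h2
  nlinarith

open scoped ComplexOrder in
lemma one_add_nonneg_of_sq_eq_one {q : ℕ} {χ : DirichletCharacter ℂ q} (h : χ ^ 2 = 1)
    (a : ZMod q) : (0 : ℂ) ≤ 1 + χ a := by
  obtain ⟨r, hr, h1, h2⟩ := apply_real_of_sq_eq_one h a
  rw [hr]
  have : (0 : ℝ) ≤ 1 + r := by linarith
  exact_mod_cast this

lemma LFunction_two_eq {q : ℕ} [NeZero q] {χ : DirichletCharacter ℂ q} (hχ : χ ≠ 1)
    (h : χ ^ 2 = 1) : ∃ r : ℝ, χ.LFunction 2 = r ∧ 1 / 4 ≤ r := by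
  refine ⟨(χ.LFunction 2).re, Complex.ext (by simp) ?_, quarter_le_re_LFunction_two χ⟩
  have := LFunction_im_eq_zero hχ h (x := 2) (by norm_num)
  simpa using this

lemma zeta_two_eq : ∃ r : ℝ, riemannZeta 2 = r ∧ 1 ≤ r := by
  refine ⟨Real.pi ^ 2 / 6, by rw [riemannZeta_two]; push_cast; rfl, ?_⟩
  have := Real.pi_gt_three
  nlinarith

/-- The product of two characters of different moduli. -/
noncomputable def mulChar {q r : ℕ} (χ : DirichletCharacter ℂ q) (χ' : DirichletCharacter ℂ r) :
    DirichletCharacter ℂ (q * r) :=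
  χ.changeLevel (dvd_mul_right q r) * χ'.changeLevel (dvd_mul_left r q)

lemma mulChar_apply {q r : ℕ} (χ : DirichletCharacter ℂ q) (χ' : DirichletCharacter ℂ r)
    (n : ℕ) : mulChar χ χ' n = χ n * χ' n := by
  unfold mulChar
  rw [MulChar.mul_apply]
  by_cases hn : IsUnit ((n : ℕ) : ZMod (q * r))
  · have e1 := DirichletCharacter.changeLevel_eq_cast_of_dvd χ (dvd_mul_right q r) hn.unit
    have e2 := DirichletCharacter.changeLevel_eq_cast_of_dvd χ' (dvd_mul_left r q) hn.unit
    rw [IsUnit.unit_spec, ZMod.cast_natCast (dvd_mul_right q r)] at e1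
    rw [IsUnit.unit_spec, ZMod.cast_natCast (dvd_mul_left r q)] at e2
    rw [e1, e2]
  · rw [MulChar.map_nonunit _ hn, zero_mul]
    rw [ZMod.isUnit_iff_coprime, Nat.coprime_mul_iff_right, not_and_or] at hn
    rcases hn with hn | hn
    · rw [χ.map_nonunit (by rwa [ZMod.isUnit_iff_coprime]), zero_mul]
    · rw [χ'.map_nonunit (by rwa [ZMod.isUnit_iff_coprime]), mul_zero]

lemma mulChar_sq {q r : ℕ} {χ : DirichletCharacter ℂ q} {χ' : DirichletCharacter ℂ r}
    (h : χ ^ 2 = 1) (h' : χ' ^ 2 = 1) : mulChar χ χ' ^ 2 = 1 := by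
  unfold mulChar
  rw [mul_pow, ← map_pow, ← map_pow, h, h', map_one, map_one, one_mul]

lemma eq_of_mulChar_eq_one {q r : ℕ} [NeZero q] [NeZero r] {χ : DirichletCharacter ℂ q}
    {χ' : DirichletCharacter ℂ r} (h : χ.IsPrimitive) (h' : χ'.IsPrimitive)
    (h1 : mulChar χ χ' = 1) : q = r := by
  unfold mulChar at h1
  have h2 := congrArg DirichletCharacter.conductor (eq_inv_of_mul_eq_one_left h1)
  rw [DirichletCharacter.conductor_inv, DirichletCharacter.conductor_changeLevel,
    DirichletCharacter.conductor_changeLevel] at h2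
  rwa [(DirichletCharacter.isPrimitive_def χ).1 h, (DirichletCharacter.isPrimitive_def χ').1 h']
    at h2

end BombieriVinogradov

namespace BombieriVinogradov

open Finset

lemma differentiableOn_LFunction {q : ℕ} [NeZero q] {χ : DirichletCharacter ℂ q} (hχ : χ ≠ 1) :
    DifferentiableOn ℂ χ.LFunction {s | 1 / 2 < s.re} :=
  (DirichletCharacter.differentiable_LFunction hχ).differentiableOn

open scoped ComplexOrder in
/-- A lower bound for `L(1, χ)` for real characters without sign change. -/
lemma exists_le_of_re_nonneg : ∃ c : ℝ, 0 < c ∧ ∃ D : ℝ, 0 ≤ D ∧ ∃ C : ℝ, 1 ≤ C ∧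
    ∀ (q : ℕ) [NeZero q] (χ : DirichletCharacter ℂ q) (β : ℝ), χ ≠ 1 → χ ^ 2 = 1 → 9 / 10 ≤ β →
      β < 1 → (riemannZeta β).re < 0 → 0 ≤ (χ.LFunction β).re →
      c * (1 - β) * (C * q) ^ (-(D * (1 - β))) ≤ ‖χ.LFunction 1‖ := by
  obtain ⟨c, hc, D, hD, h⟩ := exists_le_re_apply_one
  obtain ⟨C, hC, hC2⟩ := exists_norm_LFunction_closedBall_le
  refine ⟨c, hc, D, hD, C, hC, fun q _ χ β hχ hχ2 hβ hβ1 hz hL => ?_⟩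
  have hq : (1 : ℝ) ≤ q := by exact_mod_cast Nat.pos_of_ne_zero (NeZero.ne q)
  obtain ⟨z, hz2, hz1⟩ := zeta_two_eq
  obtain ⟨r, hr, hr1⟩ := LFunction_two_eq hχ hχ2
  refine le_trans (h χ.LFunction _ (C * q) β (by nlinarith) (differentiableOn_LFunction hχ)
    (hC2 q χ hχ) (hasLogDeriv_zeta.mul (hasLogDeriv_LFunction χ)) ?_ ?_ ?_ hβ hβ1 ?_)
    ((le_abs_self _).trans (Complex.abs_re_le_norm _))
  · intro n
    have h1 := one_add_nonneg_of_sq_eq_one hχ2 (n : ZMod q)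
    have h2 : (0 : ℂ) ≤ (ArithmeticFunction.vonMangoldt n : ℂ) := by
      exact_mod_cast ArithmeticFunction.vonMangoldt_nonneg
    calc (0 : ℂ) ≤ (1 + χ n) * (ArithmeticFunction.vonMangoldt n : ℂ) := mul_nonneg h1 h2
      _ = _ := by simp only [Pi.add_apply]; ring
  · rw [hz2, hr, ← Complex.ofReal_mul]
    exact_mod_cast (by positivity : 0 ≤ z * r)
  · rw [hz2, hr, ← Complex.ofReal_mul, Complex.ofReal_re]
    nlinarith
  · rw [Complex.mul_re, LFunction_im_eq_zero hχ hχ2 (by linarith)]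
    nlinarith

open scoped ComplexOrder in
/-- A lower bound for `L(1, χ)` in the presence of a real zero of another real `L`-function. -/
lemma exists_le_of_zero : ∃ c : ℝ, 0 < c ∧ ∃ D : ℝ, 0 ≤ D ∧ ∃ C : ℝ, 1 ≤ C ∧
    ∀ (q r : ℕ) [NeZero q] [NeZero r] (χ : DirichletCharacter ℂ q) (χ' : DirichletCharacter ℂ r)
      (β : ℝ), χ ≠ 1 → χ ^ 2 = 1 → χ' ≠ 1 → χ' ^ 2 = 1 → mulChar χ χ' ≠ 1 → 9 / 10 ≤ β →
      β < 1 → χ'.LFunction β = 0 →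
      c * (1 - β) * (C ^ 3 * (q * r) ^ 2) ^ (-(D * (1 - β)))
        ≤ ‖χ.LFunction 1‖ * ‖χ'.LFunction 1‖ * ‖(mulChar χ χ').LFunction 1‖ := by
  obtain ⟨c, hc, D, hD, h⟩ := exists_le_re_apply_one
  obtain ⟨C, hC, hC2⟩ := exists_norm_LFunction_closedBall_le
  refine ⟨c, hc, D, hD, C, hC, fun q r _ _ χ χ' β hχ hχ2 hχ' hχ'2 hψ hβ hβ1 hL => ?_⟩
  have hq : (1 : ℝ) ≤ q := by exact_mod_cast Nat.pos_of_ne_zero (NeZero.ne q)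
  have hr : (1 : ℝ) ≤ r := by exact_mod_cast Nat.pos_of_ne_zero (NeZero.ne r)
  have hψ2 := mulChar_sq hχ2 hχ'2
  set ψ := mulChar χ χ' with hψdef
  obtain ⟨z, hz2, hz1⟩ := zeta_two_eq
  obtain ⟨r₁, hr₁, hr₁'⟩ := LFunction_two_eq hχ hχ2
  obtain ⟨r₂, hr₂, hr₂'⟩ := LFunction_two_eq hχ' hχ'2
  obtain ⟨r₃, hr₃, hr₃'⟩ := LFunction_two_eq hψ hψ2
  have hprod : riemannZeta 2 * (χ.LFunction * (χ'.LFunction * ψ.LFunction)) 2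
      = ((z * (r₁ * (r₂ * r₃)) : ℝ) : ℂ) := by
    simp only [Pi.mul_apply]
    rw [hz2, hr₁, hr₂, hr₃]
    push_cast; rfl
  have hK : 1 ≤ C ^ 3 * ((q : ℝ) * r) ^ 2 :=
    one_le_mul_of_one_le_of_one_le (one_le_pow₀ hC) (one_le_pow₀ (by nlinarith))
  have hfin : ‖χ.LFunction 1‖ * ‖χ'.LFunction 1‖ * ‖ψ.LFunction 1‖
      = ‖(χ.LFunction * (χ'.LFunction * ψ.LFunction)) 1‖ := by
    simp only [Pi.mul_apply, norm_mul]; ring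
  rw [hfin]
  refine le_trans (h (χ.LFunction * (χ'.LFunction * ψ.LFunction)) _ (C ^ 3 * (q * r) ^ 2) β hK
    ((differentiableOn_LFunction hχ).mul
      ((differentiableOn_LFunction hχ').mul (differentiableOn_LFunction hψ)))
    ?_ (hasLogDeriv_zeta.mul ((hasLogDeriv_LFunction χ).mul
      ((hasLogDeriv_LFunction χ').mul (hasLogDeriv_LFunction ψ)))) ?_ ?_ ?_ hβ hβ1 ?_)
    ((le_abs_self _).trans (Complex.abs_re_le_norm _))
  · intro w hw
    simp only [Pi.mul_apply, norm_mul]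
    calc _ ≤ (C * q) * ((C * r) * (C * (q * r : ℕ))) := by
          gcongr
          · exact hC2 q χ hχ w hw
          · exact hC2 r χ' hχ' w hw
          · exact hC2 _ ψ hψ w hw
      _ = _ := by push_cast; ring
  · intro n
    have h1 := one_add_nonneg_of_sq_eq_one hχ2 (n : ZMod q)
    have h1' := one_add_nonneg_of_sq_eq_one hχ'2 (n : ZMod r)
    have h2 : (0 : ℂ) ≤ (ArithmeticFunction.vonMangoldt n : ℂ) := by
      exact_mod_cast ArithmeticFunction.vonMangoldt_nonneg
    calc (0 : ℂ) ≤ (1 + χ n) * (1 + χ' n) * (ArithmeticFunction.vonMangoldt n : ℂ) :=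
          mul_nonneg (mul_nonneg h1 h1') h2
      _ = _ := by
          simp only [Pi.add_apply]
          rw [hψdef, mulChar_apply]
          ring
  · rw [hprod]
    exact_mod_cast (by positivity : 0 ≤ z * (r₁ * (r₂ * r₃)))
  · rw [hprod, Complex.ofReal_re]
    calc (1 / 64 : ℝ) = 1 * (1 / 4 * (1 / 4 * (1 / 4))) := by norm_num
      _ ≤ _ := by gcongr
  · simp only [Pi.mul_apply]
    rw [hL]
    simp

lemma exists_zero_of_re_neg {q : ℕ} [NeZero q] {χ : DirichletCharacter ℂ q} (hχ : χ ≠ 1)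
    (hχ2 : χ ^ 2 = 1) {b : ℝ} (hb : 1 / 2 < b) (hb1 : b < 1) (h : (χ.LFunction b).re < 0) :
    ∃ β : ℝ, b ≤ β ∧ β < 1 ∧ χ.LFunction β = 0 := by
  have hcont : ContinuousOn (fun x : ℝ => (χ.LFunction x).re) (Set.Icc b 2) := by
    exact (Complex.continuous_re.comp ((DirichletCharacter.differentiable_LFunction hχ).continuous.comp
      Complex.continuous_ofReal)).continuousOn
  obtain ⟨β, hβ, h0⟩ := intermediate_value_Icc (by linarith) hcont
    (show (0 : ℝ) ∈ Set.Icc _ _ from ⟨h.le, by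
      have := quarter_le_re_LFunction_two χ
      simp only [Complex.ofReal_ofNat]
      linarith⟩)
  have h1 : χ.LFunction β = 0 :=
    Complex.ext h0 (LFunction_im_eq_zero hχ hχ2 (by linarith [hβ.1]))
  refine ⟨β, hβ.1, ?_, h1⟩
  by_contra hcon
  exact DirichletCharacter.LFunction_ne_zero_of_one_le_re χ (Or.inl hχ)
    (s := β) (by simpa using hcon) h1

end BombieriVinogradov

namespace BombieriVinogradov

open Finset

/-- Siegel's theorem. -/
lemma exists_siegel {ε : ℝ} (hε : 0 < ε) (hε1 : ε ≤ 1) : ∃ c : ℝ, 0 < c ∧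
    ∀ (q : ℕ) [NeZero q] (χ : DirichletCharacter ℂ q), χ.IsPrimitive → χ ≠ 1 → χ ^ 2 = 1 →
      c * (q : ℝ) ^ (-ε) ≤ ‖χ.LFunction 1‖ := by
  obtain ⟨δ₀, hδ₀, hzeta⟩ := exists_re_zeta_neg
  obtain ⟨c₁, hc₁, D₁, hD₁, C₁, hC₁, h₁⟩ := exists_le_of_re_nonneg
  obtain ⟨c₂, hc₂, D₂, hD₂, C₂, hC₂, h₂⟩ := exists_le_of_zero
  obtain ⟨C₃, hC₃, h₃⟩ := exists_norm_LFunction_one_le (half_pos hε) (by linarith)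
  set δ := min (min δ₀ (1 / 10)) (ε / (4 * (D₁ + D₂ + 1))) with hδ
  have hδpos : 0 < δ := by positivity
  have hδ1 : δ ≤ δ₀ := (min_le_left _ _).trans (min_le_left _ _)
  have hδ2 : δ ≤ 1 / 10 := (min_le_left _ _).trans (min_le_right _ _)
  have hδ3 : δ * (4 * (D₁ + D₂ + 1)) ≤ ε := by
    rw [← le_div_iff₀ (by positivity)]; exact min_le_right _ _
  have hDδ₁ : D₁ * δ ≤ ε / 4 := by nlinarith
  have hDδ₂ : D₂ * δ ≤ ε / 4 := by nlinarith
  by_cases hcase : ∀ (q : ℕ) [NeZero q] (χ : DirichletCharacter ℂ q), χ.IsPrimitive → χ ≠ 1 →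
      χ ^ 2 = 1 → 0 ≤ (χ.LFunction ((1 - δ : ℝ) : ℂ)).re
  · refine ⟨c₁ * δ * C₁ ^ (-ε), by positivity, fun q _ χ hp hχ hχ2 => ?_⟩
    have hq : (1 : ℝ) ≤ q := by exact_mod_cast Nat.pos_of_ne_zero (NeZero.ne q)
    have := h₁ q χ (1 - δ) hχ hχ2 (by linarith) (by linarith)
      (hzeta _ (by linarith) (by linarith)) (hcase q χ hp hχ hχ2)
    refine le_trans ?_ this
    rw [sub_sub_cancel, mul_assoc, ← Real.mul_rpow (by linarith) (by linarith)]
    gcongr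
    · nlinarith
    · linarith
  push Not at hcase
  obtain ⟨r, _, χ', hp', hχ', hχ'2, hneg⟩ := hcase
  obtain ⟨β, hbβ, hβ, hzero⟩ := exists_zero_of_re_neg hχ' hχ'2 (by linarith) (by linarith) hneg
  have hr : (1 : ℝ) ≤ r := by exact_mod_cast Nat.pos_of_ne_zero (NeZero.ne r)
  have hM : 0 < ‖χ'.LFunction 1‖ :=
    norm_pos_iff.mpr (DirichletCharacter.LFunction_apply_one_ne_zero hχ')
  obtain ⟨m, hm, hmin⟩ : ∃ m : ℝ, 0 < m ∧
      ∀ χ : DirichletCharacter ℂ r, χ ≠ 1 → m ≤ ‖χ.LFunction 1‖ := by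
    obtain ⟨χ₀, hχ₀, hle⟩ := Set.exists_min_image {χ : DirichletCharacter ℂ r | χ ≠ 1}
      (fun χ => ‖χ.LFunction 1‖) (Set.toFinite _) ⟨χ', hχ'⟩
    exact ⟨_, norm_pos_iff.mpr (DirichletCharacter.LFunction_apply_one_ne_zero hχ₀),
      fun χ hχ => hle χ hχ⟩
  set M := ‖χ'.LFunction 1‖ with hMdef
  set c := c₂ * (1 - β) * (C₂ ^ 3 * (r : ℝ) ^ 2) ^ (-(ε / 4)) / (M * C₃ * (r : ℝ) ^ (ε / 2))
    with hc
  have h1β : 0 < 1 - β := by linarith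
  refine ⟨min m c, by positivity, fun q _ χ hp hχ hχ2 => ?_⟩
  have hq : (1 : ℝ) ≤ q := by exact_mod_cast Nat.pos_of_ne_zero (NeZero.ne q)
  by_cases hψ : mulChar χ χ' = 1
  · obtain rfl := eq_of_mulChar_eq_one hp hp' hψ
    calc min m c * (q : ℝ) ^ (-ε) ≤ m * 1 := by
          gcongr
          · exact min_le_left _ _
          · exact Real.rpow_le_one_of_one_le_of_nonpos hq (by linarith)
      _ ≤ _ := by simpa using hmin χ hχ
  have hmain := h₂ q r χ χ' β hχ hχ2 hχ' hχ'2 hψ (by linarith) hβ hzero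
  have hup := h₃ (q * r) (mulChar χ χ') hψ
  have hK : 1 ≤ C₂ ^ 3 * ((q : ℝ) * r) ^ 2 :=
    one_le_mul_of_one_le_of_one_le (one_le_pow₀ hC₂) (one_le_pow₀ (by nlinarith))
  have hlow : c₂ * (1 - β) * ((C₂ ^ 3 * (r : ℝ) ^ 2) ^ (-(ε / 4)) * (q : ℝ) ^ (-(ε / 2)))
      ≤ ‖χ.LFunction 1‖ * M * (C₃ * ((r : ℝ) ^ (ε / 2) * (q : ℝ) ^ (ε / 2))) := by
    refine le_trans (le_trans ?_ hmain) (mul_le_mul_of_nonneg_left (hup.trans_eq ?_)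
      (by positivity))
    · have : (q : ℝ) ^ (-(ε / 2)) = ((q : ℝ) ^ 2) ^ (-(ε / 4)) := by
        rw [← Real.rpow_natCast, ← Real.rpow_mul (by positivity)]
        congr 1; push_cast; ring
      rw [this, ← Real.mul_rpow (by positivity) (by positivity)]
      have h5 : C₂ ^ 3 * (r : ℝ) ^ 2 * (q : ℝ) ^ 2 = C₂ ^ 3 * ((q : ℝ) * r) ^ 2 := by ring
      rw [h5]
      have h6 : D₂ * (1 - β) ≤ D₂ * δ := by gcongr; linarith
      gcongr
      linarith
    · push_cast
      rw [mul_comm (q : ℝ), Real.mul_rpow (by positivity) (by positivity)]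
  have hqε : (q : ℝ) ^ (-ε) = (q : ℝ) ^ (-(ε / 2)) * (q : ℝ) ^ (-(ε / 2)) := by
    rw [← Real.rpow_add (by positivity)]; congr 1; ring
  have hq1 : (q : ℝ) ^ (ε / 2) * (q : ℝ) ^ (-(ε / 2)) = 1 := by
    rw [← Real.rpow_add (by positivity)]; simp
  calc min m c * (q : ℝ) ^ (-ε) ≤ c * (q : ℝ) ^ (-ε) := by
        gcongr; exact min_le_right _ _
    _ = c₂ * (1 - β) * ((C₂ ^ 3 * (r : ℝ) ^ 2) ^ (-(ε / 4)) * (q : ℝ) ^ (-(ε / 2)))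
          * ((q : ℝ) ^ (-(ε / 2)) / (M * C₃ * (r : ℝ) ^ (ε / 2))) := by
        rw [hc, hqε]; ring
    _ ≤ ‖χ.LFunction 1‖ * M * (C₃ * ((r : ℝ) ^ (ε / 2) * (q : ℝ) ^ (ε / 2)))
          * ((q : ℝ) ^ (-(ε / 2)) / (M * C₃ * (r : ℝ) ^ (ε / 2))) := by gcongr
    _ = ‖χ.LFunction 1‖ * ((q : ℝ) ^ (ε / 2) * (q : ℝ) ^ (-(ε / 2))) := by
        field_simp
    _ = _ := by rw [hq1, mul_one]

end BombieriVinogradov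

namespace BombieriVinogradov

open Finset

lemma exists_norm_LFunction_le_inv : ∃ c : ℝ, 1 ≤ c ∧
    ∀ (q : ℕ) [NeZero q] (χ : DirichletCharacter ℂ q) (s : ℂ), 1 < s.re → s.re ≤ 2 →
      ‖χ.LFunction s‖ ≤ c / (s.re - 1) := by
  obtain ⟨C, hC, h⟩ := exists_norm_zeta_sub_le one_pos le_rfl
  refine ⟨1 + 2 * C, by linarith, fun q _ χ s hs hs2 => ?_⟩
  set σ := s.re with hσ
  have hσ1 : 1 < (σ : ℂ).re := by simpa using hs
  have hsum : Summable fun n : ℕ => (n : ℝ) ^ (-σ) := by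
    simpa [Real.rpow_neg] using Real.summable_nat_rpow_inv.2 hs
  have hz : riemannZeta σ = ((∑' n : ℕ, (n : ℝ) ^ (-σ) : ℝ) : ℂ) := by
    rw [zeta_eq_tsum_one_div_nat_cpow hσ1, Complex.ofReal_tsum]
    refine tsum_congr fun n => ?_
    rw [Real.rpow_neg (by positivity), Complex.ofReal_inv, Complex.ofReal_cpow (by positivity),
      Complex.ofReal_natCast, one_div]
  have h1 : ‖χ.LFunction s‖ ≤ ∑' n : ℕ, (n : ℝ) ^ (-σ) := by
    rw [DirichletCharacter.LFunction_eq_LSeries χ hs]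
    refine tsum_of_norm_bounded hsum.hasSum fun n => ?_
    rcases Nat.eq_zero_or_pos n with rfl | hn
    · rw [LSeries.term_zero, norm_zero]; positivity
    · exact norm_term_le_rpow (fun n => χ.norm_le_one _) le_rfl hn
  have h2 : ‖riemannZeta σ‖ = ∑' n : ℕ, (n : ℝ) ^ (-σ) := by
    rw [hz, Complex.norm_real, Real.norm_of_nonneg (tsum_nonneg fun n => by positivity)]
  have h3 := h σ hσ1
  have h4 : ‖(1 : ℂ) / (σ - 1)‖ = 1 / (σ - 1) := by
    rw [← Complex.ofReal_one, ← Complex.ofReal_sub, ← Complex.ofReal_div, Complex.norm_real,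
      Real.norm_of_nonneg (div_nonneg zero_le_one (by linarith))]
  have h5 : ‖(σ : ℂ)‖ ≤ 2 := by
    rw [Complex.norm_real, Real.norm_of_nonneg (by linarith)]; exact hs2
  rw [Real.rpow_one] at h3
  have h6 := norm_le_norm_add_norm_sub' (riemannZeta σ) (1 / ((σ : ℂ) - 1))
  have h7 : 1 ≤ 1 / (σ - 1) := by rw [le_div_iff₀ (by linarith)]; linarith
  calc _ ≤ 1 / (σ - 1) + C * 2 := by
        rw [← h2.trans rfl] at h1
        nlinarith
    _ ≤ 1 / (σ - 1) + C * 2 * (1 / (σ - 1)) := by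
        have := le_mul_of_one_le_right (by linarith : 0 ≤ C * 2) h7
        linarith
    _ = _ := by ring

lemma exists_norm_iteratedDeriv_LFunction_le {ε : ℝ} (hε : 0 < ε) (hε1 : ε ≤ 1) (k : ℕ) :
    ∃ C : ℝ, 1 ≤ C ∧ ∀ (q : ℕ) [NeZero q] (χ : DirichletCharacter ℂ q) (s : ℂ) (t : ℝ), χ ≠ 1 →
      1 ≤ s.re → s.re ≤ 2 → |s.im| ≤ 2 * |t| →
      ‖iteratedDeriv k χ.LFunction s‖ ≤ C * anCond q t ^ ε := by
  obtain ⟨C, hC, h⟩ := exists_norm_periodic_le hε hε1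
  refine ⟨max 1 (k.factorial * C / (ε / 4) ^ k), le_max_left _ _, fun q _ χ s t hχ h1 h2 ht => ?_⟩
  have hA := one_le_anCond_rpow (Nat.pos_of_ne_zero (NeZero.ne q)) t hε.le
  refine (Complex.norm_iteratedDeriv_le_of_forall_mem_sphere_norm_le k (show 0 < ε / 4 by linarith)
    (DirichletCharacter.differentiable_LFunction hχ).diffContOnCl
    (C := C * anCond q t ^ ε) fun z hz => ?_).trans ?_
  · rw [mem_sphere_iff_norm] at hz
    have hre := (abs_le.1 ((Complex.abs_re_le_norm _).trans_eq hz))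
    have him := ((Complex.abs_im_le_norm _).trans_eq hz)
    rw [Complex.sub_re] at hre
    rw [Complex.sub_im] at him
    rw [LFunction_eq_blockLSeries hχ (by linarith)]
    refine h q _ (periodicMeanZero_char hχ) z t (by linarith) (by linarith) ?_
    have := abs_sub_abs_le_abs_sub z.im s.im
    linarith
  · calc _ = (k.factorial * C / (ε / 4) ^ k) * anCond q t ^ ε := by ring
      _ ≤ _ := by gcongr; exact le_max_right _ _

lemma one_le_product {c : ℝ}
    (hc : ∀ (q : ℕ) [NeZero q] (χ : DirichletCharacter ℂ q) (s : ℂ), 1 < s.re → s.re ≤ 2 →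
      ‖χ.LFunction s‖ ≤ c / (s.re - 1)) {q : ℕ} [NeZero q] (χ : DirichletCharacter ℂ q)
    {s : ℂ} (h1 : 1 < s.re) (h2 : s.re ≤ 2) :
    (s.re - 1) ^ 3 ≤ c ^ 3 * ‖χ.LFunction s‖ ^ 4
      * ‖(χ ^ 2).LFunction (s.re + 2 * s.im * Complex.I)‖ := by
  have hx : 0 < s.re - 1 := by linarith
  have h := DirichletCharacter.norm_LFunction_product_ge_one χ hx s.im
  have e1 : (1 + (s.re - 1 : ℝ) + Complex.I * s.im : ℂ) = s := by
    conv_rhs => rw [← Complex.re_add_im s]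
    push_cast; ring
  have e2 : (1 + (s.re - 1 : ℝ) + 2 * Complex.I * s.im : ℂ) = s.re + 2 * s.im * Complex.I := by
    push_cast; ring
  have e0 : (1 + (s.re - 1 : ℝ) : ℂ) = s.re := by push_cast; ring
  rw [e1, e2, e0, norm_mul, norm_mul, norm_pow, norm_pow] at h
  have h0 := hc q (1 : DirichletCharacter ℂ q) s.re (by simpa using h1) (by simpa using h2)
  rw [Complex.ofReal_re] at h0
  rw [DirichletCharacter.LFunctionTrivChar] at h
  calc (s.re - 1) ^ 3 = (s.re - 1) ^ 3 * 1 := (mul_one _).symm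
    _ ≤ (s.re - 1) ^ 3 * ((c / (s.re - 1)) ^ 3 * ‖χ.LFunction s‖ ^ 4
          * ‖(χ ^ 2).LFunction (s.re + 2 * s.im * Complex.I)‖) := by
        gcongr
        refine h.trans ?_
        gcongr
    _ = _ := by field_simp

lemma re_sub_one_div_le {c : ℝ} (hc1 : 1 ≤ c)
    (hc : ∀ (q : ℕ) [NeZero q] (χ : DirichletCharacter ℂ q) (s : ℂ), 1 < s.re → s.re ≤ 2 →
      ‖χ.LFunction s‖ ≤ c / (s.re - 1)) {q : ℕ} [NeZero q] (χ : DirichletCharacter ℂ q)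
    {s : ℂ} (h1 : 1 < s.re) (h2 : s.re ≤ 2) : (s.re - 1) / c ≤ ‖χ.LFunction s‖ := by
  have hx : 0 < s.re - 1 := by linarith
  have h := one_le_product hc χ h1 h2
  have h' := hc q (χ ^ 2) (s.re + 2 * s.im * Complex.I) (by simpa using h1) (by simpa using h2)
  have e : (s.re + 2 * s.im * Complex.I : ℂ).re = s.re := by simp
  rw [e] at h'
  have h4 : (s.re - 1) ^ 4 ≤ (c * ‖χ.LFunction s‖) ^ 4 := by
    calc (s.re - 1) ^ 4 = (s.re - 1) ^ 3 * (s.re - 1) := by ring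
      _ ≤ (c ^ 3 * ‖χ.LFunction s‖ ^ 4 * (c / (s.re - 1))) * (s.re - 1) := by
          gcongr
          exact h.trans (by gcongr)
      _ = _ := by field_simp
  rw [div_le_iff₀ (by linarith), mul_comm]
  exact le_of_pow_le_pow_left₀ (by norm_num) (by positivity) h4

/-- The classical lower bound for `L`-functions near the line `re s = 1`. -/
lemma one_le_norm_LFunction_of_bounds {c V : ℝ} (hc1 : 1 ≤ c) (hV : 1 ≤ V)
    (hc : ∀ (q : ℕ) [NeZero q] (χ : DirichletCharacter ℂ q) (s : ℂ), 1 < s.re → s.re ≤ 2 →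
      ‖χ.LFunction s‖ ≤ c / (s.re - 1)) {q : ℕ} [NeZero q] {χ : DirichletCharacter ℂ q}
    (hχ : χ ≠ 1) {s : ℂ} (h1 : 1 < s.re) (h2 : s.re ≤ 2)
    (hsq : ∀ σ : ℝ, 1 < σ → σ ≤ 2 → ‖(χ ^ 2).LFunction (σ + 2 * s.im * Complex.I)‖ ≤ V)
    (hd : ∀ z : ℂ, 1 < z.re → z.re ≤ 2 → z.im = s.im → ‖deriv χ.LFunction z‖ ≤ V) :
    1 ≤ 16 * c ^ 3 * V ^ 4 * ‖χ.LFunction s‖ := by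
  set δ := 1 / (16 * c ^ 3 * V ^ 5) with hδ
  have hδ0 : 0 < δ := by positivity
  have hδ1 : δ ≤ 1 := by
    rw [hδ, div_le_one (by positivity)]
    nlinarith [one_le_pow₀ hc1 (n := 3), one_le_pow₀ hV (n := 5),
      mul_le_mul (one_le_pow₀ hc1 (n := 3)) (one_le_pow₀ hV (n := 5)) (by norm_num) (by positivity)]
  have key : ∀ z : ℂ, 1 + δ ≤ z.re → z.re ≤ 2 → z.im = s.im →
      1 ≤ 8 * c ^ 3 * V ^ 4 * ‖χ.LFunction z‖ := by
    intro z hz1 hz2 hz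
    have h := one_le_product hc χ (s := z) (by linarith) hz2
    have h' := hsq z.re (by linarith) hz2
    rw [hz] at h
    have h3 : δ ^ 3 ≤ c ^ 3 * ‖χ.LFunction z‖ ^ 4 * V :=
      (pow_le_pow_left₀ hδ0.le (by linarith) 3).trans (h.trans (by gcongr))
    refine le_of_pow_le_pow_left₀ (n := 4) (by norm_num) (by positivity) ?_
    calc (1 : ℝ) ^ 4 = (16 ^ 3 * c ^ 9 * V ^ 15) * δ ^ 3 := by rw [hδ]; field_simp
      _ ≤ (16 ^ 3 * c ^ 9 * V ^ 15) * (c ^ 3 * ‖χ.LFunction z‖ ^ 4 * V) := by gcongr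
      _ = _ := by ring
  rcases le_or_gt (1 + δ) s.re with hs | hs
  · refine (key s hs h2 rfl).trans ?_
    gcongr
    norm_num
  set z : ℂ := ⟨1 + δ, s.im⟩ with hz
  have hk := key z le_rfl (by simp only [hz]; linarith) rfl
  have hconv : Convex ℝ {w : ℂ | w.re ∈ Set.Ioc 1 2 ∧ w.im ∈ ({s.im} : Set ℝ)} :=
    ((convex_Ioc (1 : ℝ) 2).linear_preimage Complex.reLm).inter
      ((convex_singleton s.im).linear_preimage Complex.imLm)
  have hmv := Convex.norm_image_sub_le_of_norm_deriv_le (f := χ.LFunction) (C := V)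
    (x := s) (y := z)
    (fun w _ => (DirichletCharacter.differentiable_LFunction hχ) w)
    (fun w hw => hd w hw.1.1 hw.1.2 hw.2) hconv ⟨⟨h1, h2⟩, rfl⟩
    ⟨⟨by simp only [hz]; linarith, by simp only [hz]; linarith⟩, rfl⟩
  have hdist : ‖z - s‖ ≤ δ := by
    have : z - s = ((1 + δ - s.re : ℝ) : ℂ) := by
      apply Complex.ext <;> simp [hz]
    rw [this, Complex.norm_real, Real.norm_of_nonneg (by linarith)]
    linarith
  have h5 : ‖χ.LFunction z‖ ≤ ‖χ.LFunction s‖ + V * δ := by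
    have := norm_le_norm_add_norm_sub' (χ.LFunction z) (χ.LFunction s)
    nlinarith
  have h6 : 16 * c ^ 3 * V ^ 4 * (V * δ) = 1 := by rw [hδ]; field_simp
  have h7 : 16 * c ^ 3 * V ^ 4 * ‖χ.LFunction z‖
      ≤ 16 * c ^ 3 * V ^ 4 * (‖χ.LFunction s‖ + V * δ) := by gcongr
  linarith

end BombieriVinogradov

namespace BombieriVinogradov

open Finset

lemma norm_LFunction_sub_le {q : ℕ} [NeZero q] {χ : DirichletCharacter ℂ q} (hχ : χ ≠ 1) {s : ℂ}
    (h1 : 1 ≤ s.re) (h2 : s.re ≤ 2) {M : ℝ}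
    (hd : ∀ z : ℂ, 1 ≤ z.re → z.re ≤ 2 → |z.im| ≤ |s.im| → ‖deriv χ.LFunction z‖ ≤ M) :
    ‖χ.LFunction s - χ.LFunction 1‖ ≤ M * ‖s - 1‖ := by
  have hconv : Convex ℝ {w : ℂ | w.re ∈ Set.Icc 1 2 ∧ w.im ∈ Set.Icc (-|s.im|) |s.im|} :=
    ((convex_Icc (1 : ℝ) 2).linear_preimage Complex.reLm).inter
      ((convex_Icc (-|s.im|) |s.im|).linear_preimage Complex.imLm)
  exact Convex.norm_image_sub_le_of_norm_deriv_le
    (fun w _ => (DirichletCharacter.differentiable_LFunction hχ) w)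
    (fun w hw => hd w hw.1.1 hw.1.2 (abs_le.2 hw.2)) hconv ⟨⟨by simp, by simp⟩, by simp⟩
    ⟨⟨h1, h2⟩, abs_le.1 le_rfl⟩

theorem exists_one_le_norm_LFunction {ε : ℝ} (hε : 0 < ε) (hε1 : ε ≤ 1) : ∃ C : ℝ, 1 ≤ C ∧
    ∀ (q : ℕ) [NeZero q] (χ : DirichletCharacter ℂ q) (s : ℂ), χ.IsPrimitive → χ ≠ 1 →
      1 < s.re → s.re ≤ 2 → 1 ≤ C * anCond q s.im ^ ε * ‖χ.LFunction s‖ := by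
  obtain ⟨c, hc1, hc⟩ := exists_norm_LFunction_le_inv
  have hη : 0 < ε / 8 := by linarith
  obtain ⟨c₀, hc₀, hS⟩ := exists_siegel hη (by linarith)
  obtain ⟨C₁, hC₁, h₁⟩ := exists_norm_LFunction_le hη (by linarith)
  obtain ⟨C₂, hC₂, h₂⟩ := exists_norm_iteratedDeriv_LFunction_le hη (by linarith) 0
  obtain ⟨C₃, hC₃, h₃⟩ := exists_norm_iteratedDeriv_LFunction_le hη (by linarith) 1
  simp only [iteratedDeriv_zero] at h₂
  simp only [iteratedDeriv_one] at h₃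
  set K := 4 * C₃ / c₀ with hK
  have hK0 : 0 < K := by positivity
  set W := K + C₁ + C₂ + C₃ with hW
  have hW1 : 1 ≤ W := by linarith
  refine ⟨16 * c ^ 3 * W ^ 4, ?_, fun q _ χ s hp hχ hs1 hs2 => ?_⟩
  · nlinarith [mul_le_mul (one_le_pow₀ hc1 (n := 3)) (one_le_pow₀ hW1 (n := 4)) (by norm_num)
      (by positivity)]
  set t := s.im with ht
  have hq : 0 < q := Nat.pos_of_ne_zero (NeZero.ne q)
  have hAc := one_le_anCond hq t
  set A := anCond q t ^ (ε / 8) with hA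
  have hA1 : 1 ≤ A := one_le_anCond_rpow hq t hη.le
  have hA8 : anCond q t ^ ε = A ^ 8 := by
    rw [hA, ← Real.rpow_natCast, ← Real.rpow_mul (by linarith)]
    congr 1; push_cast; ring
  rw [hA8]
  have hA2 : A ≤ A ^ 2 := by nlinarith
  have hd : ∀ z : ℂ, 1 ≤ z.re → z.re ≤ 2 → |z.im| ≤ |s.im| → ‖deriv χ.LFunction z‖ ≤ C₃ * A :=
    fun z hz1 hz2 hz => h₃ q χ z t hχ hz1 hz2 (by linarith [abs_nonneg t])
  have hdW : ∀ z : ℂ, 1 < z.re → z.re ≤ 2 → z.im = s.im → ‖deriv χ.LFunction z‖ ≤ W * A ^ 2 :=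
    fun z hz1 hz2 hz => (hd z hz1.le hz2 (by rw [hz])).trans (by
      gcongr; linarith)
  have main : (∀ σ : ℝ, 1 < σ → σ ≤ 2 →
      ‖(χ ^ 2).LFunction (σ + 2 * s.im * Complex.I)‖ ≤ W * A ^ 2) →
      1 ≤ 16 * c ^ 3 * W ^ 4 * A ^ 8 * ‖χ.LFunction s‖ := fun h => by
    refine (one_le_norm_LFunction_of_bounds hc1 (V := W * A ^ 2)
      (one_le_mul_of_one_le_of_one_le hW1 (one_le_pow₀ hA1)) hc hχ hs1 hs2 h hdW).trans_eq ?_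
    ring
  by_cases hχ2 : χ ^ 2 = 1
  swap
  · refine main fun σ hσ1 hσ2 => ?_
    refine (h₂ q (χ ^ 2) _ t hχ2 (by simpa using hσ1.le) (by simpa using hσ2)
      (by simp [abs_mul, ← ht])).trans ?_
    gcongr
    linarith
  have hL : c₀ / A ≤ ‖χ.LFunction 1‖ := by
    refine le_trans ?_ (hS q χ hp hχ hχ2)
    rw [Real.rpow_neg (by positivity), div_eq_mul_inv, hA]
    gcongr
    unfold anCond
    exact le_mul_of_one_le_right (by positivity) (by linarith [abs_nonneg t])
  set L₁ := ‖χ.LFunction 1‖ with hL₁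
  have hL₁0 : 0 < L₁ := lt_of_lt_of_le (by positivity) hL
  set τ := L₁ / (4 * (C₃ * A)) with hτ
  have hτ0 : 0 < τ := by positivity
  have hτK : 1 ≤ K * A ^ 2 * τ := by
    rw [hK, hτ]
    rw [div_le_iff₀ (by positivity)] at hL
    rw [show 4 * C₃ / c₀ * A ^ 2 * (L₁ / (4 * (C₃ * A))) = (L₁ * A) / c₀ by field_simp,
      le_div_iff₀ hc₀]
    linarith
  have hcW : K * c ≤ 16 * c ^ 3 * W ^ 4 := by
    have e1 : c ≤ c ^ 3 := le_self_pow₀ hc1 (by norm_num)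
    have e2 : W ≤ W ^ 4 := le_self_pow₀ hW1 (by norm_num)
    have e3 : K ≤ W := by linarith
    calc K * c ≤ W ^ 4 * c ^ 3 := by gcongr; linarith
      _ ≤ _ := by nlinarith [show 0 ≤ W ^ 4 * c ^ 3 by positivity]
  have hA28 : A ^ 2 ≤ A ^ 8 := pow_le_pow_right₀ hA1 (by norm_num)
  rcases le_or_gt τ |t| with htτ | htτ
  · refine main fun σ hσ1 hσ2 => ?_
    have him : (σ + 2 * s.im * Complex.I : ℂ).im = 2 * t := by simp [ht]
    refine (h₁ q (χ ^ 2) (σ + 2 * s.im * Complex.I) t (by simpa using hσ1)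
      (by simp; linarith) (by rw [him, abs_mul]; norm_num)).trans ?_
    have h3 : τ ≤ ‖(σ + 2 * s.im * Complex.I - 1 : ℂ)‖ := by
      refine le_trans ?_ (Complex.abs_im_le_norm _)
      rw [Complex.sub_im, him, Complex.one_im, sub_zero, abs_mul, abs_two]
      linarith [abs_nonneg t]
    have h4 : 1 / ‖(σ + 2 * s.im * Complex.I - 1 : ℂ)‖ ≤ K * A ^ 2 := by
      rw [div_le_iff₀ (hτ0.trans_le h3)]
      exact hτK.trans (by gcongr)
    calc _ ≤ K * A ^ 2 + C₁ * A ^ 2 := by gcongr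
      _ ≤ _ := by rw [← add_mul]; gcongr; linarith
  suffices hsuff : τ / c ≤ ‖χ.LFunction s‖ by
    calc 1 ≤ K * A ^ 2 * τ := hτK
      _ = K * c * A ^ 2 * (τ / c) := by field_simp
      _ ≤ _ := by gcongr
  rcases le_or_gt τ (s.re - 1) with hσ | hσ
  · exact le_trans (by gcongr) (re_sub_one_div_le hc1 hc χ hs1 hs2)
  have h5 : ‖s - 1‖ ≤ 2 * τ := by
    refine (Complex.norm_le_abs_re_add_abs_im _).trans ?_
    rw [Complex.sub_re, Complex.sub_im, Complex.one_re, Complex.one_im, sub_zero,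
      abs_of_pos (by linarith)]
    linarith
  have h6 := norm_LFunction_sub_le hχ hs1.le hs2 hd
  have h7 := norm_le_norm_add_norm_sub (χ.LFunction s) (χ.LFunction 1)
  have h8 : C₃ * A * ‖s - 1‖ ≤ L₁ / 2 := by
    calc C₃ * A * ‖s - 1‖ ≤ C₃ * A * (2 * τ) := by gcongr
      _ = L₁ / 2 := by rw [hτ]; field_simp; norm_num
  have h9 : τ ≤ L₁ / 2 := by
    rw [hτ]
    gcongr
    nlinarith [mul_le_mul hC₃ hA1 (by norm_num) (by linarith)]
  calc τ / c ≤ τ := div_le_self hτ0.le hc1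
    _ ≤ _ := by linarith

end BombieriVinogradov

namespace BombieriVinogradov

open Finset

lemma HasLogDeriv.abscissa_lt {F : ℂ → ℂ} {g : ℕ → ℂ} (h : HasLogDeriv F g) {s : ℂ}
    (hs : 1 < s.re) : LSeries.abscissaOfAbsConv g < s.re := by
  refine lt_of_le_of_lt (LSeries.abscissaOfAbsConv_le_of_forall_lt_LSeriesSummable (x := 1)
    fun y hy => h.summable y (by simpa using hy)) (by exact_mod_cast hs)

lemma HasLogDeriv.iteratedDeriv_mul_eq {F : ℂ → ℂ} {g : ℕ → ℂ} (h : HasLogDeriv F g)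
    (hF : ContDiff ℂ ⊤ F) {s : ℂ} (hs : 1 < s.re) (k : ℕ) :
    iteratedDeriv k (LSeries g) s * F s = -iteratedDeriv (k + 1) F s
      - ∑ i ∈ range k, (k.choose i) * iteratedDeriv i (LSeries g) s * iteratedDeriv (k - i) F s := by
  have hG : ContDiffAt ℂ k (LSeries g) s :=
    (LSeries_analyticOnNhd g s (h.abscissa_lt hs)).contDiffAt
  have h1 := iteratedDeriv_fun_mul hG (hF.contDiffAt.of_le le_top)
  have h2 : (fun z => LSeries g z * F z) =ᶠ[nhds s] fun z => -(deriv F z) := by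
    filter_upwards [(isOpen_lt continuous_const Complex.continuous_re).mem_nhds hs] with z hz
    rw [(h.hasDerivAt z hz).deriv]; ring
  rw [(h2.iteratedDeriv k).eq_of_nhds, iteratedDeriv_fun_neg, ← iteratedDeriv_succ',
    sum_range_succ] at h1
  simp only [Nat.choose_self, Nat.cast_one, one_mul, Nat.sub_self, iteratedDeriv_zero] at h1
  rw [h1]; ring

theorem exists_norm_iteratedDeriv_LSeries_le (k : ℕ) : ∀ {ε : ℝ}, 0 < ε → ε ≤ 1 →
    ∃ C : ℝ, 1 ≤ C ∧ ∀ (q : ℕ) [NeZero q] (χ : DirichletCharacter ℂ q) (s : ℂ), χ.IsPrimitive →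
      χ ≠ 1 → 1 < s.re → s.re ≤ 2 →
      ‖iteratedDeriv k (LSeries fun n => χ n * (ArithmeticFunction.vonMangoldt n : ℂ)) s‖
        ≤ C * anCond q s.im ^ ε := by
  induction k using Nat.strong_induction_on with
  | _ k ih =>
  intro ε hε hε1
  have hη : 0 < ε / 3 := by linarith
  obtain ⟨C₀, hC₀, h₀⟩ := exists_one_le_norm_LFunction hη (by linarith)
  choose D hD hL using fun j => exists_norm_iteratedDeriv_LFunction_le hη (by linarith) j
  have ih' : ∀ i, ∃ C : ℝ, 1 ≤ C ∧ (i < k → ∀ (q : ℕ) [NeZero q] (χ : DirichletCharacter ℂ q)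
      (s : ℂ), χ.IsPrimitive → χ ≠ 1 → 1 < s.re → s.re ≤ 2 →
      ‖iteratedDeriv i (LSeries fun n => χ n * (ArithmeticFunction.vonMangoldt n : ℂ)) s‖
        ≤ C * anCond q s.im ^ (ε / 3)) := fun i => by
    by_cases hi : i < k
    · obtain ⟨C, hC, h⟩ := ih i hi hη (by linarith)
      exact ⟨C, hC, fun _ => h⟩
    · exact ⟨1, le_rfl, fun h => absurd h hi⟩
  choose E hE hG using ih'
  set S := D (k + 1) + ∑ i ∈ range k, (k.choose i) * E i * D (k - i) with hS
  have hS1 : 1 ≤ S := by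
    have : 0 ≤ ∑ i ∈ range k, (k.choose i) * E i * D (k - i) := sum_nonneg fun i _ => by
      have := hE i; have := hD (k - i); positivity
    linarith [hD (k + 1)]
  refine ⟨C₀ * S, one_le_mul_of_one_le_of_one_le hC₀ hS1, fun q _ χ s hp hχ h1 h2 => ?_⟩
  have hq : 0 < q := Nat.pos_of_ne_zero (NeZero.ne q)
  have hA1 := one_le_anCond_rpow hq s.im hη.le
  have hA3 : anCond q s.im ^ ε = (anCond q s.im ^ (ε / 3)) ^ 3 := by
    rw [← Real.rpow_natCast, ← Real.rpow_mul (by linarith [one_le_anCond hq s.im])]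
    congr 1; push_cast; ring
  set A := anCond q s.im ^ (ε / 3) with hA
  have hlog := hasLogDeriv_LFunction χ
  have heq := hlog.iteratedDeriv_mul_eq
    (DirichletCharacter.differentiable_LFunction hχ).contDiff h1 k
  set G := iteratedDeriv k (LSeries fun n => χ n * (ArithmeticFunction.vonMangoldt n : ℂ)) s with hGdef
  have hLj : ∀ j, ‖iteratedDeriv j χ.LFunction s‖ ≤ D j * A := fun j =>
    hL j q χ s s.im hχ h1.le h2 (by linarith [abs_nonneg s.im])
  have hGL : ‖G‖ * ‖χ.LFunction s‖ ≤ S * A ^ 2 := by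
    rw [← norm_mul, heq]
    refine (norm_sub_le _ _).trans ?_
    rw [norm_neg, hS, add_mul, sum_mul]
    refine add_le_add ((hLj _).trans ?_) ((norm_sum_le _ _).trans (sum_le_sum fun i hi => ?_))
    · have := hD (k + 1)
      gcongr
      nlinarith
    · have := hE i
      rw [norm_mul, norm_mul, Complex.norm_natCast]
      calc _ ≤ (k.choose i) * (E i * A) * (D (k - i) * A) := by
            gcongr
            · exact hG i (mem_range.1 hi) q χ s hp hχ h1 h2
            · exact hLj _
        _ = _ := by ring
  calc ‖G‖ = ‖G‖ * 1 := (mul_one _).symm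
    _ ≤ ‖G‖ * (C₀ * A * ‖χ.LFunction s‖) := by
        gcongr
        exact h₀ q χ s hp hχ h1 h2
    _ = C₀ * A * (‖G‖ * ‖χ.LFunction s‖) := by ring
    _ ≤ C₀ * A * (S * A ^ 2) := by gcongr
    _ = _ := by rw [hA3]; ring

/-- The coefficients `χ(n) Λ(n) (log n)^k`. -/
noncomputable def logCoeff {q : ℕ} (χ : DirichletCharacter ℂ q) (k : ℕ) (n : ℕ) : ℂ :=
  ((ArithmeticFunction.vonMangoldt n * Real.log n ^ k : ℝ) : ℂ) * χ n

lemma iterate_logMul_eq (g : ℕ → ℂ) (k : ℕ) :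
    LSeries.logMul^[k] g = fun n : ℕ => (Real.log n : ℂ) ^ k * g n := by
  induction k with
  | zero => simp
  | succ k ih =>
    rw [Function.iterate_succ_apply', ih]
    ext n
    simp only [LSeries.logMul]
    rw [← Complex.natCast_log]; ring

lemma logCoeff_eq {q : ℕ} (χ : DirichletCharacter ℂ q) (k : ℕ) :
    logCoeff χ k
      = LSeries.logMul^[k] fun n => χ n * (ArithmeticFunction.vonMangoldt n : ℂ) := by
  rw [iterate_logMul_eq]
  ext n
  simp only [logCoeff]
  push_cast; ring

lemma summable_logCoeff {q : ℕ} [NeZero q] (χ : DirichletCharacter ℂ q) (k : ℕ) {s : ℂ}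
    (hs : 1 < s.re) : LSeriesSummable (logCoeff χ k) s := by
  refine LSeriesSummable_of_abscissaOfAbsConv_lt_re ?_
  rw [logCoeff_eq, LSeries.absicssaOfAbsConv_logPowMul]
  exact (hasLogDeriv_LFunction χ).abscissa_lt hs

theorem exists_norm_LSeries_logCoeff_le (k : ℕ) {ε : ℝ} (hε : 0 < ε) (hε1 : ε ≤ 1) :
    ∃ C : ℝ, 1 ≤ C ∧ ∀ (q : ℕ) [NeZero q] (χ : DirichletCharacter ℂ q) (s : ℂ), χ.IsPrimitive →
      χ ≠ 1 → 1 < s.re → s.re ≤ 2 → ‖LSeries (logCoeff χ k) s‖ ≤ C * anCond q s.im ^ ε := by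
  obtain ⟨C, hC, h⟩ := exists_norm_iteratedDeriv_LSeries_le k hε hε1
  refine ⟨C, hC, fun q _ χ s hp hχ h1 h2 => ?_⟩
  have := h q χ s hp hχ h1 h2
  rwa [LSeries_iteratedDeriv k ((hasLogDeriv_LFunction χ).abscissa_lt h1), norm_mul, norm_pow,
    norm_neg, norm_one, one_pow, one_mul, ← logCoeff_eq] at this

end BombieriVinogradov

namespace BombieriVinogradov

open Finset MeasureTheory

/-- The truncated linear weight, as a complex function. -/
noncomputable def fejer (u : ℝ) : ℂ := ((max 0 (1 - u) : ℝ) : ℂ)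

lemma continuous_fejer : Continuous fejer := by
  unfold fejer
  fun_prop

lemma hasMellin_fejer {s : ℂ} (hs : 0 < s.re) : HasMellin fejer s (1 / s - 1 / (s + 1)) := by
  have h1 := hasMellin_one_Ioc hs
  have h2 := hasMellin_cpow_Ioc 1 (s := s) (by simp; linarith)
  have h := hasMellin_sub h1.1 h2.1
  rw [h1.2, h2.2] at h
  have heq : Set.EqOn (fun t => Set.indicator (Set.Ioc 0 1) (fun _ => 1 : ℝ → ℂ) t
      - Set.indicator (Set.Ioc 0 1) (fun t => (t : ℂ) ^ (1 : ℂ) : ℝ → ℂ) t) fejer (Set.Ioi 0) := by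
    intro t ht
    have ht : 0 < t := ht
    by_cases h1 : t ≤ 1
    · simp only [Set.indicator_of_mem (show t ∈ Set.Ioc (0 : ℝ) 1 from ⟨ht, h1⟩), Complex.cpow_one,
        fejer]
      rw [max_eq_right (by linarith)]; push_cast; rfl
    · simp only [Set.indicator_of_notMem (show t ∉ Set.Ioc (0 : ℝ) 1 from fun h => h1 h.2), fejer]
      rw [max_eq_left (by linarith)]; simp
  have heq' : Set.EqOn (fun t : ℝ => (t : ℂ) ^ (s - 1) •
      (Set.indicator (Set.Ioc 0 1) (fun _ => 1 : ℝ → ℂ) t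
      - Set.indicator (Set.Ioc 0 1) (fun t => (t : ℂ) ^ (1 : ℂ) : ℝ → ℂ) t))
      (fun t : ℝ => (t : ℂ) ^ (s - 1) • fejer t) (Set.Ioi 0) := fun t ht => by
    simp only [smul_eq_mul]
    rw [← heq ht]
  refine ⟨(integrableOn_congr_fun heq' measurableSet_Ioi).1 h.1, ?_⟩
  rw [← h.2]
  exact (setIntegral_congr_fun measurableSet_Ioi heq').symm

lemma norm_fejer_transform_le {c : ℝ} (hc : 1 ≤ c) (t : ℝ) :
    ‖(1 / (c + t * Complex.I) - 1 / (c + t * Complex.I + 1) : ℂ)‖ ≤ (1 + t ^ 2)⁻¹ := by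
  have h1 : (c + t * Complex.I : ℂ) ≠ 0 := fun h => by
    have := congrArg Complex.re h
    simp at this; linarith
  have h2 : (c + t * Complex.I + 1 : ℂ) ≠ 0 := fun h => by
    have := congrArg Complex.re h
    simp at this; linarith
  have key : ∀ a : ℝ, 1 ≤ a → √(1 + t ^ 2) ≤ ‖(a + t * Complex.I : ℂ)‖ := fun a ha => by
    rw [Complex.norm_add_mul_I]
    gcongr
    nlinarith
  have e : (1 / (c + t * Complex.I) - 1 / (c + t * Complex.I + 1) : ℂ)
      = 1 / ((c + t * Complex.I) * (c + t * Complex.I + 1)) := by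
    field_simp; ring
  have k1 := key c hc
  have k2 := key (c + 1) (by linarith)
  rw [e, norm_div, norm_one, norm_mul, ← one_div]
  have h3 : (c + t * Complex.I + 1 : ℂ) = ((c + 1 : ℝ) : ℂ) + t * Complex.I := by
    push_cast; ring
  rw [h3]
  refine one_div_le_one_div_of_le (by positivity) ?_
  calc 1 + t ^ 2 = √(1 + t ^ 2) * √(1 + t ^ 2) := (Real.mul_self_sqrt (by positivity)).symm
    _ ≤ _ := by gcongr

lemma continuous_fejer_transform {c : ℝ} (hc : 1 ≤ c) :
    Continuous fun t : ℝ => (1 / (c + t * Complex.I) - 1 / (c + t * Complex.I + 1) : ℂ) := by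
  refine Continuous.sub (Continuous.div (by fun_prop) (by fun_prop) fun t h => ?_)
    (Continuous.div (by fun_prop) (by fun_prop) fun t h => ?_)
  all_goals
    have := congrArg Complex.re h
    simp at this; linarith

lemma integrable_fejer_transform {c : ℝ} (hc : 1 ≤ c) :
    Integrable fun t : ℝ => (1 / (c + t * Complex.I) - 1 / (c + t * Complex.I + 1) : ℂ) :=
  integrable_inv_one_add_sq.mono' (continuous_fejer_transform hc).aestronglyMeasurable
    (Filter.Eventually.of_forall (norm_fejer_transform_le hc))

lemma integral_fejer_transform {c : ℝ} (hc : 1 ≤ c) {u : ℝ} (hu : 0 < u) :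
    ∫ t : ℝ, (u : ℂ) ^ (-(c + t * Complex.I : ℂ))
      * (1 / (c + t * Complex.I) - 1 / (c + t * Complex.I + 1)) = 2 * Real.pi * fejer u := by
  have hM : ∀ t : ℝ, mellin fejer (c + t * Complex.I)
      = 1 / (c + t * Complex.I) - 1 / (c + t * Complex.I + 1) := fun t =>
    (hasMellin_fejer (by simp; linarith)).2
  have h := mellinInv_mellin_eq c fejer hu (hasMellin_fejer (by simp; linarith)).1
    (by simpa only [Complex.VerticalIntegrable, hM] using integrable_fejer_transform hc)
    continuous_fejer.continuousAt
  simp only [mellinInv, hM, smul_eq_mul] at h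
  rw [← h, Complex.real_smul]
  set I := ∫ y : ℝ, (u : ℂ) ^ (-(c + y * Complex.I : ℂ))
      * (1 / (c + y * Complex.I) - 1 / (c + y * Complex.I + 1))
  have : (Real.pi : ℂ) ≠ 0 := by exact_mod_cast Real.pi_ne_zero
  push_cast
  field_simp

lemma exists_norm_tsum_fejer_le : ∃ C : ℝ, 0 < C ∧ ∀ (a : ℕ → ℂ) (c Q y : ℝ), a 0 = 0 → 1 ≤ c →
    0 ≤ Q → 0 < y → LSeriesSummable a c →
    (∀ t : ℝ, ‖LSeries a (c + t * Complex.I)‖ ≤ Q * (|t| + 2) ^ (1 / 2 : ℝ)) →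
    ‖∑' n : ℕ, a n * fejer (n * y)‖ ≤ C * Q * y ^ (-c) := by
  have hInt : Integrable fun t : ℝ => (1 + ‖t‖) ^ (-(3 / 2) : ℝ) :=
    integrable_one_add_norm (by norm_num)
  refine ⟨4 * (∫ t : ℝ, (1 + ‖t‖) ^ (-(3 / 2) : ℝ)) + 1, by positivity, ?_⟩
  intro a c Q y ha hc hQ hy hsum hbound
  set T : ℝ → ℂ := fun t => 1 / (c + t * Complex.I) - 1 / (c + t * Complex.I + 1) with hT
  have hTn : ∀ t, ‖T t‖ ≤ (1 + t ^ 2)⁻¹ := norm_fejer_transform_le hc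
  have hre : ∀ t : ℝ, (c + t * Complex.I : ℂ).re = c := fun t => by simp
  set G : ℕ → ℝ → ℂ := fun n t =>
    LSeries.term a (c + t * Complex.I) n * (y : ℂ) ^ (-(c + t * Complex.I : ℂ)) * T t with hG
  have hyc : ∀ t : ℝ, ‖(y : ℂ) ^ (-(c + t * Complex.I : ℂ))‖ = y ^ (-c) := fun t => by
    rw [Complex.norm_cpow_eq_rpow_re_of_pos hy]; simp
  have hterm : ∀ (n : ℕ) (t : ℝ), ‖LSeries.term a (c + t * Complex.I) n‖ = ‖LSeries.term a c n‖ :=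
    fun n t => by simp only [LSeries.norm_term_eq, hre, Complex.ofReal_re]
  have hGn : ∀ n t, ‖G n t‖ ≤ ‖LSeries.term a c n‖ * y ^ (-c) * (1 + t ^ 2)⁻¹ := fun n t => by
    simp only [hG, norm_mul, hyc, hterm]
    gcongr
    exact hTn t
  have hy0 : (y : ℂ) ≠ 0 := by exact_mod_cast hy.ne'
  have hGcont : ∀ n, Continuous (G n) := fun n => by
    refine (Continuous.mul ?_ ?_).mul (continuous_fejer_transform hc)
    · rcases Nat.eq_zero_or_pos n with rfl | hn
      · simp only [LSeries.term_zero]; exact continuous_const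
      · simp only [LSeries.term_of_ne_zero hn.ne']
        have hn0 : (n : ℂ) ≠ 0 := by exact_mod_cast hn.ne'
        refine continuous_const.div ?_ fun t => by simp [Complex.cpow_eq_zero_iff, hn0]
        exact Continuous.const_cpow (by fun_prop) (Or.inl hn0)
    · exact Continuous.const_cpow (by fun_prop) (Or.inl hy0)
  have hGint : ∀ n, Integrable (G n) := fun n =>
    (integrable_inv_one_add_sq.const_mul _).mono' (hGcont n).aestronglyMeasurable
      (Filter.Eventually.of_forall (hGn n))
  have hGsum : Summable fun n => ∫ t, ‖G n t‖ := by
    refine Summable.of_nonneg_of_le (fun n => by positivity) (fun n => ?_)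
      ((hsum.norm.mul_right (y ^ (-c))).mul_right Real.pi)
    refine (integral_mono (hGint n).norm (integrable_inv_one_add_sq.const_mul _)
      (hGn n)).trans_eq ?_
    rw [integral_const_mul, integral_univ_inv_one_add_sq]
  have hmain := hasSum_integral_of_summable_integral_norm hGint hGsum
  have hval : ∀ n, ∫ t, G n t = 2 * Real.pi * (a n * fejer (n * y)) := fun n => by
    rcases Nat.eq_zero_or_pos n with rfl | hn
    · simp [hG, ha]
    · have hn0 : (0 : ℝ) < n := by exact_mod_cast hn
      have h := integral_fejer_transform hc (mul_pos hn0 hy)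
      calc ∫ t, G n t = ∫ t : ℝ, a n * (((n * y : ℝ) : ℂ) ^ (-(c + t * Complex.I : ℂ)) * T t) := by
            congr 1
            ext t
            simp only [hG, LSeries.term_of_ne_zero hn.ne']
            rw [Complex.ofReal_mul, Complex.mul_cpow_ofReal_nonneg hn0.le hy.le,
              Complex.cpow_neg (((n : ℝ) : ℂ)), Complex.ofReal_natCast]
            ring
        _ = a n * (2 * Real.pi * fejer (n * y)) := by rw [integral_const_mul, h]
        _ = _ := by ring
  have hsumv : ∀ t : ℝ, ∑' n, G n t
      = LSeries a (c + t * Complex.I) * (y : ℂ) ^ (-(c + t * Complex.I : ℂ)) * T t := fun t => by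
    simp only [hG]
    rw [tsum_mul_right, tsum_mul_right]; rfl
  simp only [hval, hsumv] at hmain
  have h2 := hmain.tsum_eq
  rw [tsum_mul_left] at h2
  have hb : ‖∫ t : ℝ, LSeries a (c + t * Complex.I) * (y : ℂ) ^ (-(c + t * Complex.I : ℂ)) * T t‖
      ≤ ∫ t : ℝ, Q * y ^ (-c) * 4 * (1 + ‖t‖) ^ (-(3 / 2) : ℝ) := by
    refine norm_integral_le_of_norm_le (hInt.const_mul _) (Filter.Eventually.of_forall fun t => ?_)
    rw [norm_mul, norm_mul, hyc, Real.norm_eq_abs]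
    have h3 : (|t| + 2) ^ (1 / 2 : ℝ) ≤ 2 * (1 + |t|) ^ (1 / 2 : ℝ) := by
      calc (|t| + 2) ^ (1 / 2 : ℝ) ≤ (4 * (1 + |t|)) ^ (1 / 2 : ℝ) := by
            gcongr; linarith [abs_nonneg t]
        _ = _ := by
            rw [Real.mul_rpow (by norm_num) (by positivity), ← Real.sqrt_eq_rpow 4,
              show (4 : ℝ) = 2 ^ 2 by norm_num, Real.sqrt_sq (by norm_num)]
    have h4 : (1 + t ^ 2)⁻¹ ≤ 2 * (1 + |t|) ^ (-2 : ℝ) := by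
      rw [Real.rpow_neg (by positivity), Real.rpow_ofNat, ← div_eq_mul_inv,
        inv_eq_one_div, div_le_div_iff₀ (by positivity) (by positivity), one_mul]
      nlinarith [sq_abs t, sq_nonneg (|t| - 1)]
    calc _ ≤ Q * (2 * (1 + |t|) ^ (1 / 2 : ℝ)) * y ^ (-c) * (2 * (1 + |t|) ^ (-2 : ℝ)) := by
          gcongr
          · exact (hbound t).trans (by gcongr)
          · exact (hTn t).trans h4
      _ = Q * y ^ (-c) * 4 * ((1 + |t|) ^ (1 / 2 : ℝ) * (1 + |t|) ^ (-2 : ℝ)) := by ring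
      _ = _ := by rw [← Real.rpow_add (by positivity)]; norm_num
  rw [← h2, integral_const_mul, norm_mul] at hb
  have hpi : ‖(2 * Real.pi : ℂ)‖ = 2 * Real.pi := by
    rw [norm_mul, Complex.norm_real, Real.norm_of_nonneg Real.pi_pos.le]; simp
  rw [hpi] at hb
  have h5 : 1 ≤ 2 * Real.pi := by linarith [Real.pi_gt_three]
  have hnn := norm_nonneg (∑' n : ℕ, a n * fejer (n * y))
  have hyp : 0 ≤ Q * y ^ (-c) := by positivity
  nlinarith

lemma exists_norm_sum_fejer_logCoeff_le (k : ℕ) {ε : ℝ} (hε : 0 < ε) (hε1 : ε ≤ 1 / 2) :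
    ∃ C : ℝ, 0 < C ∧ ∀ (q : ℕ) [NeZero q] (χ : DirichletCharacter ℂ q) (N : ℕ), χ.IsPrimitive →
      χ ≠ 1 → 3 ≤ N →
      ‖∑ n ∈ Ioc 0 N, logCoeff χ k n * ((N - n : ℕ) : ℂ)‖ ≤ C * (q : ℝ) ^ ε * N ^ 2 := by
  obtain ⟨C₁, hC₁, h₁⟩ := exists_norm_tsum_fejer_le
  obtain ⟨C₂, hC₂, h₂⟩ := exists_norm_LSeries_logCoeff_le k hε (by linarith)
  refine ⟨C₁ * C₂ * Real.exp 1, by positivity, fun q _ χ N hp hχ hN => ?_⟩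
  have hN3 : (3 : ℝ) ≤ N := by exact_mod_cast hN
  have hN0 : (0 : ℝ) < N := by linarith
  have hlog : 1 ≤ Real.log N := by
    rw [Real.le_log_iff_exp_le hN0]
    linarith [Real.exp_one_lt_three]
  set c : ℝ := 1 + 1 / Real.log N with hc
  have hinv : 0 < 1 / Real.log N := by positivity
  have hinv1 : 1 / Real.log N ≤ 1 := by rw [div_le_one (by linarith)]; exact hlog
  have h := h₁ (logCoeff χ k) c (C₂ * (q : ℝ) ^ ε) (N : ℝ)⁻¹ (by simp [logCoeff]) (by linarith)
    (by positivity) (by positivity) (summable_logCoeff χ k (by simp; linarith)) (fun t => ?_)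
  · have hNc : ((N : ℝ)⁻¹) ^ (-c) = Real.exp 1 * N := by
      rw [Real.inv_rpow hN0.le, Real.rpow_neg hN0.le, inv_inv, hc, Real.rpow_add hN0,
        Real.rpow_one, mul_comm]
      congr 1
      rw [Real.rpow_def_of_pos hN0, mul_one_div_cancel (by linarith)]
    have hval : ∑' n : ℕ, logCoeff χ k n * fejer (n * (N : ℝ)⁻¹)
        = ∑ n ∈ Ioc 0 N, logCoeff χ k n * fejer (n * (N : ℝ)⁻¹) := by
      refine tsum_eq_sum fun n hn => ?_
      rw [mem_Ioc, not_and_or, not_lt, not_le] at hn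
      rcases hn with hn | hn
      · obtain rfl : n = 0 := by omega
        simp [logCoeff]
      · have : (1 : ℝ) ≤ n * (N : ℝ)⁻¹ := by
          rw [← div_eq_mul_inv, one_le_div hN0]; exact_mod_cast hn.le
        simp only [fejer]
        rw [max_eq_left (by linarith)]; simp
    rw [hval, hNc] at h
    have hscale : ∑ n ∈ Ioc 0 N, logCoeff χ k n * ((N - n : ℕ) : ℂ)
        = (N : ℂ) * ∑ n ∈ Ioc 0 N, logCoeff χ k n * fejer (n * (N : ℝ)⁻¹) := by
      rw [mul_sum]
      refine sum_congr rfl fun n hn => ?_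
      have hn2 := (mem_Ioc.1 hn).2
      have h3 : (n : ℝ) * (N : ℝ)⁻¹ ≤ 1 := by
        rw [← div_eq_mul_inv, div_le_one hN0]; exact_mod_cast hn2
      have hN' : (N : ℂ) ≠ 0 := by exact_mod_cast hN0.ne'
      simp only [fejer]
      rw [max_eq_right (by linarith), Nat.cast_sub hn2]
      push_cast
      field_simp
    rw [hscale, norm_mul, Complex.norm_natCast]
    calc _ ≤ (N : ℝ) * (C₁ * (C₂ * (q : ℝ) ^ ε) * (Real.exp 1 * N)) := by gcongr
      _ = _ := by ring
  · refine (h₂ q χ _ hp hχ (by simp; linarith) (by simp; linarith)).trans ?_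
    have him : (c + t * Complex.I : ℂ).im = t := by simp
    rw [him, anCond, Real.mul_rpow (by positivity) (by positivity), ← mul_assoc]
    gcongr
    linarith [abs_nonneg t]

end BombieriVinogradov

namespace BombieriVinogradov

open Finset

lemma exists_log_pow_le (k : ℕ) {δ : ℝ} (hδ : 0 < δ) :
    ∃ C : ℝ, 1 ≤ C ∧ ∀ x : ℝ, 1 ≤ x → (2 + Real.log x) ^ k ≤ C * x ^ δ := by
  set η := δ / (k + 1) with hη
  have hη0 : 0 < η := by positivity
  refine ⟨max 1 ((2 + 1 / η) ^ k), le_max_left _ _, fun x hx => ?_⟩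
  have hlog := Real.log_nonneg hx
  have hxη : 1 ≤ x ^ η := Real.one_le_rpow hx hη0.le
  have h1 : 2 + Real.log x ≤ (2 + 1 / η) * x ^ η := by
    have h := Real.log_le_rpow_div (by linarith : 0 ≤ x) hη0
    rw [add_mul, one_div_mul_eq_div]
    linarith
  calc (2 + Real.log x) ^ k ≤ ((2 + 1 / η) * x ^ η) ^ k := by gcongr
    _ = (2 + 1 / η) ^ k * x ^ (η * k) := by
        rw [mul_pow, ← Real.rpow_natCast (x ^ η), ← Real.rpow_mul (by linarith)]
    _ ≤ max 1 ((2 + 1 / η) ^ k) * x ^ δ := by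
        gcongr
        · exact le_max_right _ _
        · rw [hη, div_mul_eq_mul_div, div_le_iff₀ (by positivity)]
          nlinarith

lemma norm_sum_mul_le_of_antitone {a : ℕ → ℂ} {w : ℕ → ℝ} {M : ℕ} {P : ℝ}
    (hw : ∀ n, M < n → w (n + 1) ≤ w n) (hw0 : ∀ n, M < n → 0 ≤ w n) {N : ℕ} (hMN : M < N)
    (hP : ∀ n, M < n → n ≤ N → ‖∑ j ∈ Ioc M n, a j‖ ≤ P) :
    ‖∑ n ∈ Ioc M N, a n * w n‖ ≤ P * w (M + 1) := by
  have key : ∀ K, M + 1 ≤ K → K ≤ N →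
      ‖∑ n ∈ Ioc M K, a n * w n - w K * ∑ n ∈ Ioc M K, a n‖ ≤ P * (w (M + 1) - w K) := by
    intro K hK
    induction K, hK using Nat.le_induction with
    | base => intro _; simp [mul_comm]
    | succ K hK ih =>
      intro hKN
      have e : ∑ n ∈ Ioc M (K + 1), a n * w n - w (K + 1) * ∑ n ∈ Ioc M (K + 1), a n
          = (∑ n ∈ Ioc M K, a n * w n - w K * ∑ n ∈ Ioc M K, a n)
            + ((w K - w (K + 1) : ℝ) : ℂ) * ∑ n ∈ Ioc M K, a n := by
        rw [sum_Ioc_succ_top (by omega), sum_Ioc_succ_top (by omega)]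
        push_cast; ring
      have h1 := hw K (by omega)
      rw [e]
      calc _ ≤ P * (w (M + 1) - w K) + (w K - w (K + 1)) * P := by
            refine (norm_add_le _ _).trans (add_le_add (ih (by omega)) ?_)
            rw [norm_mul, Complex.norm_real, Real.norm_of_nonneg (by linarith)]
            exact mul_le_mul_of_nonneg_left (hP K (by omega) (by omega)) (by linarith)
        _ = _ := by ring
  have h1 := key N hMN le_rfl
  have h2 := norm_le_norm_add_norm_sub' (∑ n ∈ Ioc M N, a n * w n)
    ((w N : ℂ) * ∑ n ∈ Ioc M N, a n)
  have h3 : ‖(w N : ℂ) * ∑ n ∈ Ioc M N, a n‖ ≤ w N * P := by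
    rw [norm_mul, Complex.norm_real, Real.norm_of_nonneg (hw0 N hMN)]
    exact mul_le_mul_of_nonneg_left (hP N hMN le_rfl) (hw0 N hMN)
  linarith

lemma norm_logCoeff_le {q : ℕ} (χ : DirichletCharacter ℂ q) (k : ℕ) {n N : ℕ} (h : n ≤ N) :
    ‖logCoeff χ k n‖ ≤ Real.log N ^ (k + 1) := by
  have hlog := log_natCast_mono h
  have h0 : 0 ≤ Real.log n := Real.log_natCast_nonneg n
  rw [logCoeff, norm_mul, Complex.norm_real, Real.norm_eq_abs, abs_mul, abs_pow, abs_of_nonneg h0,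
    pow_succ']
  calc _ ≤ (Real.log N * Real.log N ^ k) * 1 := by
        gcongr
        · exact vonMangoldt_le_log_of_le h
        · exact χ.norm_le_one _
    _ = _ := mul_one _

lemma sum_logCoeff_mul_eq {q : ℕ} (χ : DirichletCharacter ℂ q) (k N h : ℕ) :
    (h : ℂ) * ∑ n ∈ Ioc 0 N, logCoeff χ k n
      = ∑ n ∈ Ioc 0 (N + h), logCoeff χ k n * ((N + h - n : ℕ) : ℂ)
        - ∑ n ∈ Ioc 0 N, logCoeff χ k n * ((N - n : ℕ) : ℂ)
        - ∑ n ∈ Ioc N (N + h), logCoeff χ k n * ((N + h - n : ℕ) : ℂ) := by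
  rw [← sum_Ioc_consecutive _ (Nat.zero_le N) (Nat.le_add_right N h), mul_sum]
  have : ∑ n ∈ Ioc 0 N, logCoeff χ k n * ((N + h - n : ℕ) : ℂ)
      = ∑ n ∈ Ioc 0 N, (h : ℂ) * logCoeff χ k n
        + ∑ n ∈ Ioc 0 N, logCoeff χ k n * ((N - n : ℕ) : ℂ) := by
    rw [← sum_add_distrib]
    refine sum_congr rfl fun n hn => ?_
    have hn := (mem_Ioc.1 hn).2
    rw [show N + h - n = N - n + h by omega]
    push_cast; ring
  rw [this]; ring

lemma exists_norm_sum_logCoeff_le (k : ℕ) {ε : ℝ} (hε : 0 < ε) (hε1 : ε ≤ 1 / 2) :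
    ∃ C : ℝ, 0 < C ∧ ∀ (q : ℕ) [NeZero q] (χ : DirichletCharacter ℂ q) (N h : ℕ), χ.IsPrimitive →
      χ ≠ 1 → 3 ≤ N → 1 ≤ h → h ≤ N →
      ‖∑ n ∈ Ioc 0 N, logCoeff χ k n‖
        ≤ C * (q : ℝ) ^ ε * N ^ 2 / h + h * (2 + Real.log N) ^ (k + 1) := by
  obtain ⟨C, hC, hF⟩ := exists_norm_sum_fejer_logCoeff_le k hε hε1
  refine ⟨5 * C, by positivity, fun q _ χ N h hp hχ hN h1 hhN => ?_⟩
  have hN0 : (0 : ℝ) < N := by exact_mod_cast (by omega : 0 < N)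
  have hh0 : (0 : ℝ) < h := by exact_mod_cast h1
  have hhN' : (h : ℝ) ≤ N := by exact_mod_cast hhN
  have hlog : Real.log (N + h : ℕ) ≤ 2 + Real.log N := by
    calc Real.log (N + h : ℕ) ≤ Real.log (2 * N) := by
          apply Real.log_le_log (by positivity)
          push_cast; linarith
      _ = Real.log 2 + Real.log N := Real.log_mul (by norm_num) hN0.ne'
      _ ≤ _ := by linarith [Real.log_two_lt_d9]
  have hlog0 : 0 ≤ Real.log (N + h : ℕ) := Real.log_natCast_nonneg _
  have hl0 : 0 ≤ Real.log N := Real.log_natCast_nonneg _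
  have e1 : ‖∑ n ∈ Ioc 0 (N + h), logCoeff χ k n * ((N + h - n : ℕ) : ℂ)‖
      ≤ C * (q : ℝ) ^ ε * (4 * N ^ 2) := by
    refine (hF q χ (N + h) hp hχ (by omega)).trans ?_
    push_cast
    gcongr
    nlinarith
  have e2 := hF q χ N hp hχ hN
  have e3 : ‖∑ n ∈ Ioc N (N + h), logCoeff χ k n * ((N + h - n : ℕ) : ℂ)‖
      ≤ h * ((2 + Real.log N) ^ (k + 1) * h) := by
    have : ∀ n ∈ Ioc N (N + h), ‖logCoeff χ k n * ((N + h - n : ℕ) : ℂ)‖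
        ≤ (2 + Real.log N) ^ (k + 1) * h := fun n hn => by
      rw [mem_Ioc] at hn
      rw [norm_mul, Complex.norm_natCast]
      gcongr
      · exact (norm_logCoeff_le χ k hn.2).trans (by gcongr)
      · omega
    refine (norm_sum_le_of_le _ this).trans_eq ?_
    rw [sum_const, Nat.card_Ioc, nsmul_eq_mul, Nat.add_sub_cancel_left]
  have hmul : (h : ℝ) * ‖∑ n ∈ Ioc 0 N, logCoeff χ k n‖
      ≤ 5 * C * (q : ℝ) ^ ε * N ^ 2 + h * ((2 + Real.log N) ^ (k + 1) * h) := by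
    rw [← Complex.norm_natCast, ← norm_mul, sum_logCoeff_mul_eq]
    refine (norm_sub_le _ _).trans ((add_le_add ((norm_sub_le _ _).trans (add_le_add e1 e2))
      e3).trans_eq ?_)
    rw [Complex.norm_natCast]
    ring
  refine le_of_mul_le_mul_left (hmul.trans_eq ?_) hh0
  field_simp

end BombieriVinogradov

namespace BombieriVinogradov

open Finset
open ArithmeticFunction (vonMangoldt)

lemma norm_twistSum_vonMangoldt_le {q : ℕ} (χ : DirichletCharacter ℂ q) (N : ℕ) :
    ‖twistSum χ vonMangoldt N‖ ≤ N * Real.log N := by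
  rw [twistSum]
  have : ∀ n ∈ Ioc 0 N, ‖((vonMangoldt n : ℝ) : ℂ) * χ n‖ ≤ Real.log N := fun n hn => by
    rw [norm_mul, Complex.norm_real, Real.norm_eq_abs]
    calc _ ≤ Real.log N * 1 := by
          gcongr
          · exact vonMangoldt_le_log_of_le (mem_Ioc.mp hn).2
          · exact χ.norm_le_one _
      _ = _ := mul_one _
  refine (norm_sum_le_of_le _ this).trans_eq ?_
  simp

lemma exists_norm_sum_logCoeff_le_mul (A : ℕ) :
    ∃ C : ℝ, 0 < C ∧ ∀ (q : ℕ) [NeZero q] (χ : DirichletCharacter ℂ q) (M N : ℕ),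
      χ.IsPrimitive → χ ≠ 1 → (q : ℝ) ≤ (2 + Real.log N) ^ A → 3 ≤ M → M ≤ N →
      ‖∑ n ∈ Ioc 0 M, logCoeff χ (2 * (A + 1)) n‖ ≤ C * N * (2 + Real.log N) ^ (A + 2) := by
  have hA : (0 : ℝ) < 1 / (2 * (A + 1)) := by positivity
  obtain ⟨C, hC, hS⟩ := exists_norm_sum_logCoeff_le (2 * (A + 1)) hA (by
    rw [div_le_div_iff_of_pos_left one_pos (by positivity) (by norm_num)]
    linarith [(Nat.cast_nonneg A : (0 : ℝ) ≤ A)])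
  obtain ⟨D, hD, hDx⟩ := exists_log_pow_le (A + 1) one_pos
  refine ⟨C + 1 + D, by linarith, fun q _ χ M N hp hχ hq hM hMN => ?_⟩
  set l := 2 + Real.log N with hl
  have hl2 : 2 ≤ l := by linarith [Real.log_natCast_nonneg N]
  have hl0 : 0 < l := by linarith
  have hM0 : (0 : ℝ) < M := by exact_mod_cast (by omega : 0 < M)
  have hN1 : (1 : ℝ) ≤ N := by exact_mod_cast (by omega : 1 ≤ N)
  have hMN' : (M : ℝ) ≤ N := by exact_mod_cast hMN
  have hlM : 2 + Real.log M ≤ l := by linarith [log_natCast_mono hMN]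
  have hlM0 : 0 ≤ Real.log M := Real.log_natCast_nonneg _
  have hqe : (q : ℝ) ^ ((1 : ℝ) / (2 * (A + 1))) ≤ l := by
    calc _ ≤ (l ^ A) ^ ((1 : ℝ) / (2 * (A + 1))) := by gcongr
      _ = l ^ (A * ((1 : ℝ) / (2 * (A + 1)))) := by
          rw [← Real.rpow_natCast l, ← Real.rpow_mul hl0.le]
      _ ≤ l ^ (1 : ℝ) := by
          apply Real.rpow_le_rpow_of_exponent_le (by linarith)
          rw [mul_one_div, div_le_one (by positivity)]
          linarith [(Nat.cast_nonneg A : (0 : ℝ) ≤ A)]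
      _ = l := Real.rpow_one l
  have hlp : (0 : ℝ) < l ^ (A + 1) := by positivity
  set h := ⌈(M : ℝ) / l ^ (A + 1)⌉₊ with hh
  have hh1 : (M : ℝ) / l ^ (A + 1) ≤ h := Nat.le_ceil _
  have hh2 : (h : ℝ) < M / l ^ (A + 1) + 1 := Nat.ceil_lt_add_one (by positivity)
  have hhpos : 1 ≤ h := Nat.one_le_iff_ne_zero.mpr (Nat.ceil_pos.mpr (by positivity)).ne'
  have hhM : h ≤ M := by
    rw [hh, Nat.ceil_le]
    exact div_le_self hM0.le (one_le_pow₀ (by linarith))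
  have hh0 : (0 : ℝ) < h := by exact_mod_cast hhpos
  have e1 : C * (q : ℝ) ^ ((1 : ℝ) / (2 * (A + 1))) * M ^ 2 / h ≤ C * N * l ^ (A + 2) := by
    rw [div_le_iff₀ hh0]
    calc C * (q : ℝ) ^ ((1 : ℝ) / (2 * (A + 1))) * M ^ 2 ≤ C * l * (N * M) := by
          rw [pow_two (M : ℝ)]; gcongr
      _ = C * N * l ^ (A + 2) * (M / l ^ (A + 1)) := by
          rw [pow_succ l (A + 1)]; field_simp
      _ ≤ _ := by gcongr
  have e2 : h * (2 + Real.log M) ^ (2 * (A + 1) + 1) ≤ (1 + D) * N * l ^ (A + 2) := by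
    calc h * (2 + Real.log M) ^ (2 * (A + 1) + 1)
        ≤ (M / l ^ (A + 1) + 1) * l ^ (2 * (A + 1) + 1) := by gcongr
      _ = M * l ^ (A + 2) + l ^ (A + 1) * l ^ (A + 2) := by
          rw [show 2 * (A + 1) + 1 = (A + 1) + (A + 2) by ring, pow_add]; field_simp; ring
      _ ≤ N * l ^ (A + 2) + (D * (N : ℝ) ^ (1 : ℝ)) * l ^ (A + 2) := by
          gcongr
          exact hDx N hN1
      _ = _ := by rw [Real.rpow_one]; ring
  have := hS q χ M h hp hχ hM hhpos hhM
  linarith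

/-- **Siegel–Walfisz** for primitive characters. -/
theorem exists_norm_twistSum_vonMangoldt_le (A : ℕ) :
    ∃ C : ℝ, 0 < C ∧ ∀ (q : ℕ) [NeZero q] (χ : DirichletCharacter ℂ q) (N : ℕ),
      χ.IsPrimitive → χ ≠ 1 → (q : ℝ) ≤ (2 + Real.log N) ^ A →
      ‖twistSum χ vonMangoldt N‖ ≤ C * N / (2 + Real.log N) ^ A := by
  obtain ⟨C, hC, hS⟩ := exists_norm_sum_logCoeff_le_mul A
  obtain ⟨D, hD, hDx⟩ := exists_log_pow_le (A + 1) (by norm_num : (0 : ℝ) < 1 / 2)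
  refine ⟨D + 2 * C * 4 ^ (2 * (A + 1)) + 5 ^ (A + 1), by positivity,
    fun q _ χ N hp hχ hq => ?_⟩
  set l := 2 + Real.log N with hl
  have hlogN := Real.log_natCast_nonneg N
  have hl2 : 2 ≤ l := by linarith
  have hl0 : 0 < l := by linarith
  rw [le_div_iff₀ (by positivity)]
  have hN0 : (0 : ℝ) ≤ N := Nat.cast_nonneg N
  have htriv : ‖twistSum χ vonMangoldt N‖ ≤ N * l :=
    (norm_twistSum_vonMangoldt_le χ N).trans (by gcongr; linarith)
  rcases lt_or_ge N 9 with hN | hN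
  · have hl5 : l ≤ 5 := by
      have h1 := log_natCast_mono (show N ≤ 9 by omega)
      have h2 : Real.log (9 : ℕ) ≤ 3 := by
        rw [Real.log_le_iff_le_exp (by norm_num)]
        have := Real.exp_one_gt_d9
        calc ((9 : ℕ) : ℝ) ≤ 2.7 ^ 3 := by norm_num
          _ ≤ (Real.exp 1) ^ 3 := by gcongr; linarith
          _ = _ := by rw [← Real.exp_nat_mul]; norm_num
      linarith
    calc _ ≤ N * l * l ^ A := by gcongr
      _ = l ^ (A + 1) * N := by ring
      _ ≤ 5 ^ (A + 1) * N := by gcongr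
      _ ≤ _ := by
          gcongr
          have : 0 ≤ 2 * C * 4 ^ (2 * (A + 1)) := by positivity
          linarith
  set M := Nat.sqrt N with hM
  have hM3 : 3 ≤ M := Nat.le_sqrt.mpr (by omega)
  have hMN : M < N := Nat.sqrt_lt_self (by omega)
  have hN1 : (1 : ℝ) ≤ N := by exact_mod_cast (by omega : 1 ≤ N)
  have hsqM : (M : ℝ) ≤ (N : ℝ) ^ (1 / 2 : ℝ) := by
    rw [← Real.sqrt_eq_rpow]; exact Real.nat_sqrt_le_real_sqrt
  have hlog2 : 2 ≤ Real.log N := by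
    rw [Real.le_log_iff_exp_le (by linarith)]
    have := Real.exp_one_lt_d9
    calc Real.exp 2 = (Real.exp 1) ^ 2 := by rw [← Real.exp_nat_mul]; norm_num
      _ ≤ 3 ^ 2 := by gcongr; linarith
      _ ≤ N := by norm_num; exact_mod_cast hN
  have hlM1 : l / 4 ≤ Real.log (M + 1 : ℕ) := by
    have h1 : Real.log N ≤ 2 * Real.log (M + 1 : ℕ) := by
      rw [← Real.log_rpow (by positivity)]
      apply Real.log_le_log (by linarith)
      have : N < (M + 1) * (M + 1) := Nat.lt_succ_sqrt N
      rw [show (2 : ℝ) = ((2 : ℕ) : ℝ) by norm_num, Real.rpow_natCast]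
      exact_mod_cast (by nlinarith : N ≤ (M + 1) ^ 2)
    linarith
  have hlogpos : ∀ n, M < n → 0 < Real.log n := fun n hn => by
    have := log_natCast_mono (show M + 1 ≤ n by omega)
    linarith
  set k := 2 * (A + 1) with hk
  set w : ℕ → ℝ := fun n => ((Real.log n) ^ k)⁻¹ with hw
  have hsplit : twistSum χ vonMangoldt N
      = twistSum χ vonMangoldt M + ∑ n ∈ Ioc M N, logCoeff χ k n * w n := by
    rw [twistSum, twistSum, ← sum_Ioc_consecutive _ (Nat.zero_le M) hMN.le]
    congr 1
    refine sum_congr rfl fun n hn => ?_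
    have h0 : ((Real.log n : ℝ) : ℂ) ≠ 0 := by
      exact_mod_cast (hlogpos n (mem_Ioc.mp hn).1).ne'
    rw [logCoeff, hw]
    push_cast
    rw [Complex.natCast_log] at h0
    field_simp
  have htail : ‖∑ n ∈ Ioc M N, logCoeff χ k n * w n‖
      ≤ (2 * (C * N * l ^ (A + 2))) * w (M + 1) := by
    refine norm_sum_mul_le_of_antitone (fun n hn => ?_) (fun n hn => ?_) hMN fun n hn hnN => ?_
    · have h1 := log_natCast_mono (Nat.le_succ n)
      have h2 := hlogpos n hn
      simp only [hw]
      gcongr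
    · have := hlogpos n hn
      simp only [hw]; positivity
    · have e : ∑ j ∈ Ioc M n, logCoeff χ k j
          = ∑ j ∈ Ioc 0 n, logCoeff χ k j - ∑ j ∈ Ioc 0 M, logCoeff χ k j := by
        rw [← sum_Ioc_consecutive _ (Nat.zero_le M) hn.le]; ring
      rw [e, two_mul]
      exact (norm_sub_le _ _).trans (add_le_add (hS q χ n N hp hχ hq (by omega) hnN)
        (hS q χ M N hp hχ hq hM3 hMN.le))
  have hwM : w (M + 1) * l ^ k ≤ 4 ^ k := by
    have hp4 : (l / 4) ^ k ≤ Real.log (M + 1 : ℕ) ^ k := by gcongr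
    have hpos : 0 < Real.log (M + 1 : ℕ) ^ k := pow_pos (hlogpos _ (by omega)) k
    simp only [hw]
    rw [inv_mul_le_iff₀ hpos]
    rw [div_pow, div_le_iff₀ (by positivity)] at hp4
    exact hp4
  have hhead : ‖twistSum χ vonMangoldt M‖ * l ^ A ≤ D * N := by
    have h1 : ‖twistSum χ vonMangoldt M‖ ≤ (N : ℝ) ^ (1 / 2 : ℝ) * l := by
      refine (norm_twistSum_vonMangoldt_le χ M).trans ?_
      gcongr
      linarith [log_natCast_mono hMN.le]
    calc _ ≤ ((N : ℝ) ^ (1 / 2 : ℝ) * l) * l ^ A := by gcongr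
      _ = (N : ℝ) ^ (1 / 2 : ℝ) * l ^ (A + 1) := by ring
      _ ≤ (N : ℝ) ^ (1 / 2 : ℝ) * (D * (N : ℝ) ^ (1 / 2 : ℝ)) := by
          gcongr
          exact hDx N hN1
      _ = D * ((N : ℝ) ^ (1 / 2 : ℝ) * (N : ℝ) ^ (1 / 2 : ℝ)) := by ring
      _ = D * N := by
          rw [← Real.rpow_add (by linarith)]; norm_num
  calc ‖twistSum χ vonMangoldt N‖ * l ^ A
      ≤ (‖twistSum χ vonMangoldt M‖ + (2 * (C * N * l ^ (A + 2))) * w (M + 1)) * l ^ A := by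
        rw [hsplit]
        gcongr
        exact (norm_add_le _ _).trans (by linarith)
    _ = ‖twistSum χ vonMangoldt M‖ * l ^ A + 2 * C * (w (M + 1) * l ^ k) * N := by
        rw [hk, show 2 * (A + 1) = (A + 2) + A by ring, pow_add]; ring
    _ ≤ D * N + 2 * C * 4 ^ k * N := by gcongr
    _ ≤ _ := by
        have : (0 : ℝ) ≤ 5 ^ (A + 1) * N := by positivity
        linarith

end BombieriVinogradov

namespace BombieriVinogradov

open Finset
open ArithmeticFunction (vonMangoldt)

lemma twistSum_one (q : ℕ) (N : ℕ) :
    twistSum (1 : DirichletCharacter ℂ q) vonMangoldt N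
      = ((∑ n ∈ Ioc 0 N, if Nat.Coprime n q then vonMangoldt n else 0 : ℝ) : ℂ) := by
  rw [twistSum]
  push_cast
  refine sum_congr rfl fun n _ => ?_
  split_ifs with h
  · rw [MulChar.one_apply ((ZMod.isUnit_iff_coprime n q).mpr h), mul_one]
  · rw [MulChar.map_nonunit _ (fun hu => h ((ZMod.isUnit_iff_coprime n q).mp hu))]
    simp

lemma abs_sum_progression_sub_le {q : ℕ} [NeZero q] {a : ℕ} (ha : a.Coprime q) (N : ℕ) :
    |(∑ n ∈ Ioc 0 N, if (n : ZMod q) = (a : ZMod q) then vonMangoldt n else 0)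
      - (∑ n ∈ Ioc 0 N, if Nat.Coprime n q then vonMangoldt n else 0) / (q.totient : ℝ)|
      ≤ (∑ χ ∈ univ.erase (1 : DirichletCharacter ℂ q), ‖twistSum χ vonMangoldt N‖)
        / (q.totient : ℝ) := by
  have hφ : (0 : ℝ) < q.totient := by exact_mod_cast Nat.totient_pos.mpr (NeZero.pos q)
  have hu : IsUnit (a : ZMod q) := (ZMod.isUnit_iff_coprime a q).mpr ha
  have horth : ∑ χ : DirichletCharacter ℂ q, χ (a : ZMod q)⁻¹ * twistSum χ vonMangoldt N
      = (q.totient : ℂ) * ((∑ n ∈ Ioc 0 N,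
        if (n : ZMod q) = (a : ZMod q) then vonMangoldt n else 0 : ℝ) : ℂ) := by
    simp only [twistSum, mul_sum]
    rw [sum_comm]
    push_cast
    rw [mul_sum]
    refine sum_congr rfl fun n _ => ?_
    have h := DirichletCharacter.sum_char_inv_mul_char_eq ℂ hu (n : ZMod q)
    calc _ = ((vonMangoldt n : ℝ) : ℂ) * ∑ χ : DirichletCharacter ℂ q,
          χ (a : ZMod q)⁻¹ * χ (n : ZMod q) := by
          rw [mul_sum]; exact sum_congr rfl fun χ _ => by ring
      _ = _ := by
          rw [h]
          simp only [eq_comm (a := (a : ZMod q))]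
          split_ifs <;> simp [mul_comm]
  rw [le_div_iff₀ hφ, ← abs_of_pos hφ, ← abs_mul, abs_of_pos hφ, sub_mul, div_mul_cancel₀ _ hφ.ne']
  rw [← sum_erase_add _ _ (mem_univ (1 : DirichletCharacter ℂ q)), twistSum_one] at horth
  have hinv : IsUnit (a : ZMod q)⁻¹ := by
    rw [← hu.unit_spec, ZMod.inv_coe_unit]; exact Units.isUnit _
  rw [MulChar.one_apply hinv, one_mul] at horth
  have e : ∑ χ ∈ univ.erase (1 : DirichletCharacter ℂ q),
      χ (a : ZMod q)⁻¹ * twistSum χ vonMangoldt N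
      = (((∑ n ∈ Ioc 0 N, if (n : ZMod q) = (a : ZMod q) then vonMangoldt n else 0) * q.totient
        - ∑ n ∈ Ioc 0 N, if Nat.Coprime n q then vonMangoldt n else 0 : ℝ) : ℂ) := by
    rw [eq_sub_of_add_eq horth, Complex.ofReal_sub, Complex.ofReal_mul, mul_comm,
      Complex.ofReal_natCast]
  rw [← Real.norm_eq_abs, ← Complex.norm_real, ← e]
  refine norm_sum_le_of_le _ fun χ _ => ?_
  rw [norm_mul]
  exact mul_le_of_le_one_left (norm_nonneg _) (χ.norm_le_one _)

lemma sum_norm_twistSum_div_totient_le (q : ℕ) [NeZero q] (N : ℕ) :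
    (∑ χ ∈ univ.erase (1 : DirichletCharacter ℂ q), ‖twistSum χ vonMangoldt N‖)
      / (q.totient : ℝ) ≤ N * Real.log N := by
  have hφ : (0 : ℝ) < q.totient := by exact_mod_cast Nat.totient_pos.mpr (NeZero.pos q)
  rw [div_le_iff₀ hφ]
  calc _ ≤ ∑ χ : DirichletCharacter ℂ q, ‖twistSum χ vonMangoldt N‖ :=
        sum_le_sum_of_subset_of_nonneg (erase_subset _ _) fun _ _ _ => norm_nonneg _
    _ ≤ ∑ _χ : DirichletCharacter ℂ q, (N * Real.log N : ℝ) :=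
        sum_le_sum fun χ _ => norm_twistSum_vonMangoldt_le χ N
    _ = _ := by
        rw [sum_const, nsmul_eq_mul, card_univ, ← Nat.card_eq_fintype_card,
          DirichletCharacter.card_eq_totient_of_hasEnoughRootsOfUnity, mul_comm]

lemma sum_vonMangoldt_multiples_le {p : ℕ} (hp : p.Prime) (N : ℕ) :
    ∑ n ∈ (Ioc 0 N).filter (p ∣ ·), vonMangoldt n ≤ Real.log N := by
  rcases Nat.eq_zero_or_pos N with rfl | hN
  · simp
  calc ∑ n ∈ (Ioc 0 N).filter (p ∣ ·), vonMangoldt n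
      ≤ ∑ n ∈ (Ioc 0 (Nat.log p N)).image (p ^ ·), vonMangoldt n := by
        rw [← sum_filter_ne_zero]
        refine sum_le_sum_of_subset_of_nonneg (fun n hn' => ?_) fun _ _ _ =>
          ArithmeticFunction.vonMangoldt_nonneg
        obtain ⟨hn, h0⟩ := mem_filter.mp hn'
        rw [mem_filter, mem_Ioc] at hn
        rw [ArithmeticFunction.vonMangoldt_ne_zero_iff] at h0
        obtain ⟨r, k, hr, hk, rfl⟩ := (isPrimePow_nat_iff _).mp h0
        have : p = r := (Nat.prime_dvd_prime_iff_eq hp hr).mp (hp.dvd_of_dvd_pow hn.2)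
        subst this
        exact mem_image.mpr ⟨k, mem_Ioc.mpr ⟨hk, Nat.le_log_of_pow_le hp.one_lt hn.1.2⟩, rfl⟩
    _ = ∑ k ∈ Ioc 0 (Nat.log p N), vonMangoldt (p ^ k) :=
        sum_image fun a _ b _ h => Nat.pow_right_injective hp.two_le h
    _ = ∑ k ∈ Ioc 0 (Nat.log p N), Real.log p := by
        refine sum_congr rfl fun k hk => ?_
        rw [ArithmeticFunction.vonMangoldt_apply_pow (by rw [mem_Ioc] at hk; omega),
          ArithmeticFunction.vonMangoldt_apply_prime hp]
    _ = Real.log ((p ^ Nat.log p N : ℕ) : ℝ) := by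
        rw [sum_const, Nat.card_Ioc, nsmul_eq_mul, Nat.cast_pow, Real.log_pow, Nat.sub_zero]
    _ ≤ _ := log_natCast_mono (Nat.pow_log_le_self p hN.ne')

lemma card_primeFactors_le {q : ℕ} (hq : q ≠ 0) : (q.primeFactors.card : ℝ) ≤ 2 * Real.log q := by
  have h1 : 2 ^ q.primeFactors.card ≤ q :=
    (pow_card_le_prod _ _ _ fun p hp => (Nat.prime_of_mem_primeFactors hp).two_le).trans
      (Nat.le_of_dvd (Nat.pos_of_ne_zero hq) (Nat.prod_primeFactors_dvd q))
  have h2 := log_natCast_mono h1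
  rw [Nat.cast_pow, Real.log_pow] at h2
  have := Real.log_two_gt_d9
  push_cast at h2
  nlinarith [(Nat.cast_nonneg _ : (0 : ℝ) ≤ q.primeFactors.card)]

lemma sum_vonMangoldt_not_coprime_le {q : ℕ} (hq : q ≠ 0) (N : ℕ) :
    ∑ n ∈ (Ioc 0 N).filter (¬ Nat.Coprime · q), vonMangoldt n ≤ 2 * Real.log q * Real.log N := by
  calc ∑ n ∈ (Ioc 0 N).filter (¬ Nat.Coprime · q), vonMangoldt n
      ≤ ∑ n ∈ Ioc 0 N, ∑ p ∈ q.primeFactors, if p ∣ n then vonMangoldt n else 0 := by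
        rw [sum_filter]
        refine sum_le_sum fun n _ => ?_
        have h0 : ∀ p ∈ q.primeFactors, 0 ≤ if p ∣ n then vonMangoldt n else 0 := fun p _ => by
          split_ifs
          exacts [ArithmeticFunction.vonMangoldt_nonneg, le_rfl]
        split_ifs with hn
        · exact sum_nonneg h0
        · obtain ⟨p, hp, h1, h2⟩ := Nat.Prime.not_coprime_iff_dvd.mp hn
          have := single_le_sum h0 (Nat.mem_primeFactors.mpr ⟨hp, h2, hq⟩)
          rwa [if_pos h1] at this
    _ = ∑ p ∈ q.primeFactors, ∑ n ∈ (Ioc 0 N).filter (p ∣ ·), vonMangoldt n := by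
        rw [sum_comm]
        exact sum_congr rfl fun p _ => (sum_filter _ _).symm
    _ ≤ ∑ p ∈ q.primeFactors, Real.log N :=
        sum_le_sum fun p hp =>
          sum_vonMangoldt_multiples_le (Nat.prime_of_mem_primeFactors hp) N
    _ ≤ _ := by
        rw [sum_const, nsmul_eq_mul]
        exact mul_le_mul_of_nonneg_right (card_primeFactors_le hq) (Real.log_natCast_nonneg _)

lemma norm_twistSum_changeLevel_le {d q : ℕ} [NeZero q] (h : d ∣ q) (ψ : DirichletCharacter ℂ d)
    (N : ℕ) :
    ‖twistSum (DirichletCharacter.changeLevel h ψ) vonMangoldt N‖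
      ≤ ‖twistSum ψ vonMangoldt N‖ + 2 * Real.log q * Real.log N := by
  have e : twistSum ψ vonMangoldt N - twistSum (DirichletCharacter.changeLevel h ψ) vonMangoldt N
      = ∑ n ∈ (Ioc 0 N).filter (¬ Nat.Coprime · q), ((vonMangoldt n : ℝ) : ℂ) * ψ n := by
    rw [twistSum, twistSum, ← sum_sub_distrib, sum_filter]
    refine sum_congr rfl fun n _ => ?_
    by_cases hn : Nat.Coprime n q
    · have hu := (ZMod.isUnit_iff_coprime n q).mpr hn
      have := DirichletCharacter.changeLevel_eq_cast_of_dvd ψ h hu.unit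
      rw [hu.unit_spec, ZMod.cast_natCast h] at this
      simp [hn, this]
    · rw [MulChar.map_nonunit _ (fun hu => hn ((ZMod.isUnit_iff_coprime n q).mp hu))]
      simp [hn]
  have e2 : ‖twistSum ψ vonMangoldt N
      - twistSum (DirichletCharacter.changeLevel h ψ) vonMangoldt N‖
      ≤ 2 * Real.log q * Real.log N := by
    rw [e]
    refine le_trans (norm_sum_le_of_le _ fun n _ => ?_)
      (sum_vonMangoldt_not_coprime_le (NeZero.ne q) N)
    rw [norm_mul, Complex.norm_real, Real.norm_of_nonneg ArithmeticFunction.vonMangoldt_nonneg]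
    exact mul_le_of_le_one_right ArithmeticFunction.vonMangoldt_nonneg (ψ.norm_le_one _)
  have := norm_le_norm_add_norm_sub (twistSum ψ vonMangoldt N)
    (twistSum (DirichletCharacter.changeLevel h ψ) vonMangoldt N)
  linarith

end BombieriVinogradov

namespace BombieriVinogradov

open Finset
open ArithmeticFunction (vonMangoldt)

lemma sum_norm_twistSum_le_sum_divisors {q : ℕ} [NeZero q] (N : ℕ) :
    ∑ χ ∈ univ.erase (1 : DirichletCharacter ℂ q), ‖twistSum χ vonMangoldt N‖
      ≤ (∑ d ∈ q.divisors.filter (2 ≤ ·), ∑ ψ ∈ primChars d, ‖twistSum ψ vonMangoldt N‖)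
        + q.totient * (2 * Real.log q * Real.log N) := by
  classical
  have hE : 0 ≤ 2 * Real.log q * Real.log N :=
    mul_nonneg (mul_nonneg zero_le_two (Real.log_natCast_nonneg _)) (Real.log_natCast_nonneg _)
  let f : DirichletCharacter ℂ q → Σ d : ℕ, DirichletCharacter ℂ d :=
    fun χ => ⟨χ.conductor, χ.primitiveCharacter⟩
  let g : (Σ d : ℕ, DirichletCharacter ℂ d) → DirichletCharacter ℂ q :=
    fun p => if h : p.1 ∣ q then DirichletCharacter.changeLevel h p.2 else 1
  have hgf : ∀ χ, g (f χ) = χ := fun χ => by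
    simp only [f, g]
    rw [dif_pos χ.conductor_dvd_level]
    exact χ.factorsThrough_conductor.eq_changeLevel.symm
  have h1 : ∀ χ : DirichletCharacter ℂ q, ‖twistSum χ vonMangoldt N‖
      ≤ ‖twistSum (f χ).2 vonMangoldt N‖ + 2 * Real.log q * Real.log N := fun χ => by
    have := norm_twistSum_changeLevel_le χ.conductor_dvd_level χ.primitiveCharacter N
    rwa [show DirichletCharacter.changeLevel χ.conductor_dvd_level χ.primitiveCharacter = χ from
      χ.factorsThrough_conductor.eq_changeLevel.symm] at this
  refine (sum_le_sum fun χ _ => h1 χ).trans ?_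
  rw [sum_add_distrib]
  refine add_le_add ?_ ?_
  · rw [sum_sigma', ← sum_image (s := univ.erase (1 : DirichletCharacter ℂ q)) (g := f)
      (f := fun p => ‖twistSum p.2 vonMangoldt N‖)
      fun a _ b _ h => by rw [← hgf a, ← hgf b]; exact congrArg g h]
    refine sum_le_sum_of_subset_of_nonneg (fun p hp => ?_) fun _ _ _ => norm_nonneg _
    obtain ⟨χ, hχ, rfl⟩ := mem_image.mp hp
    have hne : χ ≠ 1 := ne_of_mem_erase hχ
    have hc : χ.conductor ≠ 1 := fun h => hne ((χ.eq_one_iff_conductor_eq_one).mpr h)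
    have hc0 : χ.conductor ≠ 0 := fun h => NeZero.ne q (Nat.eq_zero_of_zero_dvd
      (h ▸ χ.conductor_dvd_level))
    simp only [f, mem_sigma, mem_filter, Nat.mem_divisors, mem_primChars]
    exact ⟨⟨⟨χ.conductor_dvd_level, NeZero.ne q⟩, by omega⟩, χ.primitiveCharacter_isPrimitive⟩
  · rw [sum_const, nsmul_eq_mul]
    gcongr
    refine (card_le_univ _).trans_eq ?_
    rw [← Nat.card_eq_fintype_card,
      DirichletCharacter.card_eq_totient_of_hasEnoughRootsOfUnity]

lemma le_card_divisors_mul_totient (m : ℕ) : m ≤ m.divisors.card * m.totient := by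
  calc m = ∑ d ∈ m.divisors, d.totient := (Nat.sum_totient m).symm
    _ ≤ ∑ _d ∈ m.divisors, m.totient := sum_le_sum fun d hd => by
        have h := Nat.mem_divisors.mp hd
        exact Nat.le_of_dvd (Nat.totient_pos.mpr (Nat.pos_of_ne_zero h.2))
          (Nat.totient_dvd_of_dvd h.1)
    _ = _ := by simp

lemma sum_one_div_totient_le (K : ℕ) :
    ∑ m ∈ Ioc 0 K, 1 / (m.totient : ℝ) ≤ (1 + Real.log K) ^ 2 := by
  refine le_trans (sum_le_sum fun m hm => ?_) (sum_card_divisors_div_le K)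
  have hm0 : 0 < m := (mem_Ioc.mp hm).1
  have hφ : (0 : ℝ) < m.totient := by exact_mod_cast Nat.totient_pos.mpr hm0
  rw [div_le_div_iff₀ hφ (by exact_mod_cast hm0), one_mul]
  exact_mod_cast le_card_divisors_mul_totient m

lemma sum_div_totient_sum_divisors_le {T : ℕ → ℝ} (hT : ∀ d, 0 ≤ T d) (Q : ℕ) :
    ∑ q ∈ Icc 1 Q, (∑ d ∈ q.divisors.filter (2 ≤ ·), T d) / (q.totient : ℝ)
      ≤ (1 + Real.log Q) ^ 2 * ∑ d ∈ Icc 2 Q, T d / (d.totient : ℝ) := by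
  have h1 : ∑ q ∈ Icc 1 Q, (∑ d ∈ q.divisors.filter (2 ≤ ·), T d) / (q.totient : ℝ)
      = ∑ d ∈ Icc 2 Q, ∑ q ∈ (Icc 1 Q).filter (d ∣ ·), T d / (q.totient : ℝ) := by
    simp only [sum_div]
    refine sum_comm' fun q d => ?_
    simp only [mem_Icc, mem_filter, Nat.mem_divisors]
    constructor
    · rintro ⟨⟨h1, h2⟩, ⟨h3, h4⟩, h5⟩
      exact ⟨⟨⟨h1, h2⟩, h3⟩, h5, (Nat.le_of_dvd (by omega) h3).trans h2⟩
    · rintro ⟨⟨⟨h1, h2⟩, h3⟩, h5, h6⟩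
      exact ⟨⟨h1, h2⟩, ⟨h3, by omega⟩, h5⟩
  rw [h1, mul_sum]
  refine sum_le_sum fun d hd => ?_
  have hd2 := (mem_Icc.mp hd).1
  calc ∑ q ∈ (Icc 1 Q).filter (d ∣ ·), T d / (q.totient : ℝ)
      ≤ ∑ q ∈ (Ioc 0 Q).image (d * ·), T d / (q.totient : ℝ) := by
        refine sum_le_sum_of_subset_of_nonneg (fun q hq => ?_) fun q _ _ =>
          div_nonneg (hT d) (Nat.cast_nonneg _)
        obtain ⟨h1, m, rfl⟩ := mem_filter.mp hq
        rw [mem_Icc] at h1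
        refine mem_image.mpr ⟨m, mem_Ioc.mpr ⟨Nat.pos_of_ne_zero ?_, ?_⟩, rfl⟩
        · rintro rfl; simp at h1
        · nlinarith
    _ = ∑ m ∈ Ioc 0 Q, T d / ((d * m).totient : ℝ) :=
        sum_image fun a _ b _ h => Nat.eq_of_mul_eq_mul_left (by omega) h
    _ ≤ ∑ m ∈ Ioc 0 Q, T d / (d.totient : ℝ) * (1 / (m.totient : ℝ)) := by
        refine sum_le_sum fun m hm => ?_
        have hm0 := (mem_Ioc.mp hm).1
        have hφ : (0 : ℝ) < m.totient := by exact_mod_cast Nat.totient_pos.mpr hm0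
        have hφd : (0 : ℝ) < d.totient := by exact_mod_cast Nat.totient_pos.mpr (by omega)
        rw [div_mul_div_comm, mul_one]
        refine div_le_div_of_nonneg_left (hT d) (by positivity) ?_
        exact_mod_cast Nat.totient_super_multiplicative d m
    _ ≤ T d / (d.totient : ℝ) * (1 + Real.log Q) ^ 2 := by
        rw [← mul_sum]
        exact mul_le_mul_of_nonneg_left (sum_one_div_totient_le Q)
          (div_nonneg (hT d) (Nat.cast_nonneg _))
    _ = _ := mul_comm _ _

lemma sum_div_le_of_sum_le {t : ℕ → ℝ} (ht : ∀ d, 0 ≤ t d) {R Q : ℕ} (hRQ : R < Q) :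
    ∑ d ∈ Ioc R Q, t d / d
      ≤ (∑ d ∈ Ioc R Q, t d) / Q + ∑ m ∈ Ioo R Q, (∑ d ∈ Ioc R m, t d) / m ^ 2 := by
  induction Q, (show R + 1 ≤ Q from hRQ) using Nat.le_induction with
  | base =>
    simpa using sum_nonneg fun m (_ : m ∈ Ioo R (R + 1)) =>
      div_nonneg (sum_nonneg fun d (_ : d ∈ Ioc R m) => ht d) (sq_nonneg (m : ℝ))
  | succ Q hQ ih =>
    have hQ0 : (0 : ℝ) < Q := by exact_mod_cast (by omega : 0 < Q)
    have hIoo : Ioo R (Q + 1) = Ioc R Q := by ext; simp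
    have hIoc : Ioc R Q = insert Q (Ioo R Q) := by
      ext x; simp only [mem_Ioc, mem_insert, mem_Ioo]; omega
    rw [sum_Ioc_succ_top (by omega), sum_Ioc_succ_top (by omega), hIoo]
    nth_rewrite 3 [hIoc]
    rw [sum_insert (by simp)]
    have hP : 0 ≤ ∑ d ∈ Ioc R Q, t d := sum_nonneg fun d _ => ht d
    have key : (∑ d ∈ Ioc R Q, t d) / Q
        ≤ (∑ d ∈ Ioc R Q, t d) / (Q + 1) + (∑ d ∈ Ioc R Q, t d) / Q ^ 2 := by
      have : 1 / (Q : ℝ) ≤ 1 / (Q + 1) + 1 / Q ^ 2 := by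
        rw [div_add_div _ _ (by positivity) (by positivity), div_le_div_iff₀ (by positivity)
          (by positivity)]
        nlinarith
      calc _ = (∑ d ∈ Ioc R Q, t d) * (1 / (Q : ℝ)) := by ring
        _ ≤ (∑ d ∈ Ioc R Q, t d) * (1 / (Q + 1) + 1 / Q ^ 2) := by gcongr
        _ = _ := by ring
    have := ih (by omega)
    push_cast
    rw [add_div]
    linarith

end BombieriVinogradov

namespace BombieriVinogradov

open Finset
open ArithmeticFunction (vonMangoldt)

lemma sum_primChars_div_totient_le_of_large {N R Q U : ℕ} {r : ℝ} (hU : 1 ≤ U) (hUN : U ≤ N)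
    (hR : 1 ≤ R) (hRQ : R < Q) (hQN : Q ≤ N) (hr : 0 < r) (hrR : ∀ m : ℕ, R < m → r ≤ m) :
    ∑ d ∈ Ioc R Q, (∑ ψ ∈ primChars d, ‖twistSum ψ vonMangoldt N‖) / (d.totient : ℝ)
      ≤ 48 * (2 + Real.log N) ^ 6 * ((N / r + N / √U) * (2 + Real.log N) + Q * √N
        + Q * √Q * U ^ 2) := by
  set l := 2 + Real.log N with hl
  have hl0 : 0 < l := by linarith [Real.log_natCast_nonneg N]
  have hU0 : (0 : ℝ) < √U := Real.sqrt_pos.mpr (by exact_mod_cast hU)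
  have hQ0 : (0 : ℝ) < Q := by exact_mod_cast (by omega : 0 < Q)
  set t : ℕ → ℝ := fun d => (d / d.totient : ℝ) * ∑ ψ ∈ primChars d, ‖twistSum ψ vonMangoldt N‖
    with ht
  have ht0 : ∀ d, 0 ≤ t d := fun d => by simp only [ht]; positivity
  have hP : ∀ m, R < m → m ≤ Q → ∑ d ∈ Ioc R m, t d
      ≤ 24 * l ^ 6 * (m * (N / r + N / √U) + m ^ 2 * (√N + √Q * U ^ 2)) := by
    intro m hm hmQ
    have hm0 : (0 : ℝ) < m := by exact_mod_cast (by omega : 0 < m)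
    have hmQ' : (m : ℝ) ≤ Q := by exact_mod_cast hmQ
    have h1 : (N : ℝ) ≤ m * (N / r) := by
      rw [← mul_div_assoc, le_div_iff₀ hr, mul_comm]
      have := hrR m hm
      gcongr
    calc ∑ d ∈ Ioc R m, t d ≤ ∑ d ∈ Icc 2 m, t d :=
          sum_le_sum_of_subset_of_nonneg (fun d hd => by
            simp only [mem_Ioc, mem_Icc] at hd ⊢; omega) fun d _ _ => ht0 d
      _ ≤ 24 * l ^ 6 * (N + m * N / √U + m ^ 2 * √N + m ^ 2 * √m * U ^ 2) :=
          sum_primChars_vonMangoldt_le hU hUN (by omega) (hmQ.trans hQN)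
      _ ≤ 24 * l ^ 6 * (m * (N / r) + m * N / √U + m ^ 2 * √N + m ^ 2 * √Q * U ^ 2) := by
          gcongr
      _ = _ := by ring
  have hsum : ∑ d ∈ Ioc R Q, (∑ ψ ∈ primChars d, ‖twistSum ψ vonMangoldt N‖) / (d.totient : ℝ)
      = ∑ d ∈ Ioc R Q, t d / d := by
    refine sum_congr rfl fun d hd => ?_
    have hd0 : (d : ℝ) ≠ 0 := by
      rw [mem_Ioc] at hd; exact_mod_cast (by omega : d ≠ 0)
    simp only [ht]
    field_simp
  have e1 : (∑ d ∈ Ioc R Q, t d) / Q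
      ≤ 24 * l ^ 6 * ((N / r + N / √U) + Q * (√N + √Q * U ^ 2)) := by
    rw [div_le_iff₀ hQ0]
    refine (hP Q hRQ le_rfl).trans_eq ?_
    ring
  have e2 : ∑ m ∈ Ioo R Q, (∑ d ∈ Ioc R m, t d) / m ^ 2
      ≤ 24 * l ^ 6 * ((N / r + N / √U) * (1 + Real.log Q) + Q * (√N + √Q * U ^ 2)) := by
    calc ∑ m ∈ Ioo R Q, (∑ d ∈ Ioc R m, t d) / m ^ 2
        ≤ ∑ m ∈ Ioo R Q, 24 * l ^ 6 * ((N / r + N / √U) * (1 / m) + (√N + √Q * U ^ 2)) := by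
          refine sum_le_sum fun m hm => ?_
          rw [mem_Ioo] at hm
          have hm0 : (0 : ℝ) < m := by exact_mod_cast (by omega : 0 < m)
          rw [div_le_iff₀ (by positivity)]
          refine (hP m hm.1 hm.2.le).trans_eq ?_
          field_simp
      _ ≤ ∑ m ∈ Ioc 0 Q, 24 * l ^ 6 * ((N / r + N / √U) * (1 / m) + (√N + √Q * U ^ 2)) :=
          sum_le_sum_of_subset_of_nonneg (fun d hd => by
            simp only [mem_Ioo, mem_Ioc] at hd ⊢; omega) fun d _ _ => by positivity
      _ = 24 * l ^ 6 * ((N / r + N / √U) * ∑ m ∈ Ioc 0 Q, 1 / (m : ℝ)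
          + Q * (√N + √Q * U ^ 2)) := by
          rw [← mul_sum, sum_add_distrib, ← mul_sum, sum_const, Nat.card_Ioc, nsmul_eq_mul,
            Nat.sub_zero]
      _ ≤ _ := by
          gcongr
          exact harmonic_Ioc_le Q
  rw [hsum]
  have hlQ : 2 + Real.log Q ≤ l := by linarith [log_natCast_mono hQN]
  have hfin : (N / r + N / √U) * (2 + Real.log Q) ≤ 2 * ((N / r + N / √U) * l) := by
    have h0 : 0 ≤ N / r + N / √U := by positivity
    nlinarith [mul_le_mul_of_nonneg_left hlQ h0, mul_nonneg h0 hl0.le]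
  have h3 := (sum_div_le_of_sum_le ht0 hRQ).trans (add_le_add e1 e2)
  have h4 := mul_le_mul_of_nonneg_left hfin (show 0 ≤ 24 * l ^ 6 by positivity)
  nlinarith

end BombieriVinogradov

namespace BombieriVinogradov

open Finset
open ArithmeticFunction (vonMangoldt)

lemma exists_sum_primChars_div_totient_le_of_small (A : ℕ) :
    ∃ C : ℝ, 0 < C ∧ ∀ N R : ℕ, (R : ℝ) ≤ (2 + Real.log N) ^ A →
      ∑ d ∈ Icc 2 R, (∑ ψ ∈ primChars d, ‖twistSum ψ vonMangoldt N‖) / (d.totient : ℝ)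
        ≤ C * N / (2 + Real.log N) ^ A := by
  obtain ⟨C, hC, hS⟩ := exists_norm_twistSum_vonMangoldt_le (2 * A)
  refine ⟨C, hC, fun N R hR => ?_⟩
  set l := 2 + Real.log N with hl
  have hl1 : 1 ≤ l := by linarith [Real.log_natCast_nonneg N]
  have hl0 : 0 < l := by linarith
  have hd : ∀ d ∈ Icc 2 R, (∑ ψ ∈ primChars d, ‖twistSum ψ vonMangoldt N‖) / (d.totient : ℝ)
      ≤ C * N / l ^ (2 * A) := fun d hd => by
    rw [mem_Icc] at hd
    have hne : NeZero d := ⟨by omega⟩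
    have hφ : (0 : ℝ) < d.totient := by exact_mod_cast Nat.totient_pos.mpr (by omega)
    rw [div_le_iff₀ hφ]
    have hdl : (d : ℝ) ≤ l ^ (2 * A) :=
      calc (d : ℝ) ≤ R := by exact_mod_cast hd.2
        _ ≤ l ^ A := hR
        _ ≤ l ^ (2 * A) := pow_le_pow_right₀ hl1 (by omega)
    calc _ ≤ ∑ _ψ ∈ primChars d, C * N / l ^ (2 * A) := sum_le_sum fun ψ hψ =>
          hS d ψ N (mem_primChars.mp hψ) (ne_one_of_mem_primChars (by omega) hψ) hdl
      _ = (primChars d).card * (C * N / l ^ (2 * A)) := by rw [sum_const, nsmul_eq_mul]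
      _ ≤ d.totient * (C * N / l ^ (2 * A)) := by
          gcongr
          exact card_primChars_le (by omega)
      _ = _ := mul_comm _ _
  calc _ ≤ ∑ _d ∈ Icc 2 R, C * N / l ^ (2 * A) := sum_le_sum hd
    _ = ((Icc 2 R).card : ℝ) * (C * N / l ^ (2 * A)) := by rw [sum_const, nsmul_eq_mul]
    _ ≤ l ^ A * (C * N / l ^ (2 * A)) := by
        gcongr
        refine le_trans ?_ hR
        exact_mod_cast (by simp : (Icc 2 R).card ≤ R)
    _ = _ := by rw [two_mul, pow_add]; field_simp

lemma exists_sum_primChars_div_totient_le (K : ℕ) {D : ℝ} (hD : 0 < D) :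
    ∃ C : ℝ, 0 < C ∧ ∀ N Q : ℕ, 1 ≤ N → Q ≤ N → Q * (2 + Real.log N) ^ (K + 9) ≤ D * √N →
      (∑ d ∈ Icc 2 Q, (∑ ψ ∈ primChars d, ‖twistSum ψ vonMangoldt N‖) / (d.totient : ℝ))
        * (2 + Real.log N) ^ (K + 2) ≤ C * N := by
  obtain ⟨C, hC, hS⟩ := exists_sum_primChars_div_totient_le_of_small (K + 9)
  obtain ⟨E, hE, hEx⟩ := exists_log_pow_le (K + 9) (by norm_num : (0 : ℝ) < 1 / 36)
  refine ⟨C + 48 * (1 + E + D + 4 * (D * √D) * E), by positivity, fun N Q hN hQN hQ => ?_⟩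
  set l := 2 + Real.log N with hl
  have hl1 : 1 ≤ l := by linarith [Real.log_natCast_nonneg N]
  have hl0 : 0 < l := by linarith
  have hN1 : (1 : ℝ) ≤ N := by exact_mod_cast hN
  have hN0 : (0 : ℝ) < N := by linarith
  have hlE := hEx N hN1
  rw [← hl] at hlE
  have hlE' : l ^ (K + 8) ≤ E * (N : ℝ) ^ (1 / 36 : ℝ) :=
    (pow_le_pow_right₀ hl1 (by omega)).trans hlE
  set F : ℕ → ℝ := fun d =>
    (∑ ψ ∈ primChars d, ‖twistSum ψ vonMangoldt N‖) / (d.totient : ℝ) with hF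
  have hF0 : ∀ d, 0 ≤ F d := fun d => by simp only [hF]; positivity
  set R := ⌊l ^ (K + 9)⌋₊ with hR
  have hRl : (R : ℝ) ≤ l ^ (K + 9) := Nat.floor_le (by positivity)
  have hR1 : 1 ≤ R := Nat.le_floor (by simpa using one_le_pow₀ hl1)
  have hsmall : (∑ d ∈ Icc 2 R, F d) * l ^ (K + 2) ≤ C * N := by
    calc _ ≤ C * N / l ^ (K + 9) * l ^ (K + 9) := by
          refine mul_le_mul (hS N R hRl) (pow_le_pow_right₀ hl1 (by omega)) (by positivity)
            (by positivity)
      _ = C * N := by field_simp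
  have hlarge : (∑ d ∈ Ioc R Q, F d) * l ^ (K + 2)
      ≤ 48 * (1 + E + D + 4 * (D * √D) * E) * N := by
    rcases le_or_gt Q R with h | hRQ
    · rw [Ioc_eq_empty_of_le h]; simp; positivity
    set U := ⌈(N : ℝ) ^ (1 / 9 : ℝ)⌉₊ with hU
    have hUl : (N : ℝ) ^ (1 / 9 : ℝ) ≤ U := Nat.le_ceil _
    have hN9 : 1 ≤ (N : ℝ) ^ (1 / 9 : ℝ) := Real.one_le_rpow hN1 (by norm_num)
    have hU1 : 1 ≤ U := by exact_mod_cast hN9.trans hUl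
    have hUN : U ≤ N := Nat.ceil_le.mpr (by
      calc (N : ℝ) ^ (1 / 9 : ℝ) ≤ (N : ℝ) ^ (1 : ℝ) :=
            Real.rpow_le_rpow_of_exponent_le hN1 (by norm_num)
        _ = N := Real.rpow_one _)
    have hU2 : (U : ℝ) ^ 2 ≤ 4 * (N : ℝ) ^ (2 / 9 : ℝ) := by
      have h1 : (U : ℝ) ≤ 2 * (N : ℝ) ^ (1 / 9 : ℝ) := by
        linarith [Nat.ceil_lt_add_one (show 0 ≤ (N : ℝ) ^ (1 / 9 : ℝ) by positivity)]
      calc (U : ℝ) ^ 2 ≤ (2 * (N : ℝ) ^ (1 / 9 : ℝ)) ^ 2 := by gcongr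
        _ = 4 * (N : ℝ) ^ (2 / 9 : ℝ) := by
            rw [mul_pow, ← Real.rpow_natCast ((N : ℝ) ^ (1 / 9 : ℝ)), ← Real.rpow_mul hN0.le]
            norm_num
    have hsqU : (N : ℝ) ^ (1 / 18 : ℝ) ≤ √U := by
      apply Real.le_sqrt_of_sq_le
      rw [← Real.rpow_natCast, ← Real.rpow_mul hN0.le]
      refine le_trans (le_of_eq ?_) hUl
      norm_num
    have hb := sum_primChars_div_totient_le_of_large (r := l ^ (K + 9)) hU1 hUN hR1 hRQ hQN
      (by positivity) fun m hm => (Nat.lt_of_floor_lt hm).le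
    rw [← hl] at hb
    have hQD : (Q : ℝ) ≤ D * √N :=
      (le_mul_of_one_le_right (Nat.cast_nonneg _) (one_le_pow₀ hl1)).trans hQ
    have t1 : N / l ^ (K + 9) * l ^ (K + 9) = (N : ℝ) := by field_simp
    have t2 : N / √U * l ^ (K + 9) ≤ E * N := by
      calc _ ≤ N / (N : ℝ) ^ (1 / 18 : ℝ) * (E * (N : ℝ) ^ (1 / 36 : ℝ)) := by gcongr
        _ ≤ N / (N : ℝ) ^ (1 / 18 : ℝ) * (E * (N : ℝ) ^ (1 / 18 : ℝ)) := by
            gcongr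
            norm_num
        _ = E * N := by field_simp
    have t3 : Q * √N * l ^ (K + 8) ≤ D * N := by
      calc _ = Q * l ^ (K + 8) * √N := by ring
        _ ≤ Q * l ^ (K + 9) * √N := by
            gcongr
            norm_num
        _ ≤ D * √N * √N := by gcongr
        _ = D * N := by rw [mul_assoc, Real.mul_self_sqrt hN0.le]
    have t4 : Q * √Q * U ^ 2 * l ^ (K + 8) ≤ 4 * (D * √D) * E * N := by
      have hs : √(Q : ℝ) ≤ √D * (N : ℝ) ^ (1 / 4 : ℝ) := by
        refine (Real.sqrt_le_sqrt hQD).trans_eq ?_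
        rw [Real.sqrt_mul hD.le, Real.sqrt_eq_rpow (√(N : ℝ)), Real.sqrt_eq_rpow (N : ℝ),
          ← Real.rpow_mul hN0.le]
        norm_num
      calc _ ≤ (D * √N) * (√D * (N : ℝ) ^ (1 / 4 : ℝ)) * (4 * (N : ℝ) ^ (2 / 9 : ℝ))
            * (E * (N : ℝ) ^ (1 / 36 : ℝ)) := by gcongr
        _ = 4 * (D * √D) * E * ((N : ℝ) ^ (1 / 2 : ℝ) * (N : ℝ) ^ (1 / 4 : ℝ)
            * (N : ℝ) ^ (2 / 9 : ℝ) * (N : ℝ) ^ (1 / 36 : ℝ)) := by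
            rw [← Real.sqrt_eq_rpow]; ring
        _ = 4 * (D * √D) * E * N := by
            rw [← Real.rpow_add hN0, ← Real.rpow_add hN0, ← Real.rpow_add hN0]
            norm_num
    calc (∑ d ∈ Ioc R Q, F d) * l ^ (K + 2)
        ≤ (48 * l ^ 6 * ((N / l ^ (K + 9) + N / √U) * l + Q * √N + Q * √Q * U ^ 2))
          * l ^ (K + 2) := by gcongr
      _ = 48 * (N / l ^ (K + 9) * l ^ (K + 9) + N / √U * l ^ (K + 9) + Q * √N * l ^ (K + 8)
          + Q * √Q * U ^ 2 * l ^ (K + 8)) := by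
          ring
      _ ≤ 48 * (N + E * N + D * N + 4 * (D * √D) * E * N) := by
          rw [t1]; gcongr
      _ = _ := by ring
  have hsub : ∑ d ∈ Icc 2 Q, F d ≤ ∑ d ∈ Icc 2 R, F d + ∑ d ∈ Ioc R Q, F d := by
    rw [← sum_union (disjoint_left.mpr fun d h1 h2 => by
      rw [mem_Icc] at h1; rw [mem_Ioc] at h2; omega)]
    exact sum_le_sum_of_subset_of_nonneg (fun d hd => by
      simp only [mem_union, mem_Icc, mem_Ioc] at hd ⊢; omega) fun d _ _ => hF0 d
  calc _ ≤ (∑ d ∈ Icc 2 R, F d + ∑ d ∈ Ioc R Q, F d) * l ^ (K + 2) := by gcongr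
    _ = (∑ d ∈ Icc 2 R, F d) * l ^ (K + 2) + (∑ d ∈ Ioc R Q, F d) * l ^ (K + 2) := by ring
    _ ≤ C * N + 48 * (1 + E + D + 4 * (D * √D) * E) * N := add_le_add hsmall hlarge
    _ = _ := by ring

end BombieriVinogradov

namespace BombieriVinogradov

open Finset
open ArithmeticFunction (vonMangoldt)

/-- The largest discrepancy of `ψ(N; q, a)` over the reduced residues `a` modulo `q`. -/
noncomputable def maxDiscrepancy (N q : ℕ) : ℝ :=
  ⨆ a : {a : ℕ // a < q ∧ Nat.Coprime a q},
    |(∑ n ∈ Ioc 0 N, if (n : ZMod q) = ((a : ℕ) : ZMod q) then vonMangoldt n else 0)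
      - (∑ n ∈ Ioc 0 N, if Nat.Coprime n q then vonMangoldt n else 0) / (q.totient : ℝ)|

lemma maxDiscrepancy_le_mul_log {q : ℕ} (hq : 0 < q) (N : ℕ) :
    maxDiscrepancy N q ≤ N * Real.log N := by
  have : NeZero q := ⟨hq.ne'⟩
  refine Real.iSup_le (fun a => (abs_sum_progression_sub_le a.2.2 N).trans
    (sum_norm_twistSum_div_totient_le q N)) ?_
  exact mul_nonneg (Nat.cast_nonneg _) (Real.log_natCast_nonneg _)

lemma maxDiscrepancy_le {q : ℕ} (hq : 0 < q) (N : ℕ) :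
    maxDiscrepancy N q
      ≤ (∑ d ∈ q.divisors.filter (2 ≤ ·), ∑ ψ ∈ primChars d, ‖twistSum ψ vonMangoldt N‖)
          / (q.totient : ℝ) + 2 * Real.log q * Real.log N := by
  have : NeZero q := ⟨hq.ne'⟩
  have hφ : (0 : ℝ) < q.totient := by exact_mod_cast Nat.totient_pos.mpr hq
  have hE : 0 ≤ 2 * Real.log q * Real.log N :=
    mul_nonneg (mul_nonneg zero_le_two (Real.log_natCast_nonneg _)) (Real.log_natCast_nonneg _)
  refine Real.iSup_le (fun a => (abs_sum_progression_sub_le a.2.2 N).trans ?_) (by positivity)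
  rw [div_add' _ _ _ hφ.ne']
  gcongr
  refine (sum_norm_twistSum_le_sum_divisors N).trans_eq ?_
  ring

lemma exists_sum_maxDiscrepancy_le_of_le (K : ℕ) {D : ℝ} (hD : 0 < D) :
    ∃ C : ℝ, 0 < C ∧ ∀ N Q : ℕ, 1 ≤ N → Q ≤ N → Q * (2 + Real.log N) ^ (K + 9) ≤ D * √N →
      (∑ q ∈ Icc 1 Q, maxDiscrepancy N q) * (2 + Real.log N) ^ K ≤ C * N := by
  obtain ⟨C, hC, hS⟩ := exists_sum_primChars_div_totient_le K hD
  refine ⟨C + 2 * D, by positivity, fun N Q hN hQN hQ => ?_⟩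
  have h := hS N Q hN hQN hQ
  set l := 2 + Real.log N with hl
  have hlogN := Real.log_natCast_nonneg N
  have hl1 : 1 ≤ l := by linarith
  have hl0 : 0 < l := by linarith
  have hN1 : (1 : ℝ) ≤ N := by exact_mod_cast hN
  have hlQ : Real.log Q ≤ Real.log N := log_natCast_mono hQN
  have hlQ0 := Real.log_natCast_nonneg Q
  have h1 : ∑ q ∈ Icc 1 Q, maxDiscrepancy N q
      ≤ l ^ 2 * (∑ d ∈ Icc 2 Q,
        (∑ ψ ∈ primChars d, ‖twistSum ψ vonMangoldt N‖) / (d.totient : ℝ)) + Q * (2 * l ^ 2) := by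
    calc _ ≤ ∑ q ∈ Icc 1 Q, ((∑ d ∈ q.divisors.filter (2 ≤ ·),
          ∑ ψ ∈ primChars d, ‖twistSum ψ vonMangoldt N‖) / (q.totient : ℝ) + 2 * l ^ 2) := by
          refine sum_le_sum fun q hq => (maxDiscrepancy_le (mem_Icc.mp hq).1 N).trans ?_
          have hlq := log_natCast_mono (mem_Icc.mp hq).2
          have hlq0 := Real.log_natCast_nonneg q
          refine add_le_add le_rfl ?_
          calc 2 * Real.log q * Real.log N ≤ 2 * l * l := by gcongr <;> linarith
            _ = _ := by ring
      _ ≤ _ := by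
          rw [sum_add_distrib, sum_const, Nat.card_Icc, nsmul_eq_mul, Nat.add_sub_cancel]
          gcongr
          refine (sum_div_totient_sum_divisors_le (fun d => sum_nonneg fun _ _ => norm_nonneg _)
            Q).trans ?_
          gcongr
          linarith
  have h2 : Q * (2 * l ^ 2) * l ^ K ≤ 2 * D * N := by
    calc Q * (2 * l ^ 2) * l ^ K = 2 * (Q * l ^ (K + 2)) := by ring
      _ ≤ 2 * (Q * l ^ (K + 9)) := by
          gcongr
          norm_num
      _ ≤ 2 * (D * √N) := by gcongr
      _ ≤ 2 * (D * N) := by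
          gcongr
          rw [Real.sqrt_le_left (by linarith)]
          nlinarith
      _ = _ := by ring
  calc _ ≤ (l ^ 2 * (∑ d ∈ Icc 2 Q,
        (∑ ψ ∈ primChars d, ‖twistSum ψ vonMangoldt N‖) / (d.totient : ℝ)) + Q * (2 * l ^ 2))
        * l ^ K := by gcongr
    _ = (∑ d ∈ Icc 2 Q, (∑ ψ ∈ primChars d, ‖twistSum ψ vonMangoldt N‖) / (d.totient : ℝ))
        * l ^ (K + 2) + Q * (2 * l ^ 2) * l ^ K := by ring
    _ ≤ C * N + 2 * D * N := add_le_add h h2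
    _ = _ := by ring

theorem exists_sum_maxDiscrepancy_le (K : ℕ) {D : ℝ} (hD : 0 < D) :
    ∃ C : ℝ, 0 < C ∧ ∀ N Q : ℕ, 1 ≤ N → Q * (2 + Real.log N) ^ (K + 9) ≤ D * √N →
      (∑ q ∈ Icc 1 Q, maxDiscrepancy N q) * (2 + Real.log N) ^ K ≤ C * N := by
  obtain ⟨C, hC, hS⟩ := exists_sum_maxDiscrepancy_le_of_le K hD
  refine ⟨C + D ^ 2 * (2 + D ^ 2) ^ (K + 1), by positivity, fun N Q hN hQ => ?_⟩
  have hN1 : (1 : ℝ) ≤ N := by exact_mod_cast hN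
  have hlogN := Real.log_natCast_nonneg N
  rcases le_or_gt Q N with hQN | hQN
  · refine (hS N Q hN hQN hQ).trans ?_
    gcongr
    exact le_add_of_nonneg_right (by positivity)
  set l := 2 + Real.log N with hl
  have hl1 : 1 ≤ l := by linarith
  have hl0 : 0 < l := by linarith
  have hs0 : 0 < √(N : ℝ) := Real.sqrt_pos.mpr (by linarith)
  have hss : √(N : ℝ) * √N = N := Real.mul_self_sqrt (by linarith)
  have hQD : (Q : ℝ) ≤ D * √N :=
    (le_mul_of_one_le_right (Nat.cast_nonneg _) (one_le_pow₀ hl1)).trans hQ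
  have hsD : √(N : ℝ) ≤ D := by
    have : (N : ℝ) < Q := by exact_mod_cast hQN
    nlinarith
  have hQD2 : (Q : ℝ) ≤ D ^ 2 := by nlinarith
  have hlD : l ≤ 2 + D ^ 2 := by
    have := Real.log_le_self (show (0 : ℝ) ≤ N by linarith)
    nlinarith
  calc (∑ q ∈ Icc 1 Q, maxDiscrepancy N q) * l ^ K
      ≤ (∑ _q ∈ Icc 1 Q, N * l) * l ^ K := by
        gcongr with q hq
        refine (maxDiscrepancy_le_mul_log (mem_Icc.mp hq).1 N).trans ?_
        gcongr
        linarith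
    _ = Q * l ^ (K + 1) * N := by
        rw [sum_const, Nat.card_Icc, nsmul_eq_mul, Nat.add_sub_cancel]; ring
    _ ≤ D ^ 2 * (2 + D ^ 2) ^ (K + 1) * N := by gcongr
    _ ≤ _ := by
        gcongr
        exact le_add_of_nonneg_left hC.le

theorem exists_sum_maxDiscrepancy_floor_le {A : ℝ} (hA : 0 < A) :
    ∃ B C : ℝ, ∀ X : ℝ, 2 ≤ X →
      ∑ q ∈ Icc 1 ⌊√X * Real.log X ^ (-B)⌋₊, maxDiscrepancy ⌊X⌋₊ q
        ≤ C * X * Real.log X ^ (-A) := by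
  set K := ⌈A⌉₊ with hK
  obtain ⟨C, hC, hS⟩ := exists_sum_maxDiscrepancy_le K (by positivity : (0 : ℝ) < 2 * 4 ^ (K + 9))
  refine ⟨((K + 9 : ℕ) : ℝ), C, fun X hX => ?_⟩
  set N := ⌊X⌋₊ with hN
  set Q := ⌊√X * Real.log X ^ (-((K + 9 : ℕ) : ℝ))⌋₊ with hQ
  have hNX : (N : ℝ) ≤ X := Nat.floor_le (by linarith)
  have hXN : X < N + 1 := Nat.lt_floor_add_one X
  have hN1 : 1 ≤ N := Nat.le_floor (by norm_num; linarith)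
  have hN1' : (1 : ℝ) ≤ N := by exact_mod_cast hN1
  have hL : 2 / 3 ≤ Real.log X := by
    have := Real.log_two_gt_d9
    linarith [Real.log_le_log two_pos hX]
  have hL0 : 0 < Real.log X := by linarith
  set l := 2 + Real.log N with hl
  have hl1 : 1 ≤ l := by linarith [Real.log_natCast_nonneg N]
  have hl4 : l ≤ 4 * Real.log X := by
    have := Real.log_le_log (by linarith) hNX
    linarith
  have hLl : Real.log X ≤ l := by
    have h1 : Real.log X ≤ Real.log (2 * N) := Real.log_le_log (by linarith) (by linarith)
    rw [Real.log_mul two_ne_zero (by linarith)] at h1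
    linarith [Real.log_two_lt_d9]
  have hcond : Q * l ^ (K + 9) ≤ 2 * 4 ^ (K + 9) * √N := by
    have h1 : (Q : ℝ) ≤ √X / Real.log X ^ (K + 9) := by
      refine (Nat.floor_le (by positivity)).trans_eq ?_
      rw [Real.rpow_neg hL0.le, Real.rpow_natCast, ← div_eq_mul_inv]
    have h2 : √X ≤ 2 * √N := by
      rw [Real.sqrt_le_left (by positivity), mul_pow, Real.sq_sqrt (by linarith)]
      linarith
    calc Q * l ^ (K + 9) ≤ √X / Real.log X ^ (K + 9) * (4 * Real.log X) ^ (K + 9) := by gcongr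
      _ = 4 ^ (K + 9) * √X := by rw [mul_pow]; field_simp
      _ ≤ 4 ^ (K + 9) * (2 * √N) := by gcongr
      _ = _ := by ring
  have hmain := hS N Q hN1 hcond
  have hlA : Real.log X ^ A ≤ l ^ K := by
    calc Real.log X ^ A ≤ l ^ A := by gcongr
      _ ≤ l ^ (K : ℝ) := Real.rpow_le_rpow_of_exponent_le hl1 (Nat.le_ceil A)
      _ = l ^ K := Real.rpow_natCast _ _
  rw [Real.rpow_neg hL0.le, ← div_eq_mul_inv]
  calc ∑ q ∈ Icc 1 Q, maxDiscrepancy N q ≤ C * N / l ^ K := by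
        rwa [le_div_iff₀ (by positivity)]
    _ ≤ C * X / Real.log X ^ A := by gcongr

end BombieriVinogradov

/-- The Bombieri–Vinogradov theorem: for every `A > 0` there exist `B = B(A)` and
`C = C(A)` such that for every `X ≥ 2`,
`∑_{q ≤ X^{1/2} (log X)^{-B}} max_{(a,q)=1} |ψ(X;q,a) − ψ(X;q)/φ(q)| ≤ C X (log X)^{-A}`,
where `ψ(X;q,a) = ∑_{n ≤ X, n ≡ a (q)} Λ(n)` and `ψ(X;q) = ∑_{n ≤ X, (n,q)=1} Λ(n)`. -/
theorem stmt_10 (A : ℝ) (hA : 0 < A) :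
    ∃ B C : ℝ, ∀ X : ℝ, 2 ≤ X →
      ∑ q ∈ Finset.Icc 1 (Nat.floor (Real.sqrt X * Real.log X ^ (-B))),
        ⨆ a : {a : ℕ // a < q ∧ Nat.Coprime a q},
          |(∑ n ∈ Finset.Icc 1 (Nat.floor X),
                if (n : ZMod q) = ((a : ℕ) : ZMod q) then ArithmeticFunction.vonMangoldt n else 0)
              - (∑ n ∈ Finset.Icc 1 (Nat.floor X),
                  if Nat.Coprime n q then ArithmeticFunction.vonMangoldt n else 0)
                / (Nat.totient q : ℝ)|
        ≤ C * X * Real.log X ^ (-A) := by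
  exact BombieriVinogradov.exists_sum_maxDiscrepancy_floor_le hA
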